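/- Let d ≥ 0 be an integer, X ≥ 0, and let μ satisfy: if d ∈ {0,1}, then μ₁+μ₂+μ₃ = 0, |Re(μ_i)| ≤ X for all i, and μ_i−μ_j ∉ ℤ for i ≠ j; if d ≥ 2, then μ = μ^d(r) with |Re(2r)| ≤ X and cos(π(d/2+3r)) ≠ 0. Then for all integers j₁,j₂ ≥ 0 and every ε > 0, for all y = (y₁,y₂) with y₁y₂ ≠ 0: |(y₁y₂)^{−1} (y₁∂_{y₁})^{j₁} (y₂∂_{y₂})^{j₂} K^d_{w_l}(y,μ)| ≤ C(μ,j₁,j₂,ε)·(|y₁|^{−X−ε}+|y₁|^{α₁+ε})(|y₂|^{−X−ε}+|y₂|^{α₂+ε}), where α₁ = (2/3)j₁+(1/3)j₂+(1/6)max(0, 3X−j₁−j₂) and α₂ = (1/3)j₁+(2/3)j₂+(1/6)max(0, 3X−j₁−j₂). -/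

import Mathlib

open MeasureTheory
/-- The GL(3) long-element power-series Bessel function `J_{w_l}(y,μ)`. -/
noncomputable def Jwl (y₁ y₂ : ℝ) (μ₁ μ₂ μ₃ : ℂ) : ℂ :=
  ((|4 * Real.pi ^ 2 * y₁| : ℝ) : ℂ) ^ (1 - μ₃) *
    ((|4 * Real.pi ^ 2 * y₂| : ℝ) : ℂ) ^ (1 + μ₁) *
    ∑' n : ℕ × ℕ,
      Complex.Gamma ((n.1 : ℂ) + (n.2 : ℂ) + μ₁ - μ₃ + 1) *
          ((4 * Real.pi ^ 2 * y₁ : ℝ) : ℂ) ^ n.1 * ((4 * Real.pi ^ 2 * y₂ : ℝ) : ℂ) ^ n.2 /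
        (Complex.Gamma ((n.1 : ℂ) + μ₁ - μ₃ + 1) * Complex.Gamma ((n.2 : ℂ) + μ₁ - μ₁ + 1) *
          Complex.Gamma ((n.1 : ℂ) + μ₂ - μ₃ + 1) * Complex.Gamma ((n.2 : ℂ) + μ₁ - μ₂ + 1) *
          Complex.Gamma ((n.1 : ℂ) + μ₃ - μ₃ + 1) * Complex.Gamma ((n.2 : ℂ) + μ₁ - μ₃ + 1))

/-- `J^{ε₁,ε₂}_{w_l}(y,μ) = ε₂J_{w_l}(y,μ) + ε₁J_{w_l}(y,μ^{w₄}) + ε₁ε₂J_{w_l}(y,μ^{w₅})`. -/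
noncomputable def Jsign (e₁ e₂ : ℂ) (y₁ y₂ : ℝ) (μ₁ μ₂ μ₃ : ℂ) : ℂ :=
  e₂ * Jwl y₁ y₂ μ₁ μ₂ μ₃ + e₁ * Jwl y₁ y₂ μ₃ μ₁ μ₂ + e₁ * e₂ * Jwl y₁ y₂ μ₂ μ₃ μ₁

/-- The weight-zero GL(3) long-element Bessel function `K⁰_{w_l}(y,μ)`. -/
noncomputable def K0wl (y₁ y₂ : ℝ) (μ₁ μ₂ μ₃ : ℂ) : ℂ :=
  -(1 / (16 * (Real.pi : ℂ))) *
    ((Jsign 1 1 y₁ y₂ μ₁ μ₂ μ₃ - Jsign 1 1 y₁ y₂ μ₂ μ₁ μ₃) /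
      (Complex.sin ((Real.pi : ℂ) / 2 * (μ₁ - μ₂)) *
        Complex.sin ((Real.pi : ℂ) / 2 * (μ₁ - μ₃)) *
        Complex.sin ((Real.pi : ℂ) / 2 * (μ₂ - μ₃))))

/-- The weight-one GL(3) long-element Bessel function `K¹_{w_l}(y,μ)`, with
`(ε₁,ε₂) = (sgn y₁, sgn y₂)`. -/
noncomputable def K1wl (y₁ y₂ : ℝ) (μ₁ μ₂ μ₃ : ℂ) : ℂ :=
  -(1 / (16 * (Real.pi : ℂ))) *
    ((Jsign ((Real.sign y₁ : ℝ) : ℂ) ((Real.sign y₂ : ℝ) : ℂ) y₁ y₂ μ₁ μ₂ μ₃ -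
        Jsign ((Real.sign y₁ : ℝ) : ℂ) ((Real.sign y₂ : ℝ) : ℂ) y₁ y₂ μ₂ μ₁ μ₃) /
      (Complex.cos ((Real.pi : ℂ) / 2 * (μ₁ - μ₃)) *
        Complex.cos ((Real.pi : ℂ) / 2 * (μ₂ - μ₃)) *
        Complex.sin ((Real.pi : ℂ) / 2 * (μ₁ - μ₂))))
/-- The GL(3) long-element Bessel function of weight `d ≥ 2` at `μ = μ^d(r)`, where
`μ^d(r) = ((d−1)/2+r, −(d−1)/2+r, −2r)`. -/
noncomputable def Kdwl (d : ℕ) (y₁ y₂ : ℝ) (r : ℂ) : ℂ :=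
  -(1 / (4 * (Real.pi : ℂ) * Complex.cos ((Real.pi : ℂ) * ((d : ℂ) / 2 + 3 * r)))) *
    ((if y₁ < 0 then ((Real.sign y₂ : ℝ) : ℂ) ^ d *
        Jwl y₁ y₂ (-2 * r) (((d : ℂ) - 1) / 2 + r) (-(((d : ℂ) - 1) / 2) + r) else 0) +
      (if y₂ < 0 then (-((Real.sign y₁ : ℝ) : ℂ)) ^ d *
        Jwl y₁ y₂ (((d : ℂ) - 1) / 2 + r) (-(((d : ℂ) - 1) / 2) + r) (-2 * r) else 0) -
      (if y₁ * y₂ < 0 then (-((Real.sign y₁ : ℝ) : ℂ)) ^ d *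
        Jwl y₁ y₂ (((d : ℂ) - 1) / 2 + r) (-2 * r) (-(((d : ℂ) - 1) / 2) + r) else 0))

/-- `‖μ‖ = max_i |μ_i|`. -/
noncomputable def muNorm (μ₁ μ₂ μ₃ : ℂ) : ℝ := max ‖μ₁‖ (max ‖μ₂‖ ‖μ₃‖)
/-- The Euler operator `y₁ ∂_{y₁}` on functions of `(y₁,y₂)`. -/
noncomputable def eulerOp1 (f : ℝ → ℝ → ℂ) : ℝ → ℝ → ℂ :=
  fun y₁ y₂ => (y₁ : ℂ) * deriv (fun u : ℝ => f u y₂) y₁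

/-- The Euler operator `y₂ ∂_{y₂}` on functions of `(y₁,y₂)`. -/
noncomputable def eulerOp2 (f : ℝ → ℝ → ℂ) : ℝ → ℝ → ℂ :=
  fun y₁ y₂ => (y₂ : ℂ) * deriv (fun u : ℝ => f y₁ u) y₂

theorem convexOn_log_one_add_sq_div (t : ℝ) :
    ConvexOn ℝ (Set.Ioi (0 : ℝ)) (fun u => Real.log (u ^ 2 + t ^ 2) - 2 * Real.log u) := by
  have hd : ∀ u ∈ Set.Ioi (0 : ℝ), HasDerivAt (fun u => Real.log (u ^ 2 + t ^ 2) - 2 * Real.log u)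
      (-(2 * t ^ 2) / (u * (u ^ 2 + t ^ 2))) u := by
    intro u hu
    have hu' : (0 : ℝ) < u := hu
    have h1 : HasDerivAt (fun u : ℝ => u ^ 2 + t ^ 2) (2 * u) u := by
      simpa using (hasDerivAt_pow 2 u).add_const (t ^ 2)
    have h2 := (h1.log (by positivity)).sub ((Real.hasDerivAt_log hu'.ne').const_mul 2)
    refine h2.congr_deriv ?_
    have : u ^ 2 + t ^ 2 ≠ 0 := by positivity
    field_simp
    ring
  apply MonotoneOn.convexOn_of_deriv (convex_Ioi 0)
  · exact fun u hu => (hd u hu).continuousAt.continuousWithinAt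
  · rw [interior_Ioi]
    exact fun u hu => (hd u hu).differentiableAt.differentiableWithinAt
  · rw [interior_Ioi]
    intro a ha b hb hab
    rw [(hd a ha).deriv, (hd b hb).deriv]
    have ha' : (0 : ℝ) < a := ha
    have hb' : (0 : ℝ) < b := hb
    rw [neg_div, neg_div, neg_le_neg_iff]
    gcongr

/-- The ratio `|Γ(σ)| / |Γ(σ + it)|`. -/
noncomputable def gammaRatio (t σ : ℝ) : ℝ :=
  ‖Complex.Gamma (σ : ℂ)‖ / ‖Complex.Gamma ((σ : ℂ) + t * Complex.I)‖

theorem norm_GammaSeq {σ t : ℝ} {n : ℕ} (hn : 0 < n) :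
    ‖Complex.GammaSeq ((σ : ℂ) + t * Complex.I) n‖ = (n : ℝ) ^ σ * n.factorial /
      ∏ j ∈ Finset.range (n + 1), ‖((σ + j : ℝ) : ℂ) + t * Complex.I‖ := by
  unfold Complex.GammaSeq
  rw [norm_div, norm_mul, norm_prod, Complex.norm_natCast_cpow_of_pos hn]
  congr 1
  · simp
  · refine Finset.prod_congr rfl fun j _ => ?_
    congr 1
    push_cast
    ring

theorem gammaRatio_convex {t a b p q : ℝ} (ha : 0 < a) (hb : 0 < b) (hp : 0 ≤ p) (hq : 0 ≤ q)
    (hpq : p + q = 1) :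
    gammaRatio t (p * a + q * b) ≤ gammaRatio t a ^ p * gammaRatio t b ^ q := by
  set H : ℕ → ℝ → ℝ := fun n σ => ‖Complex.GammaSeq (σ : ℂ) n‖ /
    ‖Complex.GammaSeq ((σ : ℂ) + t * Complex.I) n‖ with hH
  have hlim : ∀ σ : ℝ, 0 < σ → Filter.Tendsto (fun n => H n σ) Filter.atTop
      (nhds (gammaRatio t σ)) := by
    intro σ hσ
    refine Filter.Tendsto.div (Complex.GammaSeq_tendsto_Gamma _).norm
      (Complex.GammaSeq_tendsto_Gamma _).norm ?_
    rw [norm_ne_zero_iff]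
    exact Complex.Gamma_ne_zero_of_re_pos (by simpa using hσ)
  have hform : ∀ n : ℕ, 0 < n → ∀ σ : ℝ, 0 < σ → H n σ =
      Real.exp (∑ j ∈ Finset.range (n + 1),
        (1 / 2) * (Real.log ((σ + j) ^ 2 + t ^ 2) - 2 * Real.log (σ + j))) := by
    intro n hn σ hσ
    have h0 := norm_GammaSeq (σ := σ) (t := 0) hn
    have h1 := norm_GammaSeq (σ := σ) (t := t) hn
    simp only [Complex.ofReal_zero, zero_mul, add_zero] at h0
    simp only [hH]
    rw [h0, h1, Real.exp_sum]
    have hn' : (0 : ℝ) < (n : ℝ) ^ σ * n.factorial := by positivity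
    rw [div_div_div_cancel_left' _ _ hn'.ne', ← Finset.prod_div_distrib]
    refine Finset.prod_congr rfl fun j _ => ?_
    have hj : (0 : ℝ) < σ + j := by positivity
    rw [Complex.norm_real, Real.norm_of_nonneg hj.le, Complex.norm_add_mul_I, Real.sqrt_eq_rpow,
      mul_sub, Real.exp_sub, ← mul_assoc]
    norm_num
    rw [Real.exp_log hj, Real.rpow_def_of_pos (by positivity)]
    congr 2
    ring
  have hab : 0 < p * a + q * b := by
    rcases hp.eq_or_lt with rfl | hp
    · simp at hpq; simp [hpq, hb]
    · positivity
  have key : ∀ n : ℕ, 0 < n → H n (p * a + q * b) ≤ H n a ^ p * H n b ^ q := by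
    intro n hn
    rw [hform n hn _ hab, hform n hn _ ha, hform n hn _ hb, ← Real.exp_mul, ← Real.exp_mul,
      ← Real.exp_add, Real.exp_le_exp, Finset.sum_mul, Finset.sum_mul, ← Finset.sum_add_distrib]
    refine Finset.sum_le_sum fun j _ => ?_
    have := (convexOn_log_one_add_sq_div t).2 (x := a + j) (y := b + j)
      (by simp; positivity) (by simp; positivity) hp hq hpq
    simp only [smul_eq_mul] at this
    have e : p * (a + j) + q * (b + j) = p * a + q * b + j := by
      have : (j : ℝ) = (p + q) * j := by rw [hpq, one_mul]
      linear_combination -this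
    rw [e] at this
    linarith
  refine le_of_tendsto_of_tendsto (hlim _ hab)
    (((hlim a ha).rpow_const (Or.inr hp)).mul ((hlim b hb).rpow_const (Or.inr hq))) ?_
  filter_upwards [Filter.eventually_gt_atTop 0] with n hn using key n hn

theorem gammaRatio_pos {t σ : ℝ} (hσ : 0 < σ) : 0 < gammaRatio t σ := by
  refine div_pos ?_ ?_ <;> rw [norm_pos_iff] <;> apply Complex.Gamma_ne_zero_of_re_pos <;> simpa

theorem gammaRatio_add_one {t σ : ℝ} (hσ : 0 < σ) :
    gammaRatio t (σ + 1) = gammaRatio t σ * (σ / ‖(σ : ℂ) + t * Complex.I‖) := by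
  have h1 : (σ : ℂ) ≠ 0 := by exact_mod_cast hσ.ne'
  have h2 : (σ : ℂ) + t * Complex.I ≠ 0 := by
    intro h; have := congrArg Complex.re h; simp at this; exact hσ.ne' this
  unfold gammaRatio
  push_cast
  rw [add_right_comm, Complex.Gamma_add_one _ h1, Complex.Gamma_add_one _ h2, norm_mul, norm_mul,
    Complex.norm_real, Real.norm_of_nonneg hσ.le]
  rw [mul_comm, mul_comm (‖(σ : ℂ) + t * Complex.I‖), mul_div_mul_comm]

theorem gammaRatio_one_sq {t : ℝ} (ht : t ≠ 0) :
    gammaRatio t 1 ^ 2 = Real.sinh (Real.pi * t) / (Real.pi * t) := by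
  have h2 : (t : ℂ) * Complex.I ≠ 0 := by simp [ht]
  have hc : ‖Complex.Gamma ((1 : ℂ) + t * Complex.I)‖ ^ 2 =
      Real.pi * t / Real.sinh (Real.pi * t) := by
    have h3 : ‖Complex.Gamma ((1 : ℂ) + t * Complex.I)‖ ^ 2 =
        ‖Complex.Gamma ((1 : ℂ) + t * Complex.I) * Complex.Gamma (1 - t * Complex.I)‖ := by
      rw [norm_mul, sq]
      congr 1
      rw [← Complex.norm_conj (Complex.Gamma _), ← Complex.Gamma_conj]
      congr 2
      simp [sub_eq_add_neg]
    rw [h3, add_comm (1 : ℂ), Complex.Gamma_add_one _ h2, mul_assoc, Complex.Gamma_mul_Gamma_one_sub,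
      ← mul_assoc, Complex.sin_mul_I, ← Complex.ofReal_mul, ← Complex.ofReal_sinh]
    simp only [norm_mul, norm_div, Complex.norm_real, Complex.norm_I, mul_one]
    rw [← norm_div, ← norm_mul]
    rw [Real.norm_of_nonneg]
    · ring
    · rcases ht.lt_or_gt with h | h
      · have : Real.sinh (Real.pi * t) < 0 := Real.sinh_neg_iff.2 (by nlinarith [Real.pi_pos])
        exact mul_nonneg_of_nonpos_of_nonpos h.le (div_nonpos_of_nonneg_of_nonpos Real.pi_pos.le this.le)
      · have : 0 < Real.sinh (Real.pi * t) := Real.sinh_pos_iff.2 (by positivity)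
        positivity
  unfold gammaRatio
  push_cast
  rw [div_pow, hc]
  simp

theorem gammaRatio_one_bounds : ∃ K : ℝ, 0 < K ∧ ∀ t : ℝ,
    gammaRatio t 1 ≤ K * ((1 + |t|) ^ (-(1 / 2) : ℝ) * Real.exp (Real.pi / 2 * |t|)) ∧
    (1 + |t|) ^ (-(1 / 2) : ℝ) * Real.exp (Real.pi / 2 * |t|) ≤ K * gammaRatio t 1 := by
  have hpi := Real.pi_gt_three
  have main : ∀ t : ℝ, gammaRatio t 1 ^ 2 ≤ Real.exp Real.pi * (Real.exp (Real.pi * |t|) / (1 + |t|)) ∧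
      Real.exp (Real.pi * |t|) / (1 + |t|) ≤ (4 * Real.pi * Real.exp Real.pi) * gammaRatio t 1 ^ 2 := by
    intro t
    have he : 1 + Real.pi ≤ Real.exp Real.pi := by linarith [Real.add_one_le_exp Real.pi]
    rcases eq_or_ne t 0 with rfl | ht
    · have : gammaRatio 0 1 = 1 := by
        simp [gammaRatio]
      rw [this]
      simp
      constructor
      · linarith
      · nlinarith
    rw [gammaRatio_one_sq ht]
    have hs : Real.sinh (Real.pi * t) / (Real.pi * t) =
        Real.sinh (Real.pi * |t|) / (Real.pi * |t|) := by
      rcases abs_choice t with h | h <;> rw [h]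
      rw [mul_neg, Real.sinh_neg, neg_div_neg_eq]
    rw [hs]
    have hu : 0 < |t| := abs_pos.2 ht
    generalize |t| = u at hu
    have hx : 0 < Real.pi * u := by positivity
    rw [Real.sinh_eq]
    have hE : 1 + Real.pi * u ≤ Real.exp (Real.pi * u) := by
      linarith [Real.add_one_le_exp (Real.pi * u)]
    have hN : 1 - Real.pi * u ≤ Real.exp (-(Real.pi * u)) := by
      linarith [Real.add_one_le_exp (-(Real.pi * u))]
    have hmul : Real.exp (Real.pi * u) * Real.exp (-(Real.pi * u)) = 1 := by
      rw [← Real.exp_add]; simp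
    have hN' : 1 - 2 * (Real.pi * u) ≤ Real.exp (-(Real.pi * u)) * Real.exp (-(Real.pi * u)) := by
      rw [← Real.exp_add]; linarith [Real.add_one_le_exp (-(Real.pi * u) + -(Real.pi * u))]
    set E := Real.exp (Real.pi * u)
    set M := Real.exp (-(Real.pi * u))
    have hM : 0 < M := Real.exp_pos _
    have hEp : 0 < E := Real.exp_pos _
    have hs1 : E - M ≤ 2 * (Real.pi * u) * E := by nlinarith
    constructor
    · rw [div_div, ← mul_div_assoc, div_le_div_iff₀ (by positivity) (by positivity)]
      rcases le_total u 1 with h | h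
      · calc (E - M) * (1 + u) ≤ (2 * (Real.pi * u) * E) * 2 := by
              apply mul_le_mul hs1 (by linarith) (by linarith) (by positivity)
          _ = 2 * E * (2 * (Real.pi * u)) := by ring
          _ ≤ Real.exp Real.pi * E * (2 * (Real.pi * u)) := by
              gcongr; linarith
      · have h3 : (1 + u) ≤ 2 * (Real.pi * u) := by nlinarith
        calc (E - M) * (1 + u) ≤ E * (2 * (Real.pi * u)) := by
              apply mul_le_mul (by linarith) h3 (by linarith) hEp.le
          _ ≤ Real.exp Real.pi * E * (2 * (Real.pi * u)) := by
              gcongr; nlinarith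
    · rw [div_div, ← mul_div_assoc, div_le_div_iff₀ (by positivity) (by positivity)]
      rcases le_total u 1 with h | h
      · have h1 : E ≤ Real.exp Real.pi := Real.exp_le_exp.2 (by nlinarith)
        have h2 : 2 * (Real.pi * u) ≤ E - M := by
          have := Real.self_le_sinh_iff.2 hx.le
          rw [Real.sinh_eq] at this
          linarith
        calc E * (2 * (Real.pi * u)) ≤ Real.exp Real.pi * (E - M) := by
              apply mul_le_mul h1 h2 (by positivity) (by positivity)
          _ = 1 * Real.exp Real.pi * (E - M) * 1 := by ring
          _ ≤ 4 * Real.pi * Real.exp Real.pi * (E - M) * (1 + u) := by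
              have : 0 ≤ E - M := by linarith [h2, hx]
              gcongr <;> linarith
      · have hM1 : M ≤ 1 := Real.exp_le_one_iff.2 (by linarith)
        have hE4 : 4 ≤ E := by nlinarith
        have h2 : E ≤ 2 * (E - M) := by linarith
        have h3 : Real.exp Real.pi ≥ 1 := by linarith
        calc E * (2 * (Real.pi * u)) ≤ (2 * (E - M)) * (2 * (Real.pi * (1 + u))) := by
              gcongr <;> linarith
          _ = 4 * Real.pi * 1 * (E - M) * (1 + u) := by ring
          _ ≤ _ := by
              have : 0 ≤ E - M := by linarith
              gcongr
  have hsq : ∀ t : ℝ, Real.exp (Real.pi * |t|) / (1 + |t|) =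
      ((1 + |t|) ^ (-(1 / 2) : ℝ) * Real.exp (Real.pi / 2 * |t|)) ^ 2 := by
    intro t
    have : (0 : ℝ) < 1 + |t| := by positivity
    rw [mul_pow, ← Real.rpow_natCast, ← Real.rpow_mul this.le, ← Real.exp_nat_mul]
    norm_num
    rw [Real.rpow_neg_one, div_eq_inv_mul]
    congr 2
    ring
  refine ⟨4 * Real.pi * Real.exp Real.pi, by positivity, fun t => ?_⟩
  have h1 := main t
  rw [hsq] at h1
  set W := (1 + |t|) ^ (-(1 / 2) : ℝ) * Real.exp (Real.pi / 2 * |t|)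
  have hW : 0 < W := by positivity
  have hg : 0 < gammaRatio t 1 := gammaRatio_pos one_pos
  have hK : 1 ≤ 4 * Real.pi * Real.exp Real.pi := by
    have := Real.add_one_le_exp Real.pi
    nlinarith
  have hK2 : Real.exp Real.pi ≤ 4 * Real.pi * Real.exp Real.pi := by
    have := Real.exp_pos Real.pi
    nlinarith
  constructor
  · refine le_of_sq_le_sq ?_ (by positivity)
    rw [mul_pow]
    refine h1.1.trans ?_
    gcongr
    nlinarith
  · refine le_of_sq_le_sq ?_ (by positivity)
    rw [mul_pow _ (gammaRatio t 1)]
    refine h1.2.trans ?_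
    gcongr
    nlinarith

theorem norm_ofReal_add_mul_I_ge {σ t : ℝ} (hσ : 1 ≤ σ) :
    (1 + |t|) / 2 ≤ ‖(σ : ℂ) + t * Complex.I‖ := by
  have h1 := Complex.abs_re_le_norm ((σ : ℂ) + t * Complex.I)
  have h2 := Complex.abs_im_le_norm ((σ : ℂ) + t * Complex.I)
  simp at h1 h2
  have := le_abs_self σ
  linarith

theorem norm_ofReal_add_mul_I_le {σ t K : ℝ} (hK : 1 ≤ K) (hσ : |σ| ≤ K) :
    ‖(σ : ℂ) + t * Complex.I‖ ≤ K * (1 + |t|) := by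
  refine (norm_add_le _ _).trans ?_
  rw [norm_mul, Complex.norm_I, mul_one, Complex.norm_real, Complex.norm_real, Real.norm_eq_abs,
    Real.norm_eq_abs]
  nlinarith [abs_nonneg t]

theorem gammaRatio_bounds : ∃ K : ℝ, 0 < K ∧ ∀ σ ∈ Set.Icc (1 : ℝ) 2, ∀ t : ℝ,
    gammaRatio t σ ≤ K * ((1 + |t|) ^ (1 / 2 - σ) * Real.exp (Real.pi / 2 * |t|)) ∧
    (1 + |t|) ^ (1 / 2 - σ) * Real.exp (Real.pi / 2 * |t|) ≤ K * gammaRatio t σ := by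
  obtain ⟨K, hK, h⟩ := gammaRatio_one_bounds
  refine ⟨4 * K, by positivity, fun σ hσ t => ?_⟩
  obtain ⟨hσ1, hσ2⟩ := hσ
  obtain ⟨hu, hl⟩ := h t
  have hp : (0 : ℝ) < 1 + |t| := by positivity
  have hsplit : (1 + |t|) ^ (1 / 2 - σ) = (1 + |t|) ^ (-(1 / 2) : ℝ) * (1 + |t|) ^ (1 - σ) := by
    rw [← Real.rpow_add hp]; congr 1; ring
  have hg1 : 0 < gammaRatio t 1 := gammaRatio_pos one_pos
  have hgσ : 0 < gammaRatio t σ := gammaRatio_pos (by linarith)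
  have e2 : gammaRatio t 2 = gammaRatio t 1 * (1 / ‖((1 : ℝ) : ℂ) + t * Complex.I‖) := by
    rw [← gammaRatio_add_one one_pos]; norm_num
  have hn1 := norm_ofReal_add_mul_I_ge (σ := 1) (t := t) le_rfl
  have hn1' := norm_ofReal_add_mul_I_le (σ := 1) (t := t) le_rfl (by simp)
  have hnσ := norm_ofReal_add_mul_I_ge (σ := σ) (t := t) hσ1
  have hn1pos : 0 < ‖((1 : ℝ) : ℂ) + t * Complex.I‖ := by linarith
  constructor
  · have c := gammaRatio_convex (t := t) (a := 1) (b := 2) (p := 2 - σ) (q := σ - 1) one_pos two_pos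
      (by linarith) (by linarith) (by ring)
    rw [show (2 - σ) * 1 + (σ - 1) * 2 = σ by ring, e2, Real.mul_rpow hg1.le (by positivity),
      ← mul_assoc, ← Real.rpow_add hg1, show 2 - σ + (σ - 1) = 1 by ring, Real.rpow_one] at c
    refine c.trans ?_
    have b1 : (1 / ‖((1 : ℝ) : ℂ) + t * Complex.I‖) ^ (σ - 1) ≤ 2 * (1 + |t|) ^ (1 - σ) := by
      calc (1 / ‖((1 : ℝ) : ℂ) + t * Complex.I‖) ^ (σ - 1) ≤ (2 / (1 + |t|)) ^ (σ - 1) := by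
            apply Real.rpow_le_rpow (by positivity) _ (by linarith)
            rw [div_le_div_iff₀ hn1pos hp]; linarith
        _ = 2 ^ (σ - 1) * (1 + |t|) ^ (1 - σ) := by
            rw [Real.div_rpow (by norm_num) hp.le, div_eq_mul_inv, ← Real.rpow_neg hp.le]
            congr 2; ring
        _ ≤ 2 ^ (1 : ℝ) * (1 + |t|) ^ (1 - σ) := by
            gcongr
            · norm_num
            · linarith
        _ = _ := by norm_num
    calc _ ≤ (K * ((1 + |t|) ^ (-(1 / 2) : ℝ) * Real.exp (Real.pi / 2 * |t|))) *
          (2 * (1 + |t|) ^ (1 - σ)) := by gcongr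
      _ = 2 * (K * ((1 + |t|) ^ (1 / 2 - σ) * Real.exp (Real.pi / 2 * |t|))) := by
          rw [hsplit]; ring
      _ ≤ 4 * (K * ((1 + |t|) ^ (1 / 2 - σ) * Real.exp (Real.pi / 2 * |t|))) := by
          gcongr; norm_num
      _ = _ := by ring
  · have c := gammaRatio_convex (t := t) (a := σ) (b := σ + 1) (p := σ - 1) (q := 2 - σ)
      (by linarith) (by linarith) (by linarith) (by linarith) (by ring)
    have hσ0 : 0 < σ := by linarith
    have hnσpos : 0 < ‖(σ : ℂ) + t * Complex.I‖ := by linarith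
    rw [show (σ - 1) * σ + (2 - σ) * (σ + 1) = 2 by ring, gammaRatio_add_one hσ0,
      Real.mul_rpow hgσ.le (by positivity),
      ← mul_assoc, ← Real.rpow_add hgσ, show σ - 1 + (2 - σ) = 1 by ring, Real.rpow_one, e2] at c
    have b1 : (σ / ‖(σ : ℂ) + t * Complex.I‖) ^ (2 - σ) ≤ 4 * (1 + |t|) ^ (σ - 2) := by
      calc (σ / ‖(σ : ℂ) + t * Complex.I‖) ^ (2 - σ) ≤ (4 / (1 + |t|)) ^ (2 - σ) := by
            apply Real.rpow_le_rpow (by positivity) _ (by linarith)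
            rw [div_le_div_iff₀ hnσpos hp]
            nlinarith
        _ = 4 ^ (2 - σ) * (1 + |t|) ^ (σ - 2) := by
            rw [Real.div_rpow (by norm_num) hp.le, div_eq_mul_inv, ← Real.rpow_neg hp.le]
            congr 2; ring
        _ ≤ 4 ^ (1 : ℝ) * (1 + |t|) ^ (σ - 2) := by
            gcongr
            · norm_num
            · linarith
        _ = _ := by norm_num
    have hs2 : (1 + |t|) ^ (1 - σ) * (1 + |t|) ^ (σ - 2) = 1 / (1 + |t|) := by
      rw [← Real.rpow_add hp, show 1 - σ + (σ - 2) = -1 by ring, Real.rpow_neg_one, one_div]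
    have b2 : gammaRatio t 1 * (1 / (1 + |t|)) ≤ gammaRatio t σ * (4 * (1 + |t|) ^ (σ - 2)) := by
      calc _ ≤ gammaRatio t 1 * (1 / ‖((1 : ℝ) : ℂ) + t * Complex.I‖) := by
            gcongr; linarith
        _ ≤ _ := c
        _ ≤ _ := by gcongr
    rw [← hs2, ← mul_assoc, ← mul_assoc] at b2
    have b3 : gammaRatio t 1 * (1 + |t|) ^ (1 - σ) ≤ gammaRatio t σ * 4 :=
      le_of_mul_le_mul_right b2 (by positivity)
    calc _ = ((1 + |t|) ^ (-(1 / 2) : ℝ) * Real.exp (Real.pi / 2 * |t|)) * (1 + |t|) ^ (1 - σ) := by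
          rw [hsplit]; ring
      _ ≤ (K * gammaRatio t 1) * (1 + |t|) ^ (1 - σ) := by gcongr
      _ = K * (gammaRatio t 1 * (1 + |t|) ^ (1 - σ)) := by ring
      _ ≤ K * (gammaRatio t σ * 4) := by gcongr
      _ = _ := by ring

theorem norm_Gamma_base : ∃ K : ℝ, 0 < K ∧ ∀ s : ℂ, 1 ≤ s.re → s.re ≤ 2 →
    ‖(Complex.Gamma s)⁻¹‖ ≤ K * ((1 + |s.im|) ^ (1 / 2 - s.re) * Real.exp (Real.pi / 2 * |s.im|)) ∧
    ‖Complex.Gamma s‖ ≤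
      K * ((1 + |s.im|) ^ (s.re - 1 / 2) * Real.exp (-(Real.pi / 2 * |s.im|))) := by
  obtain ⟨K, hK, h⟩ := gammaRatio_bounds
  have hcont : ContinuousOn (fun σ : ℝ => ‖(Complex.Gamma (σ : ℂ))⁻¹‖) (Set.Icc 1 2) :=
    ((Complex.differentiable_one_div_Gamma.continuous.comp Complex.continuous_ofReal).norm).continuousOn
  have hcont' : ContinuousOn (fun σ : ℝ => ‖Complex.Gamma (σ : ℂ)‖) (Set.Icc 1 2) := by
    refine (hcont.inv₀ (fun σ hσ => ?_)).congr fun σ _ => by simp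
    rw [norm_ne_zero_iff]
    exact inv_ne_zero (Complex.Gamma_ne_zero_of_re_pos (by simpa using lt_of_lt_of_le one_pos hσ.1))
  obtain ⟨M, hM⟩ := isCompact_Icc.bddAbove_image hcont
  obtain ⟨M', hM'⟩ := isCompact_Icc.bddAbove_image hcont'
  have hM0 : ∀ σ ∈ Set.Icc (1 : ℝ) 2, ‖(Complex.Gamma (σ : ℂ))⁻¹‖ ≤ M := fun σ hσ =>
    hM (Set.mem_image_of_mem _ hσ)
  have hM0' : ∀ σ ∈ Set.Icc (1 : ℝ) 2, ‖Complex.Gamma (σ : ℂ)‖ ≤ M' := fun σ hσ =>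
    hM' (Set.mem_image_of_mem _ hσ)
  have hMn : 0 ≤ M := (norm_nonneg _).trans (hM0 1 (by norm_num))
  have hMn' : 0 ≤ M' := (norm_nonneg _).trans (hM0' 1 (by norm_num))
  refine ⟨(1 + M + M') * K, by positivity, fun s h1 h2 => ?_⟩
  have hs : s = (s.re : ℂ) + s.im * Complex.I := (Complex.re_add_im s).symm
  obtain ⟨hu, hl⟩ := h s.re ⟨h1, h2⟩ s.im
  unfold gammaRatio at hu hl
  rw [← hs] at hu hl
  have hm := hM0 s.re ⟨h1, h2⟩
  have hm' := hM0' s.re ⟨h1, h2⟩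
  have hne : Complex.Gamma (s.re : ℂ) ≠ 0 :=
    Complex.Gamma_ne_zero_of_re_pos (by simpa using lt_of_lt_of_le one_pos h1)
  have hne' : Complex.Gamma s ≠ 0 := Complex.Gamma_ne_zero_of_re_pos (lt_of_lt_of_le one_pos h1)
  have hp : (0 : ℝ) < 1 + |s.im| := by positivity
  have hpos : 0 < ‖Complex.Gamma (s.re : ℂ)‖ := norm_pos_iff.2 hne
  have hpos' : 0 < ‖Complex.Gamma s‖ := norm_pos_iff.2 hne'
  set W := (1 + |s.im|) ^ (1 / 2 - s.re) * Real.exp (Real.pi / 2 * |s.im|) with hW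
  have hWp : 0 < W := by positivity
  have hinv : (1 + |s.im|) ^ (s.re - 1 / 2) * Real.exp (-(Real.pi / 2 * |s.im|)) = W⁻¹ := by
    rw [hW, mul_inv, ← Real.rpow_neg hp.le, Real.exp_neg]; congr 2; ring
  constructor
  · calc ‖(Complex.Gamma s)⁻¹‖ = ‖(Complex.Gamma (s.re : ℂ))⁻¹‖ *
          (‖Complex.Gamma (s.re : ℂ)‖ / ‖Complex.Gamma s‖) := by
          rw [norm_inv, norm_inv]; field_simp
      _ ≤ M * (K * W) := by gcongr
      _ ≤ (1 + M + M') * (K * W) := by gcongr; linarith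
      _ = _ := by ring
  · rw [hinv]
    rw [← mul_div_assoc, le_div_iff₀ hpos'] at hl
    rw [← div_eq_mul_inv, le_div_iff₀ hWp]
    calc ‖Complex.Gamma s‖ * W = W * ‖Complex.Gamma s‖ := mul_comm _ _
      _ ≤ K * ‖Complex.Gamma (s.re : ℂ)‖ := hl
      _ ≤ K * M' := by gcongr
      _ ≤ K * (1 + M + M') := by gcongr; linarith
      _ = _ := mul_comm _ _

theorem norm_le_mul_one_add_abs_im {s : ℂ} {K : ℝ} (hK : 1 ≤ K) (hs : |s.re| ≤ K) :
    ‖s‖ ≤ K * (1 + |s.im|) := by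
  conv_lhs => rw [← Complex.re_add_im s]
  exact norm_ofReal_add_mul_I_le hK hs

theorem half_one_add_abs_im_le_norm {s : ℂ} (hs : 1 ≤ s.re) : (1 + |s.im|) / 2 ≤ ‖s‖ := by
  conv_rhs => rw [← Complex.re_add_im s]
  exact norm_ofReal_add_mul_I_ge hs

theorem norm_Gamma_inv_le_aux (n : ℕ) : ∃ K : ℝ, 0 < K ∧ ∀ s : ℂ, 1 - (n : ℝ) ≤ s.re →
    s.re ≤ 2 + n → ‖(Complex.Gamma s)⁻¹‖ ≤
      K * ((1 + |s.im|) ^ (1 / 2 - s.re) * Real.exp (Real.pi / 2 * |s.im|)) := by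
  induction n with
  | zero =>
    obtain ⟨K, hK, h⟩ := norm_Gamma_base
    exact ⟨K, hK, fun s h1 h2 => (h s (by simpa using h1) (by simpa using h2)).1⟩
  | succ n ih =>
    obtain ⟨K, hK, h⟩ := ih
    refine ⟨(n + 2) * K, by positivity, fun s h1 h2 => ?_⟩
    push_cast at h1 h2
    have hp : (0 : ℝ) < 1 + |s.im| := by positivity
    have hn : (0 : ℝ) ≤ n := n.cast_nonneg
    by_cases hlo : s.re < 1 - n
    · have hr := h (s + 1) (by simp; linarith) (by simp; linarith)
      rw [Complex.one_div_Gamma_eq_self_mul_one_div_Gamma_add_one, norm_mul]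
      have hns : ‖s‖ ≤ (n + 2) * (1 + |s.im|) :=
        norm_le_mul_one_add_abs_im (by linarith) (abs_le.2 ⟨by linarith, by linarith⟩)
      simp only [Complex.add_re, Complex.one_re, Complex.add_im, Complex.one_im, add_zero] at hr
      calc _ ≤ ((n + 2) * (1 + |s.im|)) * _ := mul_le_mul hns hr (norm_nonneg _) (by positivity)
        _ = (n + 2) * K * (((1 + |s.im|) ^ (1 : ℝ) * (1 + |s.im|) ^ (1 / 2 - (s.re + 1))) *
            Real.exp (Real.pi / 2 * |s.im|)) := by rw [Real.rpow_one]; ring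
        _ = _ := by
          rw [← Real.rpow_add hp, show (1 : ℝ) + (1 / 2 - (s.re + 1)) = 1 / 2 - s.re by ring]
    · push Not at hlo
      by_cases hhi : s.re ≤ 2 + n
      · refine (h s hlo hhi).trans ?_
        rw [mul_assoc]
        refine le_mul_of_one_le_left (by positivity) (by linarith)
      · push Not at hhi
        have hr := h (s - 1) (by simp; linarith) (by simp; linarith)
        have e := Complex.one_div_Gamma_eq_self_mul_one_div_Gamma_add_one (s - 1)
        rw [sub_add_cancel] at e
        have hs1 : (1 + |s.im|) / 2 ≤ ‖s - 1‖ := by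
          have := half_one_add_abs_im_le_norm (s := s - 1) (by simp; linarith)
          simpa using this
        have hs1p : 0 < ‖s - 1‖ := by linarith
        rw [e, norm_mul] at hr
        simp only [Complex.sub_re, Complex.one_re, Complex.sub_im, Complex.one_im, sub_zero] at hr
        have h3 : (1 + |s.im|) / 2 * ‖(Complex.Gamma s)⁻¹‖ ≤
            K * ((1 + |s.im|) ^ (1 / 2 - (s.re - 1)) * Real.exp (Real.pi / 2 * |s.im|)) :=
          (mul_le_mul_of_nonneg_right hs1 (norm_nonneg _)).trans hr
        have e3 : (1 + |s.im|) ^ (1 / 2 - (s.re - 1)) = (1 + |s.im|) * (1 + |s.im|) ^ (1 / 2 - s.re) := by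
          conv_rhs => rw [← Real.rpow_one (1 + |s.im|), ← Real.rpow_mul hp.le, one_mul]
          rw [← Real.rpow_add hp]; congr 1; ring
        rw [e3] at h3
        have h4 : ‖(Complex.Gamma s)⁻¹‖ ≤
            2 * (K * ((1 + |s.im|) ^ (1 / 2 - s.re) * Real.exp (Real.pi / 2 * |s.im|))) := by
          refine le_of_mul_le_mul_left ?_ (show (0 : ℝ) < (1 + |s.im|) / 2 by positivity)
          refine h3.trans (le_of_eq (by ring))
        refine h4.trans ?_
        rw [mul_assoc ((n : ℝ) + 2)]
        gcongr
        linarith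

/-- Vertical-strip bound for `1 / Γ`. -/
theorem norm_Gamma_inv_le (a b : ℝ) : ∃ K : ℝ, 0 < K ∧ ∀ s : ℂ, a ≤ s.re →
    s.re ≤ b → ‖(Complex.Gamma s)⁻¹‖ ≤
      K * ((1 + |s.im|) ^ (1 / 2 - s.re) * Real.exp (Real.pi / 2 * |s.im|)) := by
  obtain ⟨n, hn⟩ := exists_nat_ge (max (1 - a) (b - 2))
  obtain ⟨K, hK, h⟩ := norm_Gamma_inv_le_aux n
  have h1 := (le_max_left _ _).trans hn
  have h2 := (le_max_right _ _).trans hn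
  exact ⟨K, hK, fun s ha hb => h s (by linarith) (by linarith)⟩

/-- Vertical-strip bound for `Γ` to the right of `Re s = 1`. -/
theorem norm_Gamma_le (b : ℝ) : ∃ K : ℝ, 0 < K ∧ ∀ s : ℂ, 1 ≤ s.re →
    s.re ≤ b → ‖Complex.Gamma s‖ ≤
      K * ((1 + |s.im|) ^ (s.re - 1 / 2) * Real.exp (-(Real.pi / 2 * |s.im|))) := by
  have aux : ∀ n : ℕ, ∃ K : ℝ, 0 < K ∧ ∀ s : ℂ, 1 ≤ s.re →
    s.re ≤ 2 + n → ‖Complex.Gamma s‖ ≤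
      K * ((1 + |s.im|) ^ (s.re - 1 / 2) * Real.exp (-(Real.pi / 2 * |s.im|))) := by
    intro n
    induction n with
    | zero =>
      obtain ⟨K, hK, h⟩ := norm_Gamma_base
      exact ⟨K, hK, fun s h1 h2 => (h s h1 (by simpa using h2)).2⟩
    | succ n ih =>
      obtain ⟨K, hK, h⟩ := ih
      refine ⟨(n + 2) * K, by positivity, fun s h1 h2 => ?_⟩
      push_cast at h2
      have hp : (0 : ℝ) < 1 + |s.im| := by positivity
      have hn : (0 : ℝ) ≤ n := n.cast_nonneg
      by_cases hhi : s.re ≤ 2 + n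
      · refine (h s h1 hhi).trans ?_
        rw [mul_assoc]
        refine le_mul_of_one_le_left (by positivity) (by linarith)
      · push Not at hhi
        have hr := h (s - 1) (by simp; linarith) (by simp; linarith)
        have hne : s - 1 ≠ 0 := by
          intro h0; have := congrArg Complex.re h0; simp at this; linarith
        have e := Complex.Gamma_add_one (s - 1) hne
        rw [sub_add_cancel] at e
        rw [e, norm_mul]
        have hns : ‖s - 1‖ ≤ (n + 2) * (1 + |s.im|) := by
          have := norm_le_mul_one_add_abs_im (s := s - 1) (K := n + 2) (by linarith)
            (abs_le.2 ⟨by simp; linarith, by simp; linarith⟩)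
          simpa using this
        simp only [Complex.sub_re, Complex.one_re, Complex.sub_im, Complex.one_im, sub_zero] at hr
        calc _ ≤ ((n + 2) * (1 + |s.im|)) * _ := mul_le_mul hns hr (norm_nonneg _) (by positivity)
          _ = (n + 2) * K * (((1 + |s.im|) ^ (1 : ℝ) * (1 + |s.im|) ^ (s.re - 1 - 1 / 2)) *
              Real.exp (-(Real.pi / 2 * |s.im|))) := by rw [Real.rpow_one]; ring
          _ = _ := by
            rw [← Real.rpow_add hp, show (1 : ℝ) + (s.re - 1 - 1 / 2) = s.re - 1 / 2 by ring]
  obtain ⟨n, hn⟩ := exists_nat_ge (b - 2)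
  obtain ⟨K, hK, h⟩ := aux n
  exact ⟨K, hK, fun s ha hb => h s ha (by linarith)⟩

theorem exists_differentiableOn_of_removable {U : Set ℂ} (P : Finset ℂ) :
    ∀ f : ℂ → ℂ, (∀ p ∈ P, U ∈ nhds p) → DifferentiableOn ℂ f (U \ P) →
    (∀ p ∈ P, Filter.Tendsto (fun s => (s - p) * f s) (nhdsWithin p {p}ᶜ) (nhds 0)) →
    ∃ h : ℂ → ℂ, DifferentiableOn ℂ h U ∧ ∀ s, s ∉ P → h s = f s := by
  classical
  induction P using Finset.induction_on with
  | empty => exact fun f _ hf _ => ⟨f, by simpa using hf, fun _ _ => rfl⟩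
  | insert c P hc ih =>
    intro f hU hf hlim
    have hs : U \ P ∈ nhds c := by
      refine Filter.inter_mem (hU c (by simp)) ?_
      exact P.finite_toSet.isClosed.isOpen_compl.mem_nhds (by simpa using hc)
    have hset : (U \ (P : Set ℂ)) \ {c} = U \ ((insert c P : Finset ℂ) : Set ℂ) := by
      ext z; simp; tauto
    have hd := Complex.differentiableOn_update_limUnder_of_isLittleO hs (f := f)
      (by rw [hset]; exact hf) (by
        rw [Asymptotics.isLittleO_iff_tendsto']
        · have h1 := hlim c (by simp)
          have h2 : Filter.Tendsto (fun s => (s - c) * f c) (nhdsWithin c {c}ᶜ) (nhds 0) := by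
            have : Filter.Tendsto (fun s => (s - c) * f c) (nhds c) (nhds ((c - c) * f c)) :=
              Continuous.tendsto (by fun_prop) c
            rw [sub_self, zero_mul] at this
            exact this.mono_left nhdsWithin_le_nhds
          have h3 := h1.sub h2
          rw [sub_zero] at h3
          refine h3.congr fun s => ?_
          rw [div_inv_eq_mul]; ring
        · filter_upwards [self_mem_nhdsWithin] with z hz h0
          exact absurd (inv_eq_zero.1 h0) (sub_ne_zero.2 hz))
    obtain ⟨h, hh, he⟩ := ih _ (fun p hp => hU p (by simp [hp])) hd (by
      intro p hp
      have hpc : p ≠ c := by rintro rfl; exact hc hp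
      refine (hlim p (by simp [hp])).congr' ?_
      have : {c}ᶜ ∈ nhds p := isOpen_compl_singleton.mem_nhds hpc
      filter_upwards [nhdsWithin_le_nhds this] with z hz
      rw [Function.update_of_ne hz])
    refine ⟨h, hh, fun s hs => ?_⟩
    simp only [Finset.mem_insert, not_or] at hs
    rw [he s hs.2, Function.update_of_ne hs.1]

theorem min_one_mul_sqrt_le_norm {δ : ℝ} (hδ : 0 < δ) (t : ℝ) :
    min 1 δ * Real.sqrt (1 + t ^ 2) ≤ ‖(δ : ℂ) + t * Complex.I‖ := by
  rw [Complex.norm_add_mul_I]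
  have h0 : 0 < min 1 δ := lt_min one_pos hδ
  rw [← Real.sqrt_sq h0.le, ← Real.sqrt_mul (sq_nonneg _)]
  apply Real.sqrt_le_sqrt
  have h1 : min 1 δ ≤ 1 := min_le_left _ _
  have h2 : min 1 δ ≤ δ := min_le_right _ _
  have h3 : min 1 δ ^ 2 ≤ 1 := by nlinarith
  have h4 : min 1 δ ^ 2 ≤ δ ^ 2 := by nlinarith
  nlinarith [sq_nonneg t]

theorem integrable_and_integral_pole_zero {δ ε : ℝ} (hδ : 0 < δ) (hε : 0 < ε) :
    Integrable (fun t : ℝ => 1 / ((δ : ℂ) + t * Complex.I) - 1 / (-(ε : ℂ) + t * Complex.I)) ∧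
    ∫ t : ℝ, (1 / ((δ : ℂ) + t * Complex.I) - 1 / (-(ε : ℂ) + t * Complex.I)) = 2 * Real.pi := by
  have hne1 : ∀ t : ℝ, (δ : ℂ) + t * Complex.I ≠ 0 := by
    intro t h; have := congrArg Complex.re h; simp at this; exact hδ.ne' this
  have hne2 : ∀ t : ℝ, -(ε : ℂ) + t * Complex.I ≠ 0 := by
    intro t h; have := congrArg Complex.re h; simp at this; exact hε.ne' this
  have hcont : Continuous
      (fun t : ℝ => 1 / ((δ : ℂ) + t * Complex.I) - 1 / (-(ε : ℂ) + t * Complex.I)) := by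
    refine Continuous.sub ?_ ?_
    · exact continuous_const.div (by fun_prop) hne1
    · exact continuous_const.div (by fun_prop) hne2
  have hint : Integrable
      (fun t : ℝ => 1 / ((δ : ℂ) + t * Complex.I) - 1 / (-(ε : ℂ) + t * Complex.I)) := by
    refine Integrable.mono' (integrable_inv_one_add_sq.const_mul
      ((δ + ε) / (min 1 δ * min 1 ε))) hcont.aestronglyMeasurable (Filter.Eventually.of_forall fun t => ?_)
    have h1 := min_one_mul_sqrt_le_norm hδ t
    have h2 := min_one_mul_sqrt_le_norm hε (-t)
    have e2 : ‖(ε : ℂ) + ((-t : ℝ) : ℂ) * Complex.I‖ = ‖-(ε : ℂ) + t * Complex.I‖ := by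
      rw [← norm_neg]; congr 1; push_cast; ring
    rw [e2, neg_sq] at h2
    have hp1 : 0 < min 1 δ := lt_min one_pos hδ
    have hp2 : 0 < min 1 ε := lt_min one_pos hε
    have hs : 0 < Real.sqrt (1 + t ^ 2) := by positivity
    have hss : Real.sqrt (1 + t ^ 2) * Real.sqrt (1 + t ^ 2) = 1 + t ^ 2 :=
      Real.mul_self_sqrt (by positivity)
    rw [div_sub_div _ _ (hne1 t) (hne2 t), norm_div, norm_mul]
    have e3 : ‖1 * (-(ε : ℂ) + t * Complex.I) - ((δ : ℂ) + t * Complex.I) * 1‖ = δ + ε := by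
      rw [show 1 * (-(ε : ℂ) + t * Complex.I) - ((δ : ℂ) + t * Complex.I) * 1
        = ((-(δ + ε) : ℝ) : ℂ) by push_cast; ring, Complex.norm_real, Real.norm_eq_abs, abs_neg,
        abs_of_pos (by positivity)]
    rw [e3, div_mul_eq_mul_div, ← div_eq_mul_inv, div_div]
    rw [div_le_div_iff₀ (by have := norm_pos_iff.2 (hne1 t); have := norm_pos_iff.2 (hne2 t); positivity)
      (by positivity)]
    refine mul_le_mul_of_nonneg_left ?_ (by positivity)
    calc (1 + t ^ 2) * (min 1 δ * min 1 ε)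
        = (min 1 δ * Real.sqrt (1 + t ^ 2)) * (min 1 ε * Real.sqrt (1 + t ^ 2)) := by
          linear_combination -(min 1 δ * min 1 ε) * hss
      _ ≤ _ := mul_le_mul h1 h2 (by positivity) (norm_nonneg _)
  refine ⟨hint, ?_⟩
  set F : ℝ → ℂ := fun t => ((Real.arctan (t / δ) + Real.arctan (t / ε) : ℝ) : ℂ) +
    ((Real.log (ε ^ 2 + t ^ 2) - Real.log (δ ^ 2 + t ^ 2) : ℝ) : ℂ) * (Complex.I / 2) with hF
  have hderiv : ∀ t : ℝ, HasDerivAt F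
      (1 / ((δ : ℂ) + t * Complex.I) - 1 / (-(ε : ℂ) + t * Complex.I)) t := by
    intro t
    have a1 : HasDerivAt (fun t : ℝ => Real.arctan (t / δ) + Real.arctan (t / ε))
        (1 / (1 + (t / δ) ^ 2) * (1 / δ) + 1 / (1 + (t / ε) ^ 2) * (1 / ε)) t :=
      ((hasDerivAt_id t).div_const δ).arctan.add ((hasDerivAt_id t).div_const ε).arctan
    have a2 : HasDerivAt (fun t : ℝ => Real.log (ε ^ 2 + t ^ 2) - Real.log (δ ^ 2 + t ^ 2))
        (2 * t / (ε ^ 2 + t ^ 2) - 2 * t / (δ ^ 2 + t ^ 2)) t := by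
      have b1 : HasDerivAt (fun t : ℝ => ε ^ 2 + t ^ 2) (2 * t) t := by
        simpa using (hasDerivAt_pow 2 t).const_add (ε ^ 2)
      have b2 : HasDerivAt (fun t : ℝ => δ ^ 2 + t ^ 2) (2 * t) t := by
        simpa using (hasDerivAt_pow 2 t).const_add (δ ^ 2)
      exact (b1.log (by positivity)).sub (b2.log (by positivity))
    have := a1.ofReal_comp.add (a2.ofReal_comp.mul_const (Complex.I / 2))
    refine this.congr_deriv ?_
    have r1 : (1 : ℝ) / (1 + (t / δ) ^ 2) * (1 / δ) = δ / (δ ^ 2 + t ^ 2) := by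
      field_simp
    have r2 : (1 : ℝ) / (1 + (t / ε) ^ 2) * (1 / ε) = ε / (ε ^ 2 + t ^ 2) := by
      field_simp
    rw [r1, r2]
    have c1 : ((δ ^ 2 + t ^ 2 : ℝ) : ℂ) = (δ + t * Complex.I) * (δ - t * Complex.I) := by
      push_cast; linear_combination ((t : ℂ) ^ 2) * Complex.I_sq
    have c2 : ((ε ^ 2 + t ^ 2 : ℝ) : ℂ) = (-ε + t * Complex.I) * (-ε - t * Complex.I) := by
      push_cast; linear_combination ((t : ℂ) ^ 2) * Complex.I_sq
    have n1 := hne1 t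
    have n2 := hne2 t
    have n1' : (δ : ℂ) - t * Complex.I ≠ 0 := by
      have := hne1 (-t); push_cast at this; rwa [neg_mul, ← sub_eq_add_neg] at this
    have n2' : -(ε : ℂ) - t * Complex.I ≠ 0 := by
      have := hne2 (-t); push_cast at this; rwa [neg_mul, ← sub_eq_add_neg] at this
    have d1 : 1 / ((δ : ℂ) + t * Complex.I) = (δ - t * Complex.I) / ((δ ^ 2 + t ^ 2 : ℝ) : ℂ) := by
      rw [c1]; field_simp
    have d2 : 1 / (-(ε : ℂ) + t * Complex.I) = (-ε - t * Complex.I) / ((ε ^ 2 + t ^ 2 : ℝ) : ℂ) := by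
      rw [c2]; field_simp
    rw [d1, d2]
    push_cast
    ring
  have hlog : ∀ l : Filter ℝ, Filter.Tendsto (fun t : ℝ => |t|) l Filter.atTop →
      Filter.Tendsto (fun t : ℝ => Real.log (ε ^ 2 + t ^ 2) - Real.log (δ ^ 2 + t ^ 2)) l (nhds 0) := by
    intro l hl
    have h1 : Filter.Tendsto (fun t : ℝ => 1 + (ε ^ 2 - δ ^ 2) / (δ ^ 2 + t ^ 2)) l (nhds (1 + 0)) := by
      refine tendsto_const_nhds.add (Filter.Tendsto.div_atTop tendsto_const_nhds ?_)
      refine Filter.tendsto_atTop_mono (f := fun t : ℝ => |t| ^ 2) (fun t => ?_)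
        ((Filter.tendsto_pow_atTop two_ne_zero).comp hl)
      rw [sq_abs]; nlinarith [sq_nonneg δ]
    have h2 := (h1.log (by norm_num))
    simp only [add_zero, Real.log_one] at h2
    refine h2.congr fun t => ?_
    rw [← Real.log_div (by positivity) (by positivity)]
    congr 1
    field_simp
    ring
  have htop : Filter.Tendsto F Filter.atTop (nhds (Real.pi : ℂ)) := by
    have h1 : Filter.Tendsto (fun t : ℝ => Real.arctan (t / δ) + Real.arctan (t / ε)) Filter.atTop
        (nhds (Real.pi / 2 + Real.pi / 2)) :=
      ((Real.tendsto_arctan_atTop.mono_right nhdsWithin_le_nhds).comp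
        (Filter.tendsto_id.atTop_div_const hδ)).add
      ((Real.tendsto_arctan_atTop.mono_right nhdsWithin_le_nhds).comp
        (Filter.tendsto_id.atTop_div_const hε))
    have h2 := hlog Filter.atTop Filter.tendsto_abs_atTop_atTop
    have h3 := ((Complex.continuous_ofReal.tendsto _).comp h1).add
      (((Complex.continuous_ofReal.tendsto _).comp h2).mul_const (Complex.I / 2))
    have e : (Real.pi : ℂ) = ((Real.pi / 2 + Real.pi / 2 : ℝ) : ℂ) + ((0 : ℝ) : ℂ) * (Complex.I / 2) := by
      push_cast; ring
    rw [e]; exact h3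
  have hbot : Filter.Tendsto F Filter.atBot (nhds (-Real.pi : ℂ)) := by
    have h1 : Filter.Tendsto (fun t : ℝ => Real.arctan (t / δ) + Real.arctan (t / ε)) Filter.atBot
        (nhds (-(Real.pi / 2) + -(Real.pi / 2))) :=
      ((Real.tendsto_arctan_atBot.mono_right nhdsWithin_le_nhds).comp
        (Filter.tendsto_id.atBot_div_const hδ)).add
      ((Real.tendsto_arctan_atBot.mono_right nhdsWithin_le_nhds).comp
        (Filter.tendsto_id.atBot_div_const hε))
    have h2 := hlog Filter.atBot Filter.tendsto_abs_atBot_atTop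
    have h3 := ((Complex.continuous_ofReal.tendsto _).comp h1).add
      (((Complex.continuous_ofReal.tendsto _).comp h2).mul_const (Complex.I / 2))
    have e : (-Real.pi : ℂ) = ((-(Real.pi / 2) + -(Real.pi / 2) : ℝ) : ℂ) +
        ((0 : ℝ) : ℂ) * (Complex.I / 2) := by
      push_cast; ring
    rw [e]; exact h3
  rw [integral_of_hasDerivAt_of_tendsto hderiv hint hbot htop]
  ring

theorem integrable_and_integral_pole {σ : ℝ} {p : ℂ} (h1 : σ - 1 < p.re) (h2 : p.re < σ) :
    Integrable (fun t : ℝ => 1 / ((σ : ℂ) + t * Complex.I - p) -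
      1 / (((σ - 1 : ℝ) : ℂ) + t * Complex.I - p)) ∧
    ∫ t : ℝ, (1 / ((σ : ℂ) + t * Complex.I - p) -
      1 / (((σ - 1 : ℝ) : ℂ) + t * Complex.I - p)) = 2 * Real.pi := by
  obtain ⟨hi, hv⟩ := integrable_and_integral_pole_zero (sub_pos.2 h2) (ε := p.re - (σ - 1))
    (by linarith)
  have e : (fun t : ℝ => 1 / ((σ : ℂ) + t * Complex.I - p) -
      1 / (((σ - 1 : ℝ) : ℂ) + t * Complex.I - p)) = fun t : ℝ =>
      (fun t : ℝ => 1 / (((σ - p.re : ℝ) : ℂ) + t * Complex.I) -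
        1 / (-((p.re - (σ - 1) : ℝ) : ℂ) + t * Complex.I)) (t - p.im) := by
    funext t
    have hp := Complex.re_add_im p
    congr 2
    · push_cast; linear_combination hp
    · push_cast; linear_combination hp
  rw [e]
  exact ⟨hi.comp_sub_right p.im, (integral_sub_right_eq_self _ p.im).trans hv⟩

theorem integrable_rpow_neg_one_sub {η : ℝ} (hη : 0 < η) :
    Integrable (fun t : ℝ => (1 + |t|) ^ (-1 - η)) := by
  have := integrable_one_add_norm (E := ℝ) (μ := volume) (r := 1 + η) (by simpa using hη)
  simpa [Real.norm_eq_abs, neg_add, sub_eq_add_neg, add_comm] using this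

theorem integrable_of_decay {F : ℝ → ℂ} (hF : Continuous F) {C η : ℝ} (hη : 0 < η)
    (h : ∀ t, ‖F t‖ ≤ C * (1 + |t|) ^ (-1 - η)) : Integrable F :=
  Integrable.mono' ((integrable_rpow_neg_one_sub hη).const_mul C) hF.aestronglyMeasurable
    (Filter.Eventually.of_forall h)

theorem strip_residue {ι : Type*} (S : Finset ι) (p l : ι → ℂ) (σ : ℝ) (f : ℂ → ℂ)
    (hinj : Set.InjOn p S) (hp : ∀ i ∈ S, σ - 1 < (p i).re ∧ (p i).re < σ)
    (hd : ∀ s : ℂ, σ - 1 ≤ s.re → s.re ≤ σ → (∀ i ∈ S, s ≠ p i) → DifferentiableAt ℂ f s)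
    (hres : ∀ i ∈ S, Filter.Tendsto (fun s => (s - p i) * f s) (nhdsWithin (p i) {p i}ᶜ)
      (nhds (l i)))
    {C η T₀ : ℝ} (hη : 0 < η)
    (hdec : ∀ s : ℂ, σ - 1 ≤ s.re → s.re ≤ σ → (T₀ ≤ |s.im| ∨ s.re = σ ∨ s.re = σ - 1) →
      ‖f s‖ ≤ C * (1 + |s.im|) ^ (-1 - η)) :
    Integrable (fun t : ℝ => f (σ + t * Complex.I)) ∧
    Integrable (fun t : ℝ => f (((σ - 1 : ℝ) : ℂ) + t * Complex.I)) ∧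
    (∫ t : ℝ, f (σ + t * Complex.I)) - ∫ t : ℝ, f (((σ - 1 : ℝ) : ℂ) + t * Complex.I) =
      2 * Real.pi * ∑ i ∈ S, l i := by
  classical
  have hre : ∀ a t : ℝ, ((a : ℂ) + t * Complex.I).re = a := by intro a t; simp
  have him : ∀ a t : ℝ, ((a : ℂ) + t * Complex.I).im = t := by intro a t; simp
  have hcont : ∀ a : ℝ, (a = σ ∨ a = σ - 1) →
      Continuous (fun t : ℝ => f ((a : ℂ) + t * Complex.I)) := by
    intro a ha
    refine continuous_iff_continuousAt.2 fun t => ?_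
    have h := hd ((a : ℂ) + t * Complex.I) (by rw [hre]; rcases ha with rfl | rfl <;> linarith)
      (by rw [hre]; rcases ha with rfl | rfl <;> linarith) (fun i hi h => by
        have h1 := hp i hi
        rw [← h, hre] at h1
        rcases ha with rfl | rfl <;> linarith [h1.1, h1.2])
    exact ContinuousAt.comp (f := fun t : ℝ => (a : ℂ) + t * Complex.I) h.continuousAt (by fun_prop)
  have hI1 : Integrable (fun t : ℝ => f (σ + t * Complex.I)) :=
    integrable_of_decay (hcont σ (Or.inl rfl)) hη (fun t => by
      simpa using hdec (σ + t * Complex.I) (by simp) (by simp) (by simp))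
  have hI2 : Integrable (fun t : ℝ => f (((σ - 1 : ℝ) : ℂ) + t * Complex.I)) :=
    integrable_of_decay (hcont (σ - 1) (Or.inr rfl)) hη (fun t => by
      have := hdec (((σ - 1 : ℝ) : ℂ) + t * Complex.I) (by rw [hre]) (by rw [hre]; linarith)
        (by rw [hre]; simp)
      rwa [him] at this)
  refine ⟨hI1, hI2, ?_⟩
  set q : ℂ → ℂ := fun s => ∑ i ∈ S, l i * (1 / (s - p i)) with hq
  set U : Set ℂ := {s : ℂ | σ - 1 ≤ s.re ∧ s.re ≤ σ} with hU
  have hUn : ∀ z ∈ S.image p, U ∈ nhds z := by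
    intro z hz
    obtain ⟨i, hi, rfl⟩ := Finset.mem_image.1 hz
    have h1 : {s : ℂ | σ - 1 < s.re ∧ s.re < σ} ∈ nhds (p i) :=
      ((isOpen_lt continuous_const Complex.continuous_re).inter
        (isOpen_lt Complex.continuous_re continuous_const)).mem_nhds (hp i hi)
    exact Filter.mem_of_superset h1 fun s hs => ⟨hs.1.le, hs.2.le⟩
  obtain ⟨h, hh, hhe⟩ := exists_differentiableOn_of_removable (U := U) (S.image p)
    (fun s => f s - q s) hUn (by
      intro s hs
      have hsn : ∀ i ∈ S, s ≠ p i := by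
        intro i hi he
        exact hs.2 (by rw [he]; exact_mod_cast Finset.mem_image_of_mem p hi)
      refine (DifferentiableAt.sub (hd s hs.1.1 hs.1.2 hsn) ?_).differentiableWithinAt
      rw [hq]
      refine DifferentiableAt.fun_sum fun i hi => ?_
      exact (differentiableAt_const _).mul ((differentiableAt_const _).div (by fun_prop)
        (sub_ne_zero.2 (hsn i hi)))) (by
      intro z hz
      obtain ⟨i, hi, rfl⟩ := Finset.mem_image.1 hz
      have h1 : Filter.Tendsto (fun s => (s - p i) * q s) (nhdsWithin (p i) {p i}ᶜ)
          (nhds (l i)) := by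
        have e : ∑ j ∈ S, (if j = i then l i else 0) = l i := by simp [hi]
        rw [← e]
        have : (fun s => (s - p i) * q s) =
            fun s => ∑ j ∈ S, (s - p i) * (l j * (1 / (s - p j))) := by
          funext s; rw [hq, Finset.mul_sum]
        rw [this]
        refine tendsto_finsetSum _ fun j hj => ?_
        by_cases hji : j = i
        · subst hji
          rw [if_pos rfl]
          refine (tendsto_const_nhds).congr' ?_
          filter_upwards [self_mem_nhdsWithin] with s hs
          have : s - p j ≠ 0 := sub_ne_zero.2 hs
          field_simp
        · rw [if_neg hji]
          have hne : p i - p j ≠ 0 := sub_ne_zero.2 fun he => hji (hinj hj hi he.symm)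
          have : ContinuousAt (fun s => (s - p i) * (l j * (1 / (s - p j)))) (p i) := by
            refine ContinuousAt.mul (by fun_prop) (continuousAt_const.mul
              (continuousAt_const.div (by fun_prop) hne))
          have h2 := this.tendsto
          simp only [sub_self, zero_mul] at h2
          exact h2.mono_left nhdsWithin_le_nhds
      have h2 := (hres i hi).sub h1
      rw [sub_self] at h2
      exact h2.congr fun s => by ring)
  have hpole : ∀ a t : ℝ, (a = σ ∨ a = σ - 1) → (a : ℂ) + t * Complex.I ∉ S.image p := by
    intro a t ha hm
    obtain ⟨i, hi, he⟩ := Finset.mem_image.1 hm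
    have h1 := hp i hi
    rw [he, hre] at h1
    rcases ha with rfl | rfl <;> linarith [h1.1, h1.2]
  set D : ℝ → ℂ := fun t => h (σ + t * Complex.I) - h (((σ - 1 : ℝ) : ℂ) + t * Complex.I) with hD
  have hDe : D = fun t : ℝ => (f (σ + t * Complex.I) - f (((σ - 1 : ℝ) : ℂ) + t * Complex.I)) -
      ∑ i ∈ S, l i * (1 / ((σ : ℂ) + t * Complex.I - p i) -
        1 / (((σ - 1 : ℝ) : ℂ) + t * Complex.I - p i)) := by
    funext t
    rw [hD]
    simp only
    rw [hhe _ (hpole σ t (Or.inl rfl)), hhe _ (hpole (σ - 1) t (Or.inr rfl))]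
    simp only [hq, mul_sub, Finset.sum_sub_distrib]
    ring
  have hqi : ∀ i ∈ S, Integrable (fun t : ℝ => l i * (1 / ((σ : ℂ) + t * Complex.I - p i) -
        1 / (((σ - 1 : ℝ) : ℂ) + t * Complex.I - p i))) := fun i hi =>
    (integrable_and_integral_pole (hp i hi).1 (hp i hi).2).1.const_mul _
  have hDi : Integrable D := by
    rw [hDe]; exact (hI1.sub hI2).sub (integrable_finsetSum _ hqi)
  have hDv : ∫ t, D t = ((∫ t : ℝ, f (σ + t * Complex.I)) -
      ∫ t : ℝ, f (((σ - 1 : ℝ) : ℂ) + t * Complex.I)) - 2 * Real.pi * ∑ i ∈ S, l i := by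
    have e1 := integral_sub (hI1.sub hI2) (integrable_finsetSum _ hqi)
    simp only [Pi.sub_apply] at e1
    simp only [hDe]
    rw [e1, integral_sub hI1 hI2, integral_finsetSum _ hqi, Finset.mul_sum]
    congr 1
    refine Finset.sum_congr rfl fun i hi => ?_
    rw [integral_const_mul, (integrable_and_integral_pole (hp i hi).1 (hp i hi).2).2]
    ring
  suffices hz : ∫ t, D t = 0 by
    rw [hDv] at hz; exact sub_eq_zero.1 hz
  have hlim1 : Filter.Tendsto (fun T : ℝ => ∫ t in (-T)..T, D t) Filter.atTop (nhds (∫ t, D t)) :=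
    intervalIntegral_tendsto_integral hDi Filter.tendsto_neg_atTop_atBot Filter.tendsto_id
  have hlim2 : Filter.Tendsto (fun T : ℝ => ∫ t in (-T)..T, D t) Filter.atTop (nhds 0) := by
    set B : ℝ → ℝ := fun T => |C| * (1 + T) ^ (-1 - η) + ∑ i ∈ S, ‖l i‖ * (1 / (T - |(p i).im|))
      with hB
    have hBlim : Filter.Tendsto (fun T => 2 * B T) Filter.atTop (nhds 0) := by
      have : Filter.Tendsto (fun T : ℝ => 2 * B T) Filter.atTop
          (nhds (2 * (|C| * 0 + ∑ i ∈ S, ‖l i‖ * 0))) := by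
        refine Filter.Tendsto.const_mul _ (Filter.Tendsto.add (Filter.Tendsto.const_mul _ ?_)
          (tendsto_finsetSum _ fun i _ => Filter.Tendsto.const_mul _ ?_))
        · have := (tendsto_rpow_neg_atTop (y := 1 + η) (by linarith)).comp
            (Filter.tendsto_atTop_add_const_left _ (1 : ℝ) Filter.tendsto_id)
          refine this.congr fun T => ?_
          simp only [Function.comp, id]
          congr 1
          ring
        · refine Filter.Tendsto.div_atTop tendsto_const_nhds ?_
          exact Filter.tendsto_atTop_add_const_right _ _ Filter.tendsto_id
      simpa using this
    refine squeeze_zero_norm' ?_ hBlim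
    filter_upwards [Filter.eventually_ge_atTop (|T₀| + 1 + ∑ i ∈ S, |(p i).im|)] with T hT
    have hTp : ∀ i ∈ S, |(p i).im| < T := by
      intro i hi
      have := Finset.single_le_sum (f := fun i => |(p i).im|) (fun i _ => abs_nonneg _) hi
      linarith [abs_nonneg T₀]
    have hsum0 : 0 ≤ ∑ i ∈ S, |(p i).im| := Finset.sum_nonneg fun i _ => abs_nonneg _
    have hT0 : 0 < T := by linarith [abs_nonneg T₀]
    have hhor : ∀ t : ℝ, |t| = T → ‖∫ x in (σ - 1)..σ, h (x + t * Complex.I)‖ ≤ B T := by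
      intro t ht
      have := intervalIntegral.norm_integral_le_of_norm_le_const (a := σ - 1) (b := σ)
        (f := fun x : ℝ => h (x + t * Complex.I)) (C := B T) (by
          intro x hx
          rw [Set.uIoc_of_le (by linarith)] at hx
          have hn : (x : ℂ) + t * Complex.I ∉ S.image p := by
            intro hm
            obtain ⟨i, hi, he⟩ := Finset.mem_image.1 hm
            have h1 := hTp i hi
            rw [he, him, ht] at h1
            exact lt_irrefl _ h1
          rw [hhe _ hn]
          refine (norm_sub_le _ _).trans (add_le_add ?_ ?_)
          · have := hdec (x + t * Complex.I) (by rw [hre]; exact hx.1.le) (by rw [hre]; exact hx.2)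
              (Or.inl (by rw [him, ht]; linarith [le_abs_self T₀]))
            rw [him, ht] at this
            exact this.trans (mul_le_mul_of_nonneg_right (le_abs_self C) (by positivity))
          · rw [hq]
            refine (norm_sum_le _ _).trans (Finset.sum_le_sum fun i hi => ?_)
            rw [norm_mul]
            refine mul_le_mul_of_nonneg_left ?_ (norm_nonneg _)
            rw [norm_div, norm_one]
            refine one_div_le_one_div_of_le (by linarith [hTp i hi]) ?_
            refine le_trans ?_ (Complex.abs_im_le_norm _)
            rw [Complex.sub_im, him, ← ht]
            exact abs_sub_abs_le_abs_sub _ _)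
      simpa using this
    have hrect := Complex.integral_boundary_rect_eq_zero_of_differentiableOn h
      (((σ - 1 : ℝ) : ℂ) + ((-T : ℝ) : ℂ) * Complex.I) ((σ : ℂ) + T * Complex.I) (by
        refine hh.mono ?_
        intro s hs
        rw [hre, hre, him, him] at hs
        have := hs.1
        simp only [Set.mem_preimage, Set.uIcc_of_le (show σ - 1 ≤ σ by linarith)] at this
        exact this)
    rw [hre, hre, him, him] at hrect
    have hhc : ContinuousOn h U := hh.continuousOn
    have hvi : ∀ a : ℝ, (a = σ ∨ a = σ - 1) →
        IntervalIntegrable (fun y : ℝ => h (a + y * Complex.I)) volume (-T) T := by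
      intro a ha
      refine Continuous.intervalIntegrable ?_ _ _
      refine hhc.comp_continuous (by fun_prop) fun y => ?_
      change σ - 1 ≤ _ ∧ _ ≤ σ
      rw [hre]
      rcases ha with rfl | rfl <;> constructor <;> linarith
    have hDint : ∫ t in (-T)..T, D t = (∫ t in (-T)..T, h (σ + t * Complex.I)) -
        ∫ t in (-T)..T, h (((σ - 1 : ℝ) : ℂ) + t * Complex.I) :=
      intervalIntegral.integral_sub (hvi σ (Or.inl rfl)) (hvi _ (Or.inr rfl))
    have hfin : Complex.I * ∫ t in (-T)..T, D t =
        (∫ x in (σ - 1)..σ, h (x + T * Complex.I)) -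
        ∫ x in (σ - 1)..σ, h (x + ((-T : ℝ) : ℂ) * Complex.I) := by
      rw [hDint]
      simp only [smul_eq_mul] at hrect
      linear_combination hrect
    have hn : ‖∫ t in (-T)..T, D t‖ = ‖Complex.I * ∫ t in (-T)..T, D t‖ := by
      rw [norm_mul, Complex.norm_I, one_mul]
    rw [hn, hfin]
    refine (norm_sub_le _ _).trans ?_
    have a1 := hhor T (abs_of_pos hT0)
    have a2 := hhor (-T) (by rw [abs_neg, abs_of_pos hT0])
    linarith
  exact tendsto_nhds_unique hlim1 hlim2

/-- A meromorphic function, periodic up to the multiplier `κ`, whose poles in the closed strip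
`σ - 1 ≤ Re s ≤ σ` are simple, interior, located at `p i` with residue `l i` for `i ∈ S`. -/
structure StripPoles (σ : ℝ) (S : Finset (Fin 3)) (p l : Fin 3 → ℂ) (κ : ℂ) (Θ : ℂ → ℂ) :
    Prop where
  period : ∀ s, Θ (s - 1) = κ * Θ s
  inj : Set.InjOn p S
  mem : ∀ i ∈ S, σ - 1 < (p i).re ∧ (p i).re < σ
  diff : ∀ s : ℂ, σ - 1 ≤ s.re → s.re ≤ σ → (∀ i ∈ S, s ≠ p i) → DifferentiableAt ℂ Θ s
  res : ∀ i ∈ S, Filter.Tendsto (fun s => (s - p i) * Θ s) (nhdsWithin (p i) {p i}ᶜ) (nhds (l i))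

/-- Summable decay of `f` on the edges and towards the ends of the strip `σ - 1 ≤ Re s ≤ σ`. -/
def StripDecay (σ : ℝ) (f : ℂ → ℂ) : Prop :=
  ∃ C η T₀ : ℝ, 0 < η ∧ ∀ s : ℂ, σ - 1 ≤ s.re → s.re ≤ σ →
    (T₀ ≤ |s.im| ∨ s.re = σ ∨ s.re = σ - 1) → ‖f s‖ ≤ C * (1 + |s.im|) ^ (-1 - η)

section

variable {σ : ℝ} {S : Finset (Fin 3)} {p l : Fin 3 → ℂ} {κ : ℂ} {Θ a : ℂ → ℂ}

theorem StripPoles.one_strip (h : StripPoles σ S p l κ Θ) (hσ : σ < 0)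
    (ha : ∀ s : ℂ, s.re < 0 → DifferentiableAt ℂ a s) (n : ℕ)
    (hdec : StripDecay σ (fun s => a (s - n) * Θ s)) :
    Integrable (fun t : ℝ => a (σ + t * Complex.I - n) * Θ (σ + t * Complex.I)) ∧
    (∫ t : ℝ, a (σ + t * Complex.I - n) * Θ (σ + t * Complex.I)) -
      κ * ∫ t : ℝ, a (σ + t * Complex.I - (n + 1 : ℕ)) * Θ (σ + t * Complex.I) =
      2 * Real.pi * ∑ i ∈ S, l i * a (p i - n) := by
  obtain ⟨C, η, T₀, hη, hC⟩ := hdec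
  have hcast : ∀ s : ℂ, (s - n).re = s.re - n := by intro s; simp
  have han : ∀ s : ℂ, s.re ≤ σ → DifferentiableAt ℂ (fun s => a (s - n)) s := by
    intro s hs
    have : DifferentiableAt ℂ a (s - n) := ha _ (by
      rw [hcast]; have : (0 : ℝ) ≤ n := n.cast_nonneg
      linarith)
    exact DifferentiableAt.comp (f := fun s => s - (n : ℂ)) s this (by fun_prop)
  obtain ⟨h1, _, h3⟩ := strip_residue S p (fun i => l i * a (p i - n)) σ
    (fun s => a (s - n) * Θ s) h.inj h.mem
    (fun s h1 h2 h3 => (han s h2).mul (h.diff s h1 h2 h3)) (by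
      intro i hi
      have t1 := (han (p i) (h.mem i hi).2.le).continuousAt.tendsto.mono_left
        (nhdsWithin_le_nhds (s := {p i}ᶜ))
      refine ((h.res i hi).mul t1).congr fun s => by ring) hη hC
  refine ⟨h1, ?_⟩
  rw [← h3, ← integral_const_mul]
  congr 1
  refine integral_congr_ae (Filter.Eventually.of_forall fun t => ?_)
  have e1 : (((σ - 1 : ℝ) : ℂ) + t * Complex.I) = (σ + t * Complex.I) - 1 := by push_cast; ring
  simp only [e1, h.period]
  have e2 : (σ : ℂ) + t * Complex.I - ((n + 1 : ℕ) : ℂ) = σ + t * Complex.I - 1 - n := by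
    push_cast; ring
  rw [e2]
  ring

theorem StripPoles.sum_range (h : StripPoles σ S p l κ Θ) (hσ : σ < 0)
    (ha : ∀ s : ℂ, s.re < 0 → DifferentiableAt ℂ a s)
    (hdec : ∀ n : ℕ, StripDecay σ (fun s => a (s - n) * Θ s)) (N : ℕ) :
    2 * Real.pi * ∑ n ∈ Finset.range N, ∑ i ∈ S, l i * (κ ^ n * a (p i - n)) =
      (∫ t : ℝ, a (σ + t * Complex.I) * Θ (σ + t * Complex.I)) -
      κ ^ N * ∫ t : ℝ, a (σ + t * Complex.I - N) * Θ (σ + t * Complex.I) := by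
  induction N with
  | zero => simp
  | succ N ih =>
    rw [Finset.sum_range_succ, mul_add, ih]
    have h1 := (h.one_strip hσ ha N (hdec N)).2
    have e : ∑ i ∈ S, l i * (κ ^ N * a (p i - N)) = κ ^ N * ∑ i ∈ S, l i * a (p i - N) := by
      rw [Finset.mul_sum]; exact Finset.sum_congr rfl fun i _ => by ring
    rw [e]
    linear_combination -κ ^ N * h1

theorem norm_le_half_pow_of_ratio {R : ℝ}
    (hR : ∀ s : ℂ, s.re ≤ -R → ‖a (s - 1)‖ ≤ 1 / 2 * ‖a s‖) {s : ℂ} (hs : s.re ≤ -R) (m : ℕ) :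
    ‖a (s - m)‖ ≤ (1 / 2) ^ m * ‖a s‖ := by
  induction m with
  | zero => simp
  | succ m ih =>
    have e : s - ((m + 1 : ℕ) : ℂ) = s - m - 1 := by push_cast; ring
    rw [e]
    refine (hR _ ?_).trans ?_
    · have : (0 : ℝ) ≤ m := m.cast_nonneg
      simp; linarith
    · rw [pow_succ]; linarith

theorem summable_of_ratio {R : ℝ} (hκ : ‖κ‖ = 1)
    (hR : ∀ s : ℂ, s.re ≤ -R → ‖a (s - 1)‖ ≤ 1 / 2 * ‖a s‖) (s : ℂ) :
    Summable (fun n : ℕ => κ ^ n * a (s - n)) := by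
  refine summable_of_ratio_norm_eventually_le (r := 1 / 2) (by norm_num) ?_
  obtain ⟨N, hN⟩ := exists_nat_ge (s.re + R)
  filter_upwards [Filter.eventually_ge_atTop N] with n hn
  have e : s - ((n + 1 : ℕ) : ℂ) = s - n - 1 := by push_cast; ring
  have hn' : (N : ℝ) ≤ n := by exact_mod_cast hn
  have h1 := hR (s - n) (by simp; linarith)
  rw [norm_mul, norm_mul, norm_pow, norm_pow, hκ, one_pow, one_pow, one_mul, one_mul, e]
  exact h1

theorem StripPoles.tsum (h : StripPoles σ S p l κ Θ) (hσ : σ < 0) (hκ : ‖κ‖ = 1)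
    (ha : ∀ s : ℂ, s.re < 0 → DifferentiableAt ℂ a s)
    (hdec : ∀ n : ℕ, StripDecay σ (fun s => a (s - n) * Θ s))
    {R : ℝ} (hR : ∀ s : ℂ, s.re ≤ -R → ‖a (s - 1)‖ ≤ 1 / 2 * ‖a s‖) :
    2 * Real.pi * ∑ i ∈ S, l i * ∑' n : ℕ, κ ^ n * a (p i - n) =
      ∫ t : ℝ, a (σ + t * Complex.I) * Θ (σ + t * Complex.I) := by
  have hs := fun i : Fin 3 => summable_of_ratio hκ hR (p i)
  have h1 : Filter.Tendsto (fun N => 2 * Real.pi * ∑ n ∈ Finset.range N,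
      ∑ i ∈ S, l i * (κ ^ n * a (p i - n))) Filter.atTop
      (nhds (2 * Real.pi * ∑ i ∈ S, l i * ∑' n : ℕ, κ ^ n * a (p i - n))) := by
    refine Filter.Tendsto.const_mul _ ?_
    simp_rw [Finset.sum_comm (s := Finset.range _), ← Finset.mul_sum]
    exact tendsto_finsetSum _ fun i _ => ((hs i).hasSum.tendsto_sum_nat).const_mul _
  obtain ⟨N₀, hN₀⟩ := exists_nat_ge (σ + R)
  have h2 : Filter.Tendsto (fun N : ℕ => κ ^ N * ∫ t : ℝ, a (σ + t * Complex.I - N) *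
      Θ (σ + t * Complex.I)) Filter.atTop (nhds 0) := by
    rw [← Filter.tendsto_add_atTop_iff_nat N₀]
    have hI := (h.one_strip hσ ha N₀ (hdec N₀)).1.norm
    set M := ∫ t : ℝ, ‖a (σ + t * Complex.I - N₀) * Θ (σ + t * Complex.I)‖
    have hz : Filter.Tendsto (fun m : ℕ => (1 / 2 : ℝ) ^ m * M) Filter.atTop (nhds 0) := by
      simpa using (tendsto_pow_atTop_nhds_zero_of_lt_one (r := (1 / 2 : ℝ)) (by norm_num)
        (by norm_num)).mul_const M
    refine squeeze_zero_norm (fun m => ?_) hz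
    rw [norm_mul, norm_pow, hκ, one_pow, one_mul, ← integral_const_mul]
    refine norm_integral_le_of_norm_le (hI.const_mul _) (Filter.Eventually.of_forall fun t => ?_)
    have := norm_le_half_pow_of_ratio hR (s := σ + t * Complex.I - N₀) (by simp; linarith) m
    have e : (σ : ℂ) + t * Complex.I - ((m + N₀ : ℕ) : ℂ) = σ + t * Complex.I - N₀ - m := by
      push_cast; ring
    rw [e, norm_mul, norm_mul, ← mul_assoc]
    exact mul_le_mul_of_nonneg_right this (norm_nonneg _)
  have h3 : Filter.Tendsto (fun N => 2 * Real.pi * ∑ n ∈ Finset.range N,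
      ∑ i ∈ S, l i * (κ ^ n * a (p i - n))) Filter.atTop
      (nhds ((∫ t : ℝ, a (σ + t * Complex.I) * Θ (σ + t * Complex.I)) - 0)) := by
    refine (tendsto_const_nhds.sub h2).congr fun N => ?_
    exact (h.sum_range hσ ha hdec N).symm
  rw [sub_zero] at h3
  exact tendsto_nhds_unique h1 h3

end

theorem one_add_abs_rpow_le {u v c e E : ℝ} (huv : |u - v| ≤ c) (he : |e| ≤ E) :
    (1 + |u|) ^ e ≤ (1 + c) ^ E * (1 + |v|) ^ e := by
  have hc : 0 ≤ c := (abs_nonneg _).trans huv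
  have hu : 0 < 1 + |u| := by positivity
  have hv : 0 < 1 + |v| := by positivity
  have hE : (1 + c) ^ |e| ≤ (1 + c) ^ E := Real.rpow_le_rpow_of_exponent_le (by linarith) he
  have h1 : 1 + |u| ≤ (1 + c) * (1 + |v|) := by
    have := abs_sub_abs_le_abs_sub u v
    nlinarith [abs_nonneg v]
  have h2 : 1 + |v| ≤ (1 + c) * (1 + |u|) := by
    have := abs_sub_abs_le_abs_sub v u
    rw [abs_sub_comm] at this
    nlinarith [abs_nonneg u]
  refine le_trans ?_ (mul_le_mul_of_nonneg_right hE (by positivity))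
  rcases le_total 0 e with h | h
  · rw [abs_of_nonneg h, ← Real.mul_rpow (by linarith) hv.le]
    exact Real.rpow_le_rpow hu.le h1 h
  · rw [abs_of_nonpos h]
    have h3 := Real.rpow_le_rpow hv.le h2 (neg_nonneg.2 h)
    rw [Real.mul_rpow (by linarith) hu.le, Real.rpow_neg hv.le, Real.rpow_neg hu.le] at h3
    have p1 : 0 < (1 + |u|) ^ e := Real.rpow_pos_of_pos hu e
    have p2 : 0 < (1 + |v|) ^ e := Real.rpow_pos_of_pos hv e
    rw [← div_eq_mul_inv, le_div_iff₀ p1, inv_mul_le_iff₀ p2] at h3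
    linarith

theorem norm_Gamma_one_sub_add_inv_le (ν : ℂ) (a b : ℝ) : ∃ K, 0 < K ∧ ∀ s : ℂ, a ≤ s.re →
    s.re ≤ b → ‖(Complex.Gamma (1 - s + ν))⁻¹‖ ≤
      K * ((1 + |s.im|) ^ (-1 / 2 + s.re - ν.re) * Real.exp (Real.pi / 2 * |s.im|)) := by
  obtain ⟨K, hK, h⟩ := norm_Gamma_inv_le (1 - b + ν.re) (1 - a + ν.re)
  set E := 1 / 2 + |a| + |b| + |ν.re| with hE
  refine ⟨K * ((1 + |ν.im|) ^ E * Real.exp (Real.pi / 2 * |ν.im|)), by positivity, fun s h1 h2 => ?_⟩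
  have hh := h (1 - s + ν) (by simp; linarith) (by simp; linarith)
  refine hh.trans ?_
  have hre : (1 - s + ν).re = 1 - s.re + ν.re := by simp
  have him : (1 - s + ν).im = -s.im + ν.im := by simp
  rw [hre, him, mul_assoc]
  refine mul_le_mul_of_nonneg_left ?_ hK.le
  have e1 := one_add_abs_rpow_le (u := -s.im + ν.im) (v := -s.im) (c := |ν.im|)
    (e := 1 / 2 - (1 - s.re + ν.re)) (E := E) (by simp) (by
      rw [hE, abs_le]
      constructor <;> linarith [neg_abs_le a, le_abs_self b, neg_abs_le b, le_abs_self a,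
        neg_abs_le ν.re, le_abs_self ν.re])
  have e2 : Real.exp (Real.pi / 2 * |-s.im + ν.im|) ≤
      Real.exp (Real.pi / 2 * |ν.im|) * Real.exp (Real.pi / 2 * |s.im|) := by
    rw [← Real.exp_add]
    refine Real.exp_le_exp.2 ?_
    have := abs_add_le (-s.im) ν.im
    rw [abs_neg] at this
    nlinarith [Real.pi_pos]
  rw [abs_neg] at e1
  have e3 : (1 / 2 - (1 - s.re + ν.re)) = -1 / 2 + s.re - ν.re := by ring
  rw [e3] at e1 ⊢
  calc _ ≤ ((1 + |ν.im|) ^ E * (1 + |s.im|) ^ (-1 / 2 + s.re - ν.re)) *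
        (Real.exp (Real.pi / 2 * |ν.im|) * Real.exp (Real.pi / 2 * |s.im|)) :=
        mul_le_mul e1 e2 (by positivity) (by positivity)
    _ = _ := by ring

/-- The product `∏ₖ 1 / Γ(1 - s + νₖ)`. -/
noncomputable def invGammaProd (ν : Fin 3 → ℂ) (s : ℂ) : ℂ := ∏ k, (Complex.Gamma (1 - s + ν k))⁻¹

theorem norm_prod_Gamma_inv_le (ν : Fin 3 → ℂ) (P : Finset (Fin 3)) (a b : ℝ) :
    ∃ K, 0 < K ∧ ∀ s : ℂ, a ≤ s.re → s.re ≤ b →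
      ‖∏ k ∈ P, (Complex.Gamma (1 - s + ν k))⁻¹‖ ≤
      K * ((1 + |s.im|) ^ (∑ k ∈ P, (-1 / 2 + s.re - (ν k).re)) *
        Real.exp (P.card * (Real.pi / 2 * |s.im|))) := by
  classical
  induction P using Finset.induction_on with
  | empty => exact ⟨1, one_pos, fun s _ _ => by simp⟩
  | insert c P hc ih =>
    obtain ⟨K, hK, h⟩ := ih
    obtain ⟨K', hK', h'⟩ := norm_Gamma_one_sub_add_inv_le (ν c) a b
    refine ⟨K' * K, by positivity, fun s h1 h2 => ?_⟩
    rw [Finset.prod_insert hc, Finset.sum_insert hc, Finset.card_insert_of_notMem hc, norm_mul,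
      Real.rpow_add (by positivity)]
    refine (mul_le_mul (h' s h1 h2) (h s h1 h2) (norm_nonneg _) (by positivity)).trans
      (le_of_eq ?_)
    push_cast
    rw [add_mul, Real.exp_add, one_mul]
    ring

theorem norm_invGammaProd_le {ν : Fin 3 → ℂ} (hν : ∑ k, ν k = 0) (a b : ℝ) :
    ∃ K, 0 < K ∧ ∀ s : ℂ, a ≤ s.re → s.re ≤ b → ‖invGammaProd ν s‖ ≤
      K * ((1 + |s.im|) ^ (-3 / 2 + 3 * s.re) * Real.exp (3 * Real.pi / 2 * |s.im|)) := by
  obtain ⟨K, hK, h⟩ := norm_prod_Gamma_inv_le ν Finset.univ a b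
  refine ⟨K, hK, fun s h1 h2 => ?_⟩
  have := h s h1 h2
  have e : ∑ k : Fin 3, (-1 / 2 + s.re - (ν k).re) = -3 / 2 + 3 * s.re := by
    have := congrArg Complex.re hν
    simp only [Complex.re_sum, Complex.zero_re] at this
    rw [Finset.sum_sub_distrib, this]
    simp; ring
  rw [e] at this
  refine this.trans (le_of_eq ?_)
  congr 3
  simp; ring

theorem differentiable_invGammaProd (ν : Fin 3 → ℂ) : Differentiable ℂ (invGammaProd ν) := by
  unfold invGammaProd
  refine Differentiable.fun_finsetProd fun k _ => ?_
  exact Complex.differentiable_one_div_Gamma.comp (by fun_prop)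

theorem Gamma_add_nat {z : ℂ} (hz : ∀ m : ℕ, z + m ≠ 0) (n : ℕ) :
    Complex.Gamma (z + n) = (∏ m ∈ Finset.range n, (z + m)) * Complex.Gamma z := by
  induction n with
  | zero => simp
  | succ n ih =>
    rw [Finset.prod_range_succ, Nat.cast_succ, ← add_assoc, Complex.Gamma_add_one _ (hz n), ih]
    ring

/-- The entire function that agrees with `∏ₖ 1 / Γ(1 - s + νₖ) · Γ(1 - s + νⱼ + n)` off the
poles of the last factor. -/
noncomputable def cancelledGammaProd (ν : Fin 3 → ℂ) (j : Fin 3) (n : ℕ) (s : ℂ) : ℂ :=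
  (∏ m ∈ Finset.range n, (1 - s + ν j + m)) *
    ∏ k ∈ Finset.univ.erase j, (Complex.Gamma (1 - s + ν k))⁻¹

theorem cancelledGammaProd_eq {ν : Fin 3 → ℂ} {j : Fin 3} {s : ℂ}
    (hs : ∀ m : ℕ, 1 - s + ν j + m ≠ 0) (n : ℕ) :
    cancelledGammaProd ν j n s = invGammaProd ν s * Complex.Gamma (1 - s + ν j + n) := by
  have h0 : Complex.Gamma (1 - s + ν j) ≠ 0 := by
    refine Complex.Gamma_ne_zero fun m hm => hs m ?_
    rw [hm]; ring
  rw [Gamma_add_nat hs, cancelledGammaProd, invGammaProd,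
    ← Finset.mul_prod_erase Finset.univ _ (Finset.mem_univ j)]
  field_simp

theorem differentiable_cancelledGammaProd (ν : Fin 3 → ℂ) (j : Fin 3) (n : ℕ) :
    Differentiable ℂ (cancelledGammaProd ν j n) := by
  unfold cancelledGammaProd
  refine Differentiable.mul ?_ ?_
  · exact Differentiable.fun_finsetProd fun k _ => by fun_prop
  · refine Differentiable.fun_finsetProd fun k _ => ?_
    exact Complex.differentiable_one_div_Gamma.comp (by fun_prop)

theorem norm_one_sub_add_le (a b : ℝ) (c : ℂ) : ∃ K, 1 ≤ K ∧ ∀ s : ℂ, a ≤ s.re → s.re ≤ b →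
    ‖1 - s + c‖ ≤ K * (1 + |s.im|) := by
  refine ⟨1 + |a| + |b| + ‖c‖ + 1, by positivity |> fun h : (0 : ℝ) ≤ |a| + |b| + ‖c‖ => by
    linarith, fun s h1 h2 => ?_⟩
  have e1 : ‖1 - s + c‖ ≤ 1 + ‖s‖ + ‖c‖ :=
    (norm_add_le _ _).trans (by gcongr; exact (norm_sub_le _ _).trans (by simp))
  have e2 : ‖s‖ ≤ |s.re| + |s.im| := Complex.norm_le_abs_re_add_abs_im s
  have e3 : |s.re| ≤ |a| + |b| := by
    rw [abs_le]
    constructor <;> linarith [neg_abs_le a, le_abs_self b, abs_nonneg a, abs_nonneg b]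
  nlinarith [abs_nonneg s.im, abs_nonneg a, abs_nonneg b, norm_nonneg c,
    mul_nonneg (abs_nonneg s.im) (abs_nonneg a), mul_nonneg (abs_nonneg s.im) (abs_nonneg b),
    mul_nonneg (abs_nonneg s.im) (norm_nonneg c)]

theorem norm_cancelledGammaProd_le {ν : Fin 3 → ℂ} (hν : ∑ k, ν k = 0) (j : Fin 3) (n : ℕ)
    (a b : ℝ) : ∃ K, 0 < K ∧ ∀ s : ℂ, a ≤ s.re → s.re ≤ b → ‖cancelledGammaProd ν j n s‖ ≤
      K * ((1 + |s.im|) ^ (n - 1 + 2 * s.re + (ν j).re) * Real.exp (Real.pi * |s.im|)) := by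
  obtain ⟨K, hK, h⟩ := norm_prod_Gamma_inv_le ν (Finset.univ.erase j) a b
  have hprod : ∃ K', 0 < K' ∧ ∀ s : ℂ, a ≤ s.re → s.re ≤ b →
      ‖∏ m ∈ Finset.range n, (1 - s + ν j + m)‖ ≤ K' * (1 + |s.im|) ^ n := by
    clear h
    induction n with
    | zero => exact ⟨1, one_pos, fun s _ _ => by simp⟩
    | succ n ih =>
      obtain ⟨K', hK', h'⟩ := ih
      obtain ⟨K₂, hK₂, h₂⟩ := norm_one_sub_add_le a b (ν j + n)
      refine ⟨K' * K₂, by positivity, fun s h1 h2 => ?_⟩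
      rw [Finset.prod_range_succ, norm_mul, pow_succ]
      have := h₂ s h1 h2
      rw [← add_assoc] at this
      refine (mul_le_mul (h' s h1 h2) this (norm_nonneg _) (by positivity)).trans (le_of_eq ?_)
      ring
  obtain ⟨K', hK', h'⟩ := hprod
  refine ⟨K' * K, by positivity, fun s h1 h2 => ?_⟩
  rw [cancelledGammaProd, norm_mul]
  refine (mul_le_mul (h' s h1 h2) (h s h1 h2) (norm_nonneg _) (by positivity)).trans
    (le_of_eq ?_)
  have e : ∑ k ∈ Finset.univ.erase j, (-1 / 2 + s.re - (ν k).re) = -1 + 2 * s.re + (ν j).re := by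
    have := congrArg Complex.re hν
    simp only [Complex.re_sum, Complex.zero_re] at this
    rw [← Finset.add_sum_erase _ _ (Finset.mem_univ j)] at this
    rw [Finset.sum_sub_distrib, eq_neg_of_add_eq_zero_right this]
    simp; ring
  have e2 : ((Finset.univ.erase j).card : ℝ) * (Real.pi / 2 * |s.im|) = Real.pi * |s.im| := by
    simp; ring
  have e3 : (n : ℝ) - 1 + 2 * s.re + (ν j).re = n + (-1 + 2 * s.re + (ν j).re) := by ring
  rw [e, e2, e3, Real.rpow_add (by positivity) (n : ℝ), Real.rpow_natCast]
  ring

/-- The ratio of consecutive values `b (s - 1) / b s` tends to zero as `Re s → -∞`. -/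
def ShiftSmall (b : ℂ → ℂ) : Prop :=
  ∀ q : ℝ, 0 < q → ∃ R : ℝ, ∀ s : ℂ, s.re ≤ -R → ‖b (s - 1)‖ ≤ q * ‖b s‖

theorem ShiftSmall.mul_left {b c : ℂ → ℂ} (hb : ShiftSmall b) {K R₀ : ℝ} (hK : 0 < K)
    (hc : ∀ s : ℂ, s.re ≤ -R₀ → ‖c (s - 1)‖ ≤ K * ‖c s‖) : ShiftSmall (fun s => c s * b s) := by
  intro q hq
  obtain ⟨R, hR⟩ := hb (q / K) (by positivity)
  refine ⟨max R R₀, fun s hs => ?_⟩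
  have h1 := hR s (by linarith [le_max_left R R₀])
  have h2 := hc s (by linarith [le_max_right R R₀])
  rw [norm_mul, norm_mul]
  refine (mul_le_mul h2 h1 (norm_nonneg _) (by positivity)).trans (le_of_eq ?_)
  field_simp

theorem ShiftSmall.congr {b c : ℂ → ℂ} (hb : ShiftSmall b) {R₀ : ℝ}
    (hc : ∀ s : ℂ, s.re ≤ -R₀ → c s = b s) : ShiftSmall c := by
  intro q hq
  obtain ⟨R, hR⟩ := hb q hq
  refine ⟨max R R₀, fun s hs => ?_⟩
  rw [hc s (by linarith [le_max_right R R₀]),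
    hc (s - 1) (by simp; linarith [le_max_right R R₀])]
  exact hR s (by linarith [le_max_left R R₀])

theorem shiftSmall_invGammaProd_mul_Gamma (ν : Fin 3 → ℂ) (c : ℂ) :
    ShiftSmall (fun s => invGammaProd ν s * Complex.Gamma (1 - s - c)) := by
  intro q hq
  set M := ∑ k, ‖ν k‖ with hM
  have hM0 : 0 ≤ M := Finset.sum_nonneg fun k _ => norm_nonneg _
  refine ⟨2 * M + 2 * ‖c‖ + 16 / q, fun s hs => ?_⟩
  have hq' : 0 < 16 / q := by positivity
  have hW : 1 + (2 * M + 2 * ‖c‖ + 16 / q) ≤ ‖1 - s‖ := by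
    refine le_trans ?_ (Complex.re_le_norm _)
    simp; linarith
  set W := ‖1 - s‖ with hWd
  have hc0 := norm_nonneg c
  have hW0 : 0 < W := by linarith
  have hk : ∀ k, W / 2 ≤ ‖1 - s + ν k‖ := by
    intro k
    have h1 : ‖ν k‖ ≤ M := Finset.single_le_sum (f := fun k => ‖ν k‖)
      (fun k _ => norm_nonneg _) (Finset.mem_univ k)
    have h2 := norm_sub_le (1 - s + ν k) (ν k)
    rw [add_sub_cancel_right] at h2
    linarith
  have hkne : ∀ k, 1 - s + ν k ≠ 0 := fun k => norm_pos_iff.1 (by linarith [hk k])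
  have hcl : ‖1 - s - c‖ ≤ 2 * W := (norm_sub_le _ _).trans (by linarith)
  have hcne : 1 - s - c ≠ 0 := by
    have h2 := norm_sub_norm_le (1 - s) c
    exact norm_pos_iff.1 (by linarith)
  have e1 : Complex.Gamma (1 - (s - 1) - c) = (1 - s - c) * Complex.Gamma (1 - s - c) := by
    rw [← Complex.Gamma_add_one _ hcne]; congr 1; ring
  have e2 : invGammaProd ν (s - 1) = (∏ k, (1 - s + ν k)⁻¹) * invGammaProd ν s := by
    rw [invGammaProd, invGammaProd, ← Finset.prod_mul_distrib]
    refine Finset.prod_congr rfl fun k _ => ?_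
    rw [← mul_inv, ← Complex.Gamma_add_one _ (hkne k)]
    congr 2; ring
  have e3 : ‖∏ k, (1 - s + ν k)⁻¹‖ ≤ (2 / W) ^ 3 := by
    rw [norm_prod]
    refine (Finset.prod_le_prod (g := fun _ => 2 / W) (fun k _ => norm_nonneg _)
      fun k _ => ?_).trans (by simp [div_pow])
    rw [norm_inv, ← inv_div]
    exact inv_anti₀ (by positivity) (hk k)
  simp only
  rw [e1, e2, norm_mul, norm_mul, norm_mul, norm_mul]
  calc _ ≤ (2 / W) ^ 3 * ‖invGammaProd ν s‖ * (2 * W * ‖Complex.Gamma (1 - s - c)‖) := by gcongr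
    _ = 16 / W ^ 2 * (‖invGammaProd ν s‖ * ‖Complex.Gamma (1 - s - c)‖) := by
      field_simp; ring
    _ ≤ _ := by
      refine mul_le_mul_of_nonneg_right ?_ (by positivity)
      rw [div_le_iff₀ (by positivity)]
      have : 16 / q ≤ W := by linarith
      rw [div_le_iff₀ hq] at this
      nlinarith

theorem norm_one_sub_shift_le {s : ℂ} (hs : s.re ≤ 0) (j : ℕ) :
    ‖(1 - (s - 1)) ^ j‖ ≤ 2 ^ j * ‖(1 - s) ^ j‖ := by
  rw [norm_pow, norm_pow, ← mul_pow]
  have h1 : 1 ≤ ‖1 - s‖ := le_trans (by simp; linarith) (Complex.re_le_norm _)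
  have h2 : ‖1 - (s - 1)‖ ≤ ‖1 - s‖ + 1 := by
    rw [show 1 - (s - 1) = (1 - s) + 1 by ring]
    exact (norm_add_le _ _).trans (by simp)
  exact pow_le_pow_left₀ (norm_nonneg _) (by linarith) _

theorem rpow_le_rpow_add_rpow {x a e b : ℝ} (hx : 0 < x) (h1 : a ≤ e) (h2 : e ≤ b) :
    x ^ e ≤ x ^ a + x ^ b := by
  have pa := Real.rpow_pos_of_pos hx a
  have pb := Real.rpow_pos_of_pos hx b
  rcases le_total 1 x with h | h
  · linarith [Real.rpow_le_rpow_of_exponent_le h h2]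
  · linarith [Real.rpow_le_rpow_of_exponent_ge hx h h1]

/-- The decay `exp (-π |Im s|)` on the edges and towards the ends of a strip. -/
def StripExpDecay (σ : ℝ) (Θ : ℂ → ℂ) : Prop :=
  ∃ C T₀ : ℝ, 0 ≤ C ∧ ∀ s : ℂ, σ - 1 ≤ s.re → s.re ≤ σ →
    (T₀ ≤ |s.im| ∨ s.re = σ ∨ s.re = σ - 1) → ‖Θ s‖ ≤ C * Real.exp (-(Real.pi * |s.im|))

theorem norm_cpow_neg {X : ℝ} (hX : 0 < X) (s : ℂ) : ‖(X : ℂ) ^ (-s)‖ = X ^ (-s.re) := by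
  rw [Complex.norm_cpow_eq_rpow_re_of_pos hX, Complex.neg_re]

section

variable {A : ℝ} {S : Finset (Fin 3)} {p l : Fin 3 → ℂ} {κ : ℂ} {Θ b : ℂ → ℂ}

theorem StripPoles.tsum_cpow (h : StripPoles (-A) S p l κ Θ) (hA : 0 < A) (hκ : ‖κ‖ = 1)
    (hb : ∀ s : ℂ, s.re < 0 → DifferentiableAt ℂ b s)
    (hdec : ∀ n : ℕ, StripDecay (-A) (fun s => b (s - n) * Θ s)) (hR : ShiftSmall b)
    {X : ℝ} (hX : 0 < X) :
    2 * Real.pi * ∑ i ∈ S, l i * ∑' n : ℕ, κ ^ n * ((X : ℂ) ^ (-(p i - n)) * b (p i - n)) =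
      ∫ t : ℝ, (X : ℂ) ^ (-(((-A : ℝ) : ℂ) + t * Complex.I)) *
        (b (((-A : ℝ) : ℂ) + t * Complex.I) * Θ (((-A : ℝ) : ℂ) + t * Complex.I)) := by
  have hX0 : (X : ℂ) ≠ 0 := by exact_mod_cast hX.ne'
  obtain ⟨R, hR⟩ := hR (1 / (2 * X)) (by positivity)
  have := h.tsum (a := fun s => (X : ℂ) ^ (-s) * b s) (by linarith) hκ
    (fun s hs => DifferentiableAt.mul (by
      exact DifferentiableAt.const_cpow (by fun_prop) (Or.inl hX0)) (hb s hs))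
    (fun n => by
      obtain ⟨C, η, T₀, hη, hC⟩ := hdec n
      refine ⟨(X ^ (A + n) + X ^ (A + 1 + n)) * C, η, T₀, hη, fun s h1 h2 h3 => ?_⟩
      have g := hC s h1 h2 h3
      simp only at g ⊢
      rw [mul_assoc ((X : ℂ) ^ (-(s - n))), norm_mul, mul_assoc, norm_cpow_neg hX]
      refine mul_le_mul ?_ g (norm_nonneg _) (by positivity)
      refine rpow_le_rpow_add_rpow hX ?_ ?_ <;> simp <;> linarith)
    (R := R) (fun s hs => by
      rw [norm_mul, norm_mul]
      have e : ‖(X : ℂ) ^ (-(s - 1))‖ = X * ‖(X : ℂ) ^ (-s)‖ := by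
        rw [norm_cpow_neg hX, norm_cpow_neg hX, show -(s - 1).re = -s.re + 1 by simp; ring,
          Real.rpow_add_one hX.ne', mul_comm]
      rw [e]
      have h1 := hR s hs
      calc X * ‖(X : ℂ) ^ (-s)‖ * ‖b (s - 1)‖ ≤
          X * ‖(X : ℂ) ^ (-s)‖ * (1 / (2 * X) * ‖b s‖) := by gcongr
        _ = _ := by field_simp)
  simpa only [mul_assoc] using this

theorem StripPoles.norm_tsum_cpow_le (h : StripPoles (-A) S p l κ Θ) (hA : 0 < A) (hκ : ‖κ‖ = 1)
    (hb : ∀ s : ℂ, s.re < 0 → DifferentiableAt ℂ b s)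
    (hdec : ∀ n : ℕ, StripDecay (-A) (fun s => b (s - n) * Θ s)) (hR : ShiftSmall b) :
    ∃ C : ℝ, ∀ X : ℝ, 0 < X → ‖∑ i ∈ S, l i * ∑' n : ℕ, κ ^ n *
      ((X : ℂ) ^ (-(p i - n)) * b (p i - n))‖ ≤ C * X ^ A := by
  refine ⟨(2 * Real.pi)⁻¹ * ∫ t : ℝ, ‖b (((-A : ℝ) : ℂ) + t * Complex.I) *
    Θ (((-A : ℝ) : ℂ) + t * Complex.I)‖, fun X hX => ?_⟩
  have h1 := h.tsum_cpow hA hκ hb hdec hR hX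
  have h2 : ‖(2 * (Real.pi : ℂ))‖ = 2 * Real.pi := by
    simp [abs_of_pos Real.pi_pos]
  have h3 := congrArg norm h1
  rw [norm_mul, h2] at h3
  have h4 : 2 * Real.pi * ‖∑ i ∈ S, l i * ∑' n : ℕ, κ ^ n *
      ((X : ℂ) ^ (-(p i - n)) * b (p i - n))‖ ≤
      X ^ A * ∫ t : ℝ, ‖b (((-A : ℝ) : ℂ) + t * Complex.I) *
        Θ (((-A : ℝ) : ℂ) + t * Complex.I)‖ := by
    rw [h3, ← integral_const_mul]
    have hi := (h.one_strip (by linarith) hb 0 (hdec 0)).1.norm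
    simp only [Nat.cast_zero, sub_zero] at hi
    refine norm_integral_le_of_norm_le (hi.const_mul _) (Filter.Eventually.of_forall fun t => ?_)
    rw [norm_mul, norm_cpow_neg hX]
    simp
  rw [mul_assoc, inv_mul_eq_div, le_div_iff₀ (by positivity)]
  linarith

theorem StripPoles.norm_tsum_cancelledGammaProd_le (h : StripPoles (-A) S p l κ Θ) (hA : 0 < A)
    (hκ : ‖κ‖ = 1) (hΘ : StripExpDecay (-A) Θ) {ν : Fin 3 → ℂ} (hν : ∑ k, ν k = 0) (j : Fin 3)
    (n e : ℕ) (hexp : (e : ℝ) + n - 2 * A + (ν j).re < 0) :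
    ∃ C : ℝ, ∀ X : ℝ, 0 < X → ‖∑ i ∈ S, l i * ∑' m : ℕ, κ ^ m *
      ((X : ℂ) ^ (-(p i - m)) * ((1 - (p i - m)) ^ e * cancelledGammaProd ν j n (p i - m)))‖ ≤
      C * X ^ A := by
  refine h.norm_tsum_cpow_le (b := fun s => (1 - s) ^ e * cancelledGammaProd ν j n s) hA hκ
    (fun s _ => ?_) (fun m => ?_) ?_
  · exact (DifferentiableAt.pow (by fun_prop) _).mul
      (differentiable_cancelledGammaProd ν j n s)
  · obtain ⟨C, T₀, hC0, hC⟩ := hΘ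
    obtain ⟨K₁, hK₁, h₁⟩ := norm_one_sub_add_le (-A - 1 - m) (-A - m) 0
    obtain ⟨K₂, hK₂, h₂⟩ := norm_cancelledGammaProd_le hν j n (-A - 1 - m) (-A - m)
    refine ⟨K₁ ^ e * K₂ * C, -((e : ℝ) + n - 2 * A + (ν j).re), T₀, by linarith,
      fun s g1 g2 g3 => ?_⟩
    have b1 := h₁ (s - m) (by simp; linarith) (by simp; linarith)
    have b2 := h₂ (s - m) (by simp; linarith) (by simp; linarith)
    have b3 := hC s g1 g2 g3
    have him : (s - m).im = s.im := by simp
    have hre : (s - m).re = s.re - m := by simp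
    rw [add_zero, him] at b1
    rw [him, hre] at b2
    rw [norm_mul, norm_mul, norm_pow]
    have hm : (0 : ℝ) ≤ m := m.cast_nonneg
    calc _ ≤ (K₁ * (1 + |s.im|)) ^ e * (K₂ * ((1 + |s.im|) ^ (n - 1 + 2 * (s.re - m) + (ν j).re) *
          Real.exp (Real.pi * |s.im|))) * (C * Real.exp (-(Real.pi * |s.im|))) := by gcongr
      _ = K₁ ^ e * K₂ * C * ((1 + |s.im|) ^ e *
          (1 + |s.im|) ^ (n - 1 + 2 * (s.re - m) + (ν j).re)) *
          (Real.exp (Real.pi * |s.im|) * Real.exp (-(Real.pi * |s.im|))) := by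
        rw [mul_pow]; ring
      _ = K₁ ^ e * K₂ * C * (1 + |s.im|) ^ (e + (n - 1 + 2 * (s.re - m) + (ν j).re)) := by
        rw [← Real.exp_add, add_neg_cancel, Real.exp_zero, mul_one,
          Real.rpow_add (by positivity) (e : ℝ), Real.rpow_natCast]
      _ ≤ _ := by
        refine mul_le_mul_of_nonneg_left ?_ (by positivity)
        refine Real.rpow_le_rpow_of_exponent_le (by linarith [abs_nonneg s.im]) ?_
        linarith
  · refine ShiftSmall.mul_left (K := 2 ^ e) (R₀ := 0) ?_ (by positivity)
      (fun s hs => norm_one_sub_shift_le (by linarith) e)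
    refine (shiftSmall_invGammaProd_mul_Gamma ν (-(ν j) - n)).congr (R₀ := ‖ν j‖) fun s hs => ?_
    rw [cancelledGammaProd_eq]
    · congr 2; ring
    · intro m hm
      have := congrArg Complex.re hm
      simp at this
      have h1 := neg_abs_le (ν j).re
      have h2 := Complex.abs_re_le_norm (ν j)
      have h3 : (0 : ℝ) ≤ m := m.cast_nonneg
      linarith

end

theorem exists_le_pow_of_ratio_bounded {u : ℕ → ℝ} (hu : ∀ n, 0 ≤ u n) {n₀ : ℕ} {c : ℝ}
    (h : ∀ n, n₀ ≤ n → u (n + 1) ≤ c * u n) : ∃ B : ℝ, 1 ≤ B ∧ ∀ n, u n ≤ B ^ (n + 1) := by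
  set B := 1 + |c| + ∑ k ∈ Finset.range (n₀ + 1), u k with hB
  have hs : 0 ≤ ∑ k ∈ Finset.range (n₀ + 1), u k := Finset.sum_nonneg fun k _ => hu k
  have hB1 : 1 ≤ B := by linarith [abs_nonneg c]
  refine ⟨B, hB1, fun n => ?_⟩
  induction n with
  | zero =>
    have := Finset.single_le_sum (f := u) (fun k _ => hu k)
      (Finset.mem_range.2 (Nat.succ_pos n₀))
    simp; linarith [abs_nonneg c]
  | succ n ih =>
    rcases lt_or_ge n n₀ with hn | hn
    · have := Finset.single_le_sum (f := u) (fun k _ => hu k)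
        (Finset.mem_range.2 (show n + 1 < n₀ + 1 by omega))
      calc u (n + 1) ≤ B := by linarith [abs_nonneg c]
        _ ≤ B ^ (n + 1 + 1) := le_self_pow₀ hB1 (by omega)
    · calc u (n + 1) ≤ c * u n := h n hn
        _ ≤ B * B ^ (n + 1) := by
          refine mul_le_mul ?_ ih (hu n) (by linarith)
          linarith [le_abs_self c]
        _ = B ^ (n + 1 + 1) := by ring

theorem half_le_norm_add_nat {w : ℂ} {n : ℕ} (hn : ⌈2 * ‖w‖ + 1⌉₊ ≤ n) :
    ((n : ℝ) + 1) / 2 ≤ ‖w + n‖ := by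
  have h1 : 2 * ‖w‖ + 1 ≤ n := Nat.ceil_le.1 hn
  have h2 := norm_sub_norm_le (n : ℂ) (-w)
  rw [norm_neg, sub_neg_eq_add, add_comm (n : ℂ), Complex.norm_natCast] at h2
  linarith

theorem norm_Gamma_add_nat_le (w : ℂ) : ∃ B : ℝ, 1 ≤ B ∧ ∀ n : ℕ,
    ‖Complex.Gamma (w + n)‖ ≤ B ^ (n + 1) * n.factorial := by
  obtain ⟨B, hB, h⟩ := exists_le_pow_of_ratio_bounded
    (u := fun n : ℕ => ‖Complex.Gamma (w + n)‖ / n.factorial)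
    (n₀ := ⌈2 * ‖w‖ + 1⌉₊) (c := ‖w‖ + 1) (fun n => by positivity) (fun n hn => by
      have h1 := half_le_norm_add_nat hn
      have h0 : w + n ≠ 0 := norm_pos_iff.1 (lt_of_lt_of_le (by positivity) h1)
      have e : w + ((n + 1 : ℕ) : ℂ) = w + n + 1 := by push_cast; ring
      simp only [e]
      rw [Complex.Gamma_add_one _ h0, norm_mul, Nat.factorial_succ]
      have h2 : ‖w + n‖ ≤ (‖w‖ + 1) * (n + 1) := by
        refine (norm_add_le _ _).trans ?_
        rw [Complex.norm_natCast]
        nlinarith [norm_nonneg w, (n.cast_nonneg : (0 : ℝ) ≤ n),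
          mul_nonneg (norm_nonneg w) (n.cast_nonneg : (0 : ℝ) ≤ n)]
      push_cast
      rw [div_le_iff₀ (by positivity)]
      calc _ ≤ (‖w‖ + 1) * (n + 1) * ‖Complex.Gamma (w + n)‖ := by gcongr
        _ = _ := by field_simp)
  refine ⟨B, hB, fun n => ?_⟩
  have := h n
  rwa [div_le_iff₀ (by positivity)] at this

theorem norm_Gamma_add_nat_inv_le (w : ℂ) : ∃ B : ℝ, 1 ≤ B ∧ ∀ n : ℕ,
    ‖(Complex.Gamma (w + n))⁻¹‖ ≤ B ^ (n + 1) / n.factorial := by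
  obtain ⟨B, hB, h⟩ := exists_le_pow_of_ratio_bounded
    (u := fun n : ℕ => ‖(Complex.Gamma (w + n))⁻¹‖ * n.factorial)
    (n₀ := ⌈2 * ‖w‖ + 1⌉₊) (c := 2) (fun n => by positivity) (fun n hn => by
      have h1 := half_le_norm_add_nat hn
      have h0 : w + n ≠ 0 := norm_pos_iff.1 (lt_of_lt_of_le (by positivity) h1)
      have hp : 0 < ‖w + n‖ := norm_pos_iff.2 h0
      have e : w + ((n + 1 : ℕ) : ℂ) = w + n + 1 := by push_cast; ring
      simp only [e]
      rw [Complex.Gamma_add_one _ h0, mul_inv, norm_mul, norm_inv, Nat.factorial_succ]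
      push_cast
      have h3 : ‖w + n‖⁻¹ * ((n : ℝ) + 1) ≤ 2 := by
        rw [inv_mul_le_iff₀ hp]; linarith
      calc _ = (‖w + n‖⁻¹ * ((n : ℝ) + 1)) * (‖(Complex.Gamma (w + n))⁻¹‖ * n.factorial) := by
            ring
        _ ≤ _ := by gcongr)
  refine ⟨B, hB, fun n => ?_⟩
  have := h n
  rwa [← le_div_iff₀ (by positivity)] at this

theorem norm_invGammaProd_sub_nat_le (ν : Fin 3 → ℂ) (p : ℂ) : ∃ B : ℝ, 1 ≤ B ∧ ∀ n : ℕ,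
    ‖invGammaProd ν (p - n)‖ ≤ B ^ (n + 1) / (n.factorial : ℝ) ^ 3 := by
  choose B hB h using fun k => norm_Gamma_add_nat_inv_le (1 - p + ν k)
  refine ⟨∏ k, B k, Finset.prod_induction _ (fun x => 1 ≤ x)
    (fun _ _ => one_le_mul_of_one_le_of_one_le) le_rfl fun k _ => hB k, fun n => ?_⟩
  rw [invGammaProd, norm_prod, ← Finset.prod_pow]
  have e : (∏ k, B k ^ (n + 1)) / (n.factorial : ℝ) ^ 3 =
      ∏ k, (B k ^ (n + 1) / (n.factorial : ℝ)) := by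
    rw [Finset.prod_div_distrib]; simp
  rw [e]
  refine Finset.prod_le_prod (fun k _ => norm_nonneg _) fun k _ => ?_
  have := h k n
  rwa [show 1 - p + ν k + n = 1 - (p - n) + ν k by ring] at this

theorem norm_one_sub_sub_nat_pow_le (p : ℂ) (e : ℕ) : ∃ B : ℝ, 1 ≤ B ∧ ∀ n : ℕ,
    ‖(1 - (p - n)) ^ e‖ ≤ B ^ (n + 1) := by
  refine exists_le_pow_of_ratio_bounded (u := fun n : ℕ => ‖(1 - (p - n)) ^ e‖)
    (n₀ := ⌈‖p‖⌉₊) (c := 2 ^ e) (fun n => norm_nonneg _) (fun n hn => ?_)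
  have := norm_one_sub_shift_le (s := p - n) (by
    have h1 := Nat.ceil_le.1 hn
    have h2 := Complex.re_le_norm p
    simp; linarith) e
  simpa [sub_sub] using this

/-- The Mellin-type kernel whose residues are the terms of the double series. -/
noncomputable def mellinTerm (ν : Fin 3 → ℂ) (e₁ e₂ : ℕ) (X Y : ℝ) (s₁ s₂ : ℂ) : ℂ :=
  (X : ℂ) ^ (-s₁) * (Y : ℂ) ^ (-s₂) * (1 - s₁) ^ e₁ * (1 - s₂) ^ e₂ * invGammaProd ν s₁ *
    invGammaProd (-ν) s₂ * Complex.Gamma (1 - s₁ - s₂)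

theorem summable_pow_div_factorial_prod (B c : ℝ) :
    Summable (fun m : ℕ × ℕ => c * (B ^ m.1 / m.1.factorial * (B ^ m.2 / m.2.factorial))) := by
  refine Summable.mul_left _ ?_
  have h := (Real.summable_pow_div_factorial B).norm
  exact summable_mul_of_summable_norm h h

theorem norm_mellinTerm_sub_nat_le (ν : Fin 3 → ℂ) (e₁ e₂ : ℕ) {X Y : ℝ} (hX : 0 < X) (hY : 0 < Y)
    (p q : ℂ) : ∃ B c : ℝ, ∀ m : ℕ × ℕ, ‖mellinTerm ν e₁ e₂ X Y (p - m.1) (q - m.2)‖ ≤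
      c * (B ^ m.1 / m.1.factorial * (B ^ m.2 / m.2.factorial)) := by
  obtain ⟨B₁, hB₁, h₁⟩ := norm_invGammaProd_sub_nat_le ν p
  obtain ⟨B₂, hB₂, h₂⟩ := norm_invGammaProd_sub_nat_le (-ν) q
  obtain ⟨B₃, hB₃, h₃⟩ := norm_one_sub_sub_nat_pow_le p e₁
  obtain ⟨B₄, hB₄, h₄⟩ := norm_one_sub_sub_nat_pow_le q e₂
  obtain ⟨B₅, hB₅, h₅⟩ := norm_Gamma_add_nat_le (1 - p - q)
  set B := (X + Y + 1) * (B₁ * B₂ * B₃ * B₄ * B₅ * 2) with hB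
  refine ⟨B, X ^ (-p.re) * Y ^ (-q.re) * (B₁ * B₂ * B₃ * B₄ * B₅), fun m => ?_⟩
  obtain ⟨m, n⟩ := m
  simp only
  have g1 := h₁ m
  have g2 := h₂ n
  have g3 := h₃ m
  have g4 := h₄ n
  have g5 := h₅ (m + n)
  have e5 : 1 - p - q + ((m + n : ℕ) : ℂ) = 1 - (p - m) - (q - n) := by push_cast; ring
  rw [e5] at g5
  have g6 : ((m + n).factorial : ℝ) ≤ 2 ^ (m + n) * (m.factorial * n.factorial) := by
    have h1 := Nat.add_choose_mul_factorial_mul_factorial m n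
    have h2 := Nat.choose_le_two_pow (m + n) n
    rw [← h1]
    push_cast
    rw [mul_assoc]
    gcongr
    exact_mod_cast h2
  have eX : ‖(X : ℂ) ^ (-(p - m))‖ = X ^ (-p.re) * X ^ m := by
    rw [norm_cpow_neg hX, show -(p - m).re = -p.re + m by simp; ring, Real.rpow_add hX,
      Real.rpow_natCast]
  have eY : ‖(Y : ℂ) ^ (-(q - n))‖ = Y ^ (-q.re) * Y ^ n := by
    rw [norm_cpow_neg hY, show -(q - n).re = -q.re + n by simp; ring, Real.rpow_add hY,
      Real.rpow_natCast]
  rw [mellinTerm, norm_mul, norm_mul, norm_mul, norm_mul, norm_mul, norm_mul, eX, eY]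
  have fm : (1 : ℝ) ≤ m.factorial := by exact_mod_cast m.factorial_pos
  have fn : (1 : ℝ) ≤ n.factorial := by exact_mod_cast n.factorial_pos
  calc _ ≤ X ^ (-p.re) * X ^ m * (Y ^ (-q.re) * Y ^ n) * B₃ ^ (m + 1) * B₄ ^ (n + 1) *
        (B₁ ^ (m + 1) / (m.factorial : ℝ) ^ 3) * (B₂ ^ (n + 1) / (n.factorial : ℝ) ^ 3) *
        (B₅ ^ (m + n + 1) * (2 ^ (m + n) * (m.factorial * n.factorial))) := by
        gcongr
        exact g5.trans (by gcongr)
    _ = X ^ (-p.re) * Y ^ (-q.re) * (B₁ * B₂ * B₃ * B₄ * B₅) *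
        (((X * (B₁ * B₃ * B₅ * 2)) ^ m / (m.factorial : ℝ) ^ 2) *
          ((Y * (B₂ * B₄ * B₅ * 2)) ^ n / (n.factorial : ℝ) ^ 2)) := by
        field_simp
        ring
    _ ≤ _ := by
        have k1 : (X * (B₁ * B₃ * B₅ * 2)) ^ m ≤ B ^ m := by
          refine pow_le_pow_left₀ (by positivity) ?_ _
          rw [hB]
          refine mul_le_mul (by linarith) ?_ (by positivity) (by positivity)
          have : 1 ≤ B₂ * B₄ := one_le_mul_of_one_le_of_one_le hB₂ hB₄
          have h0 : 0 ≤ B₁ * B₃ * B₅ * 2 := by positivity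
          nlinarith
        have k2 : (Y * (B₂ * B₄ * B₅ * 2)) ^ n ≤ B ^ n := by
          refine pow_le_pow_left₀ (by positivity) ?_ _
          rw [hB]
          refine mul_le_mul (by linarith) ?_ (by positivity) (by positivity)
          have : 1 ≤ B₁ * B₃ := one_le_mul_of_one_le_of_one_le hB₁ hB₃
          have h0 : 0 ≤ B₂ * B₄ * B₅ * 2 := by positivity
          nlinarith
        have k3 : (m.factorial : ℝ) ≤ (m.factorial : ℝ) ^ 2 := by nlinarith
        have k4 : (n.factorial : ℝ) ≤ (n.factorial : ℝ) ^ 2 := by nlinarith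
        gcongr

theorem summable_mellinTerm (ν : Fin 3 → ℂ) (e₁ e₂ : ℕ) {X Y : ℝ} (hX : 0 < X) (hY : 0 < Y)
    {κ₁ κ₂ : ℂ} (h₁ : ‖κ₁‖ = 1) (h₂ : ‖κ₂‖ = 1) (p q : ℂ) : Summable (fun m : ℕ × ℕ =>
      κ₁ ^ m.1 * κ₂ ^ m.2 * mellinTerm ν e₁ e₂ X Y (p - m.1) (q - m.2)) := by
  obtain ⟨B, c, h⟩ := norm_mellinTerm_sub_nat_le ν e₁ e₂ hX hY p q
  refine Summable.of_norm_bounded (summable_pow_div_factorial_prod B c) fun m => ?_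
  rw [norm_mul, norm_mul, norm_pow, norm_pow, h₁, h₂, one_pow, one_pow, one_mul, one_mul]
  exact h m

/-- The part of the Mellin kernel depending on the second variable. -/
noncomputable def rowKernel (ν : Fin 3 → ℂ) (e : ℕ) (s₁ s₂ : ℂ) : ℂ :=
  (1 - s₂) ^ e * (invGammaProd ν s₂ * Complex.Gamma (1 - s₁ - s₂))

theorem norm_rowKernel_le {ν : Fin 3 → ℂ} (hν : ∑ k, ν k = 0) (e : ℕ) {A : ℝ} (hA : 0 ≤ A)
    (a : ℝ) {b : ℝ} (hb : b ≤ 0) : ∃ K : ℝ, 0 < K ∧ ∀ s₁ s₂ : ℂ, s₁.re = -A → a ≤ s₂.re →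
      s₂.re ≤ b → ‖rowKernel ν e s₁ s₂‖ ≤
        K * ((1 + |s₁.im|) ^ (1 / 2 + A - s₂.re) * (1 + |s₂.im|) ^ (e - 1 + A + 2 * s₂.re)) *
          Real.exp (3 * Real.pi / 2 * |s₂.im| - Real.pi / 2 * |s₁.im + s₂.im|) := by
  obtain ⟨K₁, hK₁, h₁⟩ := norm_one_sub_add_le a b 0
  obtain ⟨K₂, hK₂, h₂⟩ := norm_invGammaProd_le hν a b
  obtain ⟨K₃, hK₃, h₃⟩ := norm_Gamma_le (1 + A - a)
  refine ⟨K₁ ^ e * K₂ * K₃, by positivity, fun s₁ s₂ hs₁ ha hb' => ?_⟩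
  have b1 := h₁ s₂ ha hb'
  have b2 := h₂ s₂ ha hb'
  have hre : (1 - s₁ - s₂).re = 1 + A - s₂.re := by simp [hs₁]
  have him : |(1 - s₁ - s₂).im| = |s₁.im + s₂.im| := by
    rw [← abs_neg]; congr 1; simp; ring
  have b3 := h₃ (1 - s₁ - s₂) (by rw [hre]; linarith) (by rw [hre]; linarith)
  rw [hre, him] at b3
  rw [add_zero] at b1
  have b4 : (1 + |s₁.im + s₂.im|) ^ (1 + A - s₂.re - 1 / 2) ≤
      (1 + |s₁.im|) ^ (1 + A - s₂.re - 1 / 2) * (1 + |s₂.im|) ^ (1 + A - s₂.re - 1 / 2) := by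
    rw [← Real.mul_rpow (by positivity) (by positivity)]
    refine Real.rpow_le_rpow (by positivity) ?_ (by linarith)
    nlinarith [abs_add_le s₁.im s₂.im, abs_nonneg s₁.im, abs_nonneg s₂.im,
      mul_nonneg (abs_nonneg s₁.im) (abs_nonneg s₂.im)]
  rw [rowKernel, norm_mul, norm_mul, norm_pow]
  calc _ ≤ (K₁ * (1 + |s₂.im|)) ^ e * ((K₂ * ((1 + |s₂.im|) ^ (-3 / 2 + 3 * s₂.re) *
        Real.exp (3 * Real.pi / 2 * |s₂.im|))) * (K₃ * (((1 + |s₁.im|) ^ (1 + A - s₂.re - 1 / 2) *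
          (1 + |s₂.im|) ^ (1 + A - s₂.re - 1 / 2)) *
          Real.exp (-(Real.pi / 2 * |s₁.im + s₂.im|))))) := by
        gcongr
        exact b3.trans (by gcongr)
    _ = K₁ ^ e * K₂ * K₃ * ((1 + |s₁.im|) ^ (1 + A - s₂.re - 1 / 2) * ((1 + |s₂.im|) ^ e *
          (1 + |s₂.im|) ^ (-3 / 2 + 3 * s₂.re) * (1 + |s₂.im|) ^ (1 + A - s₂.re - 1 / 2))) *
          (Real.exp (3 * Real.pi / 2 * |s₂.im|) *
            Real.exp (-(Real.pi / 2 * |s₁.im + s₂.im|))) := by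
        rw [mul_pow]; ring
    _ = _ := by
        rw [← Real.exp_add, ← Real.rpow_natCast (1 + |s₂.im|) e, ← Real.rpow_add (by positivity),
          ← Real.rpow_add (by positivity)]
        ring_nf

theorem exists_mul_le_norm_add_nat {a : ℝ} (ha : ∀ n : ℕ, a + n ≠ 0) :
    ∃ c : ℝ, 0 < c ∧ ∀ n : ℕ, c * (n + 1) ≤ |a + n| := by
  set N := ⌈2 * |a| + 1⌉₊
  obtain ⟨c, hc0, hc⟩ : ∃ c : ℝ, 0 < c ∧ ∀ n ∈ Finset.range N, c * (n + 1) ≤ |a + n| := by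
    generalize N = N
    induction N with
    | zero => exact ⟨1, one_pos, by simp⟩
    | succ N ih =>
      obtain ⟨c, hc0, hc⟩ := ih
      have h0 : 0 < |a + N| := abs_pos.2 (ha N)
      refine ⟨min c (|a + N| / (N + 1)), lt_min hc0 (by positivity), fun n hn => ?_⟩
      rcases Nat.lt_succ_iff_lt_or_eq.1 (Finset.mem_range.1 hn) with h | rfl
      · refine le_trans ?_ (hc n (Finset.mem_range.2 h))
        gcongr; exact min_le_left _ _
      · rw [← le_div_iff₀ (by positivity)]
        exact min_le_right _ _
  refine ⟨min c (1 / 2), lt_min hc0 (by norm_num), fun n => ?_⟩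
  rcases lt_or_ge n N with h | h
  · refine le_trans ?_ (hc n (Finset.mem_range.2 h))
    gcongr; exact min_le_left _ _
  · have h1 : 2 * |a| + 1 ≤ n := Nat.ceil_le.1 h
    have h2 := neg_abs_le a
    have h3 : min c (1 / 2) * (n + 1) ≤ 1 / 2 * (n + 1) := by gcongr; exact min_le_right _ _
    refine h3.trans (le_trans ?_ (le_abs_self _))
    linarith

theorem norm_rowKernel_sub_one_le (ν : Fin 3 → ℂ) (e : ℕ) {A₁ A₂ : ℝ} (hA₁ : 0 ≤ A₁)
    (hA₂ : 0 ≤ A₂) (hns : ∀ (k : Fin 3) (n : ℕ), 1 + A₂ + (ν k).re + n ≠ 0) :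
    ∃ C : ℝ, 1 ≤ C ∧ ∀ s₁ s₂ : ℂ, s₁.re = -A₁ → s₂.re = -A₂ → ∀ n : ℕ,
      ‖rowKernel ν e s₁ (s₂ - (n + 1 : ℕ))‖ ≤
        C * (1 + |s₁.im|) / (n + 1) ^ 2 * ‖rowKernel ν e s₁ (s₂ - n)‖ := by
  choose c hc0 hc using fun k => exists_mul_le_norm_add_nat (hns k)
  have hck : ∀ k, ∀ s : ℂ, s.re = -A₂ → ∀ n : ℕ, c k * (n + 1) ≤ ‖1 - (s - n) + ν k‖ := by
    intro k s hs n
    refine (hc k n).trans (le_trans (le_of_eq ?_) (Complex.abs_re_le_norm _))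
    congr 1; simp [hs]; ring
  set L := 2 + A₁ + A₂ + ‖ν 2‖ with hL
  have hL0 : 0 < L := by positivity
  have h0 := hc0 0
  have h1 := hc0 1
  have h2 := hc0 2
  set C := 2 ^ e * ((c 0)⁻¹ * (c 1)⁻¹) * (L * (1 + (c 2)⁻¹)) with hC
  have hCp : 0 ≤ C := by positivity
  refine ⟨1 + C, by linarith, fun s₁ s₂ hs₁ hs₂ n => ?_⟩
  have hn0 : (0 : ℝ) ≤ n := n.cast_nonneg
  have hz : ∀ k, 0 < ‖1 - (s₂ - n) + ν k‖ := fun k =>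
    lt_of_lt_of_le (mul_pos (hc0 k) (by positivity)) (hck k s₂ hs₂ n)
  have hzn : ∀ k, 1 - (s₂ - n) + ν k ≠ 0 := fun k => norm_pos_iff.1 (hz k)
  have e0 : s₂ - ((n + 1 : ℕ) : ℂ) = (s₂ - n) - 1 := by push_cast; ring
  set s := s₂ - n with hs
  have hsre : s.re = -A₂ - n := by simp [hs, hs₂]
  have hsim : s.im = s₂.im := by simp [hs]
  have hg : 1 - s₁ - s ≠ 0 := by
    intro h
    have := congrArg Complex.re h
    simp [hs₁, hsre] at this
    linarith
  have e1 : Complex.Gamma (1 - s₁ - (s - 1)) = (1 - s₁ - s) * Complex.Gamma (1 - s₁ - s) := by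
    rw [← Complex.Gamma_add_one _ hg]; congr 1; ring
  have e2 : invGammaProd ν (s - 1) = (∏ k, (1 - s + ν k)⁻¹) * invGammaProd ν s := by
    rw [invGammaProd, invGammaProd, ← Finset.prod_mul_distrib]
    refine Finset.prod_congr rfl fun k _ => ?_
    rw [← mul_inv, ← Complex.Gamma_add_one _ (hzn k)]
    congr 2; ring
  have b1 := norm_one_sub_shift_le (s := s) (by rw [hsre]; linarith) e
  have b2 : ‖1 - s₁ - s‖ ≤ L * (1 + (c 2)⁻¹) * (1 + |s₁.im|) * ‖1 - s + ν 2‖ := by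
    have g1 : ‖1 - s₁ - s‖ ≤ ‖1 - s + ν 2‖ + ‖s₁‖ + ‖ν 2‖ := by
      rw [show 1 - s₁ - s = (1 - s + ν 2) - s₁ - ν 2 by ring]
      exact (norm_sub_le _ _).trans (by gcongr; exact norm_sub_le _ _)
    have g2 : ‖s₁‖ ≤ A₁ + |s₁.im| := by
      refine (Complex.norm_le_abs_re_add_abs_im _).trans ?_
      rw [hs₁, abs_neg, abs_of_nonneg hA₁]
    have g3 : 1 ≤ (c 2)⁻¹ * ‖1 - s + ν 2‖ := by
      rw [inv_mul_eq_div, le_div_iff₀ h2]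
      refine le_trans ?_ (hck 2 s₂ hs₂ n)
      nlinarith
    have g4 : ‖s₁‖ + ‖ν 2‖ ≤ L * (1 + |s₁.im|) * 1 := by
      have := norm_nonneg (ν 2)
      have := abs_nonneg s₁.im
      nlinarith [mul_nonneg (norm_nonneg (ν 2)) (abs_nonneg s₁.im), mul_nonneg hA₁ (abs_nonneg s₁.im), mul_nonneg hA₂ (abs_nonneg s₁.im)]
    have g5 : L * (1 + |s₁.im|) * 1 ≤ L * (1 + |s₁.im|) * ((c 2)⁻¹ * ‖1 - s + ν 2‖) := by gcongr
    have g6 : ‖1 - s + ν 2‖ ≤ L * (1 + |s₁.im|) * ‖1 - s + ν 2‖ := by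
      refine le_mul_of_one_le_left (norm_nonneg _) ?_
      have := norm_nonneg (ν 2)
      exact one_le_mul_of_one_le_of_one_le (by linarith) (by linarith [abs_nonneg s₁.im])
    calc _ ≤ L * (1 + |s₁.im|) * ‖1 - s + ν 2‖ + L * (1 + |s₁.im|) *
          ((c 2)⁻¹ * ‖1 - s + ν 2‖) := by linarith
      _ = _ := by ring
  have i0 : ‖1 - s + ν 0‖⁻¹ ≤ (c 0)⁻¹ * ((n : ℝ) + 1)⁻¹ := by
    rw [← mul_inv]; exact inv_anti₀ (by positivity) (hck 0 s₂ hs₂ n)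
  have i1 : ‖1 - s + ν 1‖⁻¹ ≤ (c 1)⁻¹ * ((n : ℝ) + 1)⁻¹ := by
    rw [← mul_inv]; exact inv_anti₀ (by positivity) (hck 1 s₂ hs₂ n)
  rw [e0, rowKernel, rowKernel, e1, e2, Fin.prod_univ_three]
  simp only [norm_mul, norm_inv]
  have z2 := hz 2
  calc _ ≤ 2 ^ e * ‖(1 - s) ^ e‖ * ((((c 0)⁻¹ * ((n : ℝ) + 1)⁻¹) * ((c 1)⁻¹ * ((n : ℝ) + 1)⁻¹) *
        ‖1 - s + ν 2‖⁻¹) * ‖invGammaProd ν s‖ * ((L * (1 + (c 2)⁻¹) * (1 + |s₁.im|) *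
          ‖1 - s + ν 2‖) * ‖Complex.Gamma (1 - s₁ - s)‖)) := by gcongr
    _ = C * (1 + |s₁.im|) / (n + 1) ^ 2 *
        (‖(1 - s) ^ e‖ * (‖invGammaProd ν s‖ * ‖Complex.Gamma (1 - s₁ - s)‖)) := by
        rw [hC]; field_simp
    _ ≤ _ := by gcongr; linarith

theorem norm_rowKernel_sub_nat_le (ν : Fin 3 → ℂ) (e : ℕ) {A₁ A₂ : ℝ} (hA₁ : 0 ≤ A₁)
    (hA₂ : 0 ≤ A₂) (hns : ∀ (k : Fin 3) (n : ℕ), 1 + A₂ + (ν k).re + n ≠ 0) :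
    ∃ C : ℝ, 1 ≤ C ∧ ∀ s₁ s₂ : ℂ, s₁.re = -A₁ → s₂.re = -A₂ → ∀ n : ℕ,
      ‖rowKernel ν e s₁ (s₂ - n)‖ ≤
        (C * (1 + |s₁.im|)) ^ n / (n.factorial : ℝ) ^ 2 * ‖rowKernel ν e s₁ s₂‖ := by
  obtain ⟨C, hC, h⟩ := norm_rowKernel_sub_one_le ν e hA₁ hA₂ hns
  refine ⟨C, hC, fun s₁ s₂ h1 h2 n => ?_⟩
  induction n with
  | zero => simp
  | succ n ih =>
    refine (h s₁ s₂ h1 h2 n).trans ?_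
    calc _ ≤ C * (1 + |s₁.im|) / (n + 1) ^ 2 *
          ((C * (1 + |s₁.im|)) ^ n / (n.factorial : ℝ) ^ 2 * ‖rowKernel ν e s₁ s₂‖) := by
          gcongr
      _ = _ := by
        rw [Nat.factorial_succ]; push_cast
        field_simp
        ring

/-- The scale of the damping factor. -/
noncomputable def dampScale (N : ℕ) : ℝ := (((N : ℝ) + 1) * √((N : ℝ) + 1))⁻¹

/-- A rational damping factor, bounded by one on the left half plane and tending to one. -/
noncomputable def dampFactor (N : ℕ) (s : ℂ) : ℂ := ((1 - (dampScale N : ℂ) * s) ^ N)⁻¹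

theorem dampScale_pos (N : ℕ) : 0 < dampScale N := by
  rw [dampScale]; positivity

theorem dampScale_le_one (N : ℕ) : dampScale N ≤ 1 := by
  have h : (1 : ℝ) ≤ (N : ℝ) + 1 := by linarith [(N.cast_nonneg : (0 : ℝ) ≤ N)]
  exact inv_le_one_of_one_le₀ (one_le_mul_of_one_le_of_one_le h (Real.one_le_sqrt.2 h))

theorem one_le_norm_one_sub_mul {δ : ℝ} (hδ : 0 ≤ δ) {s : ℂ} (hs : s.re ≤ 0) :
    1 ≤ ‖1 - (δ : ℂ) * s‖ := by
  refine le_trans ?_ (Complex.re_le_norm _)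
  simp
  nlinarith

theorem half_mul_le_norm_one_sub_mul {δ : ℝ} (hδ : 0 ≤ δ) (hδ1 : δ ≤ 1) {s : ℂ} (hs : s.re ≤ 0) :
    δ / 2 * (1 + |s.im|) ≤ ‖1 - (δ : ℂ) * s‖ := by
  have h1 := one_le_norm_one_sub_mul hδ hs
  have h2 : δ * |s.im| ≤ ‖1 - (δ : ℂ) * s‖ := by
    refine le_trans (le_of_eq ?_) (Complex.abs_im_le_norm _)
    simp [abs_mul, abs_of_nonneg hδ]
  linarith

theorem differentiableAt_dampFactor (N : ℕ) {s : ℂ} (hs : s.re < 0) :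
    DifferentiableAt ℂ (dampFactor N) s := by
  have h := one_le_norm_one_sub_mul (dampScale_pos N).le hs.le
  have h0 : (1 - (dampScale N : ℂ) * s) ^ N ≠ 0 :=
    pow_ne_zero _ (norm_pos_iff.1 (by linarith))
  unfold dampFactor
  exact DifferentiableAt.inv (by fun_prop) h0

theorem norm_dampFactor_le_one (N : ℕ) {s : ℂ} (hs : s.re ≤ 0) : ‖dampFactor N s‖ ≤ 1 := by
  rw [dampFactor, norm_inv, norm_pow]
  exact inv_le_one_of_one_le₀ (one_le_pow₀ (one_le_norm_one_sub_mul (dampScale_pos N).le hs))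

theorem norm_dampFactor_mul_le (N : ℕ) {s : ℂ} (hs : s.re ≤ 0) :
    ‖dampFactor N s‖ * (1 + |s.im|) ^ N ≤ (2 / dampScale N) ^ N := by
  have h := half_mul_le_norm_one_sub_mul (dampScale_pos N).le (dampScale_le_one N) hs
  have h1 := one_le_norm_one_sub_mul (dampScale_pos N).le hs
  rw [dampFactor, norm_inv, norm_pow, ← inv_pow, ← mul_pow]
  refine pow_le_pow_left₀ (by positivity) ?_ _
  rw [inv_mul_le_iff₀ (by linarith), mul_div_assoc', le_div_iff₀ (dampScale_pos N)]
  linarith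

theorem norm_dampFactor_sub_one_le (N : ℕ) {s : ℂ} (hs : s.re ≤ 0) :
    ‖dampFactor N (s - 1)‖ ≤ 1 * ‖dampFactor N s‖ := by
  have h1 := one_le_norm_one_sub_mul (dampScale_pos N).le hs
  rw [one_mul, dampFactor, dampFactor, norm_inv, norm_inv, norm_pow, norm_pow]
  refine inv_anti₀ (by positivity) (pow_le_pow_left₀ (norm_nonneg _) ?_ _)
  have hd := dampScale_pos N
  refine abs_le_of_sq_le_sq' ?_ (norm_nonneg _) |>.2
  rw [Complex.sq_norm, Complex.sq_norm, Complex.normSq_apply, Complex.normSq_apply]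
  simp
  nlinarith [mul_nonneg hd.le (neg_nonneg.2 hs)]

theorem tendsto_mul_dampScale : Filter.Tendsto (fun N : ℕ => (N : ℝ) * dampScale N) Filter.atTop
    (nhds 0) := by
  have h : Filter.Tendsto (fun N : ℕ => (√((N : ℝ) + 1))⁻¹) Filter.atTop (nhds 0) :=
    (Real.tendsto_sqrt_atTop.comp
      (Filter.tendsto_atTop_add_const_right _ 1 tendsto_natCast_atTop_atTop)).inv_tendsto_atTop
  refine squeeze_zero (fun N => mul_nonneg N.cast_nonneg (dampScale_pos N).le) (fun N => ?_) h
  rw [dampScale, mul_inv, ← mul_assoc]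
  refine mul_le_of_le_one_left (by positivity) ?_
  rw [← div_eq_mul_inv, div_le_one (by positivity)]
  linarith

theorem tendsto_dampFactor (s : ℂ) :
    Filter.Tendsto (fun N => dampFactor N s) Filter.atTop (nhds 1) := by
  have h1 : Filter.Tendsto (fun N : ℕ => (1 - (dampScale N : ℂ) * s) ^ N) Filter.atTop
      (nhds 1) := by
    rw [tendsto_iff_norm_sub_tendsto_zero]
    have h2 : Filter.Tendsto (fun N : ℕ => Real.exp (N * dampScale N * ‖s‖) - 1) Filter.atTop
        (nhds 0) := by
      have := ((tendsto_mul_dampScale.mul_const ‖s‖).rexp).sub_const 1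
      simpa using this
    refine squeeze_zero (fun _ => norm_nonneg _) (fun N => ?_) h2
    set w : ℂ := -((dampScale N : ℂ) * s)
    have hw : ‖w‖ = dampScale N * ‖s‖ := by
      simp [w, abs_of_pos (dampScale_pos N)]
    have e : 1 - (dampScale N : ℂ) * s = 1 + w := by simp [w, sub_eq_add_neg]
    have h3 := Finset.norm_prod_one_add_sub_one_le (Finset.range N) (fun _ => w)
    simp only [Finset.prod_const, Finset.sum_const, Finset.card_range, nsmul_eq_mul, hw] at h3
    rw [e, mul_assoc]
    exact h3
  have := h1.inv₀ one_ne_zero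
  rwa [inv_one] at this

theorem tendsto_pow_div_dampScale (C : ℝ) (hC : 0 ≤ C) : Filter.Tendsto (fun N : ℕ =>
    C ^ N / (N.factorial : ℝ) ^ 2 * (2 / dampScale N) ^ N) Filter.atTop (nhds 0) := by
  have h := (FloorSemiring.tendsto_pow_div_factorial_atTop ((2 * C) ^ 2 * Real.exp 3)).const_mul
    (Real.exp 3)
  rw [mul_zero] at h
  have h2 := h.sqrt
  rw [Real.sqrt_zero] at h2
  refine squeeze_zero (fun N => ?_) (fun N => ?_) h2
  · have := dampScale_pos N
    positivity
  · refine Real.le_sqrt_of_sq_le ?_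
    have hN : (0 : ℝ) < (N : ℝ) + 1 := by positivity
    have hf : (0 : ℝ) < N.factorial := by exact_mod_cast N.factorial_pos
    have h3 := Real.pow_div_factorial_le_exp _ hN.le N
    rw [div_le_iff₀ hf] at h3
    have e1 : (2 / dampScale N) ^ 2 = 4 * ((N : ℝ) + 1) ^ 3 := by
      rw [dampScale, div_inv_eq_mul, mul_pow, mul_pow, Real.sq_sqrt hN.le]; ring
    calc (C ^ N / (N.factorial : ℝ) ^ 2 * (2 / dampScale N) ^ N) ^ 2
        = (C ^ 2) ^ N / (N.factorial : ℝ) ^ 4 * ((2 / dampScale N) ^ 2) ^ N := by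
          rw [mul_pow, div_pow, ← pow_mul, ← pow_mul, ← pow_mul, ← pow_mul, ← pow_mul _ 2 N,
            mul_comm 2 N]
      _ = ((2 * C) ^ 2) ^ N / (N.factorial : ℝ) ^ 4 * (((N : ℝ) + 1) ^ N) ^ 3 := by
          rw [e1, mul_pow, mul_pow 2 C, mul_pow (2 ^ 2), ← pow_mul, ← pow_mul, mul_comm 3 N,
            show (2 : ℝ) ^ 2 = 4 by norm_num]
          ring
      _ ≤ ((2 * C) ^ 2) ^ N / (N.factorial : ℝ) ^ 4 *
          (Real.exp ((N : ℝ) + 1) * N.factorial) ^ 3 := by gcongr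
      _ = Real.exp 3 * (((2 * C) ^ 2 * Real.exp 3) ^ N / N.factorial) := by
          have : Real.exp ((N : ℝ) + 1) ^ 3 = Real.exp 3 * Real.exp 3 ^ N := by
            rw [← Real.exp_nat_mul, ← Real.exp_nat_mul, ← Real.exp_add]
            congr 1; push_cast; ring
          rw [mul_pow (Real.exp ((N : ℝ) + 1)), this, mul_pow _ (Real.exp 3)]
          field_simp

/-- A kernel in two variables with simple poles at `q j`, `j ∈ J`, in the second variable, whose
residues `D j` have simple poles at `p i`, `i ∈ I j`, in the first variable. -/
structure DoublePoles (A₁ A₂ : ℝ) (J : Finset (Fin 3)) (I : Fin 3 → Finset (Fin 3))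
    (p q : Fin 3 → ℂ) (l : Fin 3 → Fin 3 → ℂ) (κ₁ κ₂ : ℂ) (D : Fin 3 → ℂ → ℂ) (T : ℂ → ℂ → ℂ) :
    Prop where
  fst : ∀ j ∈ J, StripPoles (-A₁) (I j) p (l j) κ₁ (D j)
  fst_decay : ∀ j ∈ J, StripExpDecay (-A₁) (D j)
  snd : ∀ s₁ : ℂ, s₁.re = -A₁ → StripPoles (-A₂) J q (fun j => D j s₁) κ₂ (T s₁)
  snd_decay : ∃ C T₀ : ℝ, 0 ≤ C ∧ ∀ s₁ s₂ : ℂ, s₁.re = -A₁ → -A₂ - 1 ≤ s₂.re → s₂.re ≤ -A₂ →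
    (T₀ ≤ |s₂.im| ∨ s₂.re = -A₂ ∨ s₂.re = -A₂ - 1) → ‖T s₁ s₂‖ ≤
      C * Real.exp (-(3 * Real.pi / 2) * (|s₁.im| + |s₂.im|) + Real.pi / 2 * |s₁.im + s₂.im|)

theorem differentiableAt_rowKernel (ν : Fin 3 → ℂ) (e : ℕ) {s₁ s₂ : ℂ} (h₁ : s₁.re < 0)
    (h₂ : s₂.re < 0) : DifferentiableAt ℂ (rowKernel ν e s₁) s₂ := by
  unfold rowKernel
  refine (DifferentiableAt.pow (by fun_prop) _).mul ((differentiable_invGammaProd ν s₂).mul ?_)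
  refine DifferentiableAt.comp s₂ (Complex.differentiableAt_Gamma _ fun m h => ?_) (by fun_prop)
  have := congrArg Complex.re h
  simp at this
  have h3 : (0 : ℝ) ≤ m := m.cast_nonneg
  linarith

section

variable {A₁ A₂ : ℝ} {J : Finset (Fin 3)} {I : Fin 3 → Finset (Fin 3)} {p q : Fin 3 → ℂ}
  {l : Fin 3 → Fin 3 → ℂ} {κ₁ κ₂ : ℂ} {D : Fin 3 → ℂ → ℂ} {T : ℂ → ℂ → ℂ} {ν : Fin 3 → ℂ}
  {e₁ e₂ : ℕ} {η : ℝ}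

theorem DoublePoles.stripDecay_row (h : DoublePoles A₁ A₂ J I p q l κ₁ κ₂ D T) (hA₁ : 0 < A₁)
    (hA₂ : 0 < A₂) (hη : 0 < η) (he₂ : 2 * A₂ - A₁ = e₂ + η) (hν : ∑ k, ν k = 0)
    {s₁ : ℂ} (hs₁ : s₁.re = -A₁) {Y : ℝ} (hY : 0 < Y) (n : ℕ) :
    StripDecay (-A₂) (fun s => ((Y : ℂ) ^ (-(s - n)) * rowKernel ν e₂ s₁ (s - n)) * T s₁ s) := by
  obtain ⟨C, T₀, hC0, hC⟩ := h.snd_decay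
  have hn : (0 : ℝ) ≤ n := n.cast_nonneg
  obtain ⟨K, hK, hk⟩ := norm_rowKernel_le hν e₂ hA₁.le (-A₂ - 1 - n) (b := -A₂ - n) (by linarith)
  refine ⟨(Y ^ (A₂ + n) + Y ^ (A₂ + 1 + n)) * (K * (1 + |s₁.im|) ^ (1 / 2 + A₁ + (A₂ + 1 + n))) *
    C, η, T₀, hη, fun s g1 g2 g3 => ?_⟩
  have b1 := hC s₁ s hs₁ g1 g2 g3
  have b2 := hk s₁ (s - n) hs₁ (by simp; linarith) (by simp; linarith)
  have him : (s - n).im = s.im := by simp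
  have hre : (s - n).re = s.re - n := by simp
  rw [him, hre] at b2
  have b3 : ‖(Y : ℂ) ^ (-(s - n))‖ ≤ Y ^ (A₂ + n) + Y ^ (A₂ + 1 + n) := by
    rw [norm_cpow_neg hY]
    refine rpow_le_rpow_add_rpow hY ?_ ?_ <;> simp <;> linarith
  rw [norm_mul, norm_mul]
  have b4 : (1 + |s₁.im|) ^ (1 / 2 + A₁ - (s.re - n)) ≤
      (1 + |s₁.im|) ^ (1 / 2 + A₁ + (A₂ + 1 + n)) :=
    Real.rpow_le_rpow_of_exponent_le (by linarith [abs_nonneg s₁.im]) (by linarith)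
  have b5 : (1 + |s.im|) ^ (e₂ - 1 + A₁ + 2 * (s.re - n)) ≤ (1 + |s.im|) ^ (-1 - η) :=
    Real.rpow_le_rpow_of_exponent_le (by linarith [abs_nonneg s.im]) (by linarith)
  have b6 : Real.exp (3 * Real.pi / 2 * |s.im| - Real.pi / 2 * |s₁.im + s.im|) *
      Real.exp (-(3 * Real.pi / 2) * (|s₁.im| + |s.im|) + Real.pi / 2 * |s₁.im + s.im|) ≤ 1 := by
    rw [← Real.exp_add, Real.exp_le_one_iff]
    nlinarith [mul_nonneg Real.pi_pos.le (abs_nonneg s₁.im)]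
  calc _ ≤ (Y ^ (A₂ + n) + Y ^ (A₂ + 1 + n)) *
        (K * ((1 + |s₁.im|) ^ (1 / 2 + A₁ + (A₂ + 1 + n)) * (1 + |s.im|) ^ (-1 - η)) *
          Real.exp (3 * Real.pi / 2 * |s.im| - Real.pi / 2 * |s₁.im + s.im|)) *
        (C * Real.exp (-(3 * Real.pi / 2) * (|s₁.im| + |s.im|) +
          Real.pi / 2 * |s₁.im + s.im|)) := by
        gcongr
        exact b2.trans (by gcongr)
    _ = (Y ^ (A₂ + n) + Y ^ (A₂ + 1 + n)) * (K * (1 + |s₁.im|) ^ (1 / 2 + A₁ + (A₂ + 1 + n))) *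
        C * (1 + |s.im|) ^ (-1 - η) *
        (Real.exp (3 * Real.pi / 2 * |s.im| - Real.pi / 2 * |s₁.im + s.im|) *
          Real.exp (-(3 * Real.pi / 2) * (|s₁.im| + |s.im|) +
            Real.pi / 2 * |s₁.im + s.im|)) := by ring
    _ ≤ _ := mul_le_of_le_one_right (by positivity) b6

theorem DoublePoles.norm_edge_le (h : DoublePoles A₁ A₂ J I p q l κ₁ κ₂ D T) (hA₁ : 0 < A₁)
    (hA₂ : 0 < A₂) (he₁ : 2 * A₁ - A₂ = e₁ + η) (he₂ : 2 * A₂ - A₁ = e₂ + η) (hν : ∑ k, ν k = 0) :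
    ∃ K : ℝ, 0 < K ∧ ∀ s₁ s₂ : ℂ, s₁.re = -A₁ → s₂.re = -A₂ →
      ‖(1 - s₁) ^ e₁ * invGammaProd ν s₁‖ * (‖rowKernel (-ν) e₂ s₁ s₂‖ * ‖T s₁ s₂‖) ≤
        K * ((1 + |s₁.im|) ^ (-1 - η) * (1 + |s₂.im|) ^ (-1 - η)) := by
  obtain ⟨C, T₀, hC0, hC⟩ := h.snd_decay
  have hν' : ∑ k, (-ν) k = 0 := by simp [hν]
  obtain ⟨K₁, hK₁, h₁⟩ := norm_one_sub_add_le (-A₁) (-A₁) 0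
  obtain ⟨K₂, hK₂, h₂⟩ := norm_invGammaProd_le hν (-A₁) (-A₁)
  obtain ⟨K₃, hK₃, h₃⟩ := norm_rowKernel_le hν' e₂ hA₁.le (-A₂) (b := -A₂) (by linarith)
  refine ⟨K₁ ^ e₁ * K₂ * K₃ * (C + 1), by positivity, fun s₁ s₂ hs₁ hs₂ => ?_⟩
  have b1 := h₁ s₁ hs₁.ge hs₁.le
  have b2 := h₂ s₁ hs₁.ge hs₁.le
  have b3 := h₃ s₁ s₂ hs₁ hs₂.ge hs₂.le
  have b4 := hC s₁ s₂ hs₁ (by linarith) hs₂.le (Or.inr (Or.inl hs₂))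
  rw [add_zero] at b1
  rw [hs₁] at b2
  rw [hs₂] at b3
  have p1 : 0 < 1 + |s₁.im| := by positivity
  have p2 : 0 < 1 + |s₂.im| := by positivity
  have k1 : (1 + |s₁.im|) ^ e₁ * (1 + |s₁.im|) ^ (-3 / 2 + 3 * -A₁) *
      (1 + |s₁.im|) ^ (1 / 2 + A₁ - -A₂) = (1 + |s₁.im|) ^ (-1 - η) := by
    rw [← Real.rpow_natCast, ← Real.rpow_add p1, ← Real.rpow_add p1]
    congr 1; linarith
  have k2 : (1 + |s₂.im|) ^ (e₂ - 1 + A₁ + 2 * -A₂) = (1 + |s₂.im|) ^ (-1 - η) := by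
    congr 1; linarith
  have k3 : Real.exp (3 * Real.pi / 2 * |s₁.im|) *
      Real.exp (3 * Real.pi / 2 * |s₂.im| - Real.pi / 2 * |s₁.im + s₂.im|) *
      Real.exp (-(3 * Real.pi / 2) * (|s₁.im| + |s₂.im|) + Real.pi / 2 * |s₁.im + s₂.im|) = 1 := by
    rw [← Real.exp_add, ← Real.exp_add, Real.exp_eq_one_iff]
    ring
  rw [norm_mul, norm_pow]
  calc _ ≤ ((K₁ * (1 + |s₁.im|)) ^ e₁ * (K₂ * ((1 + |s₁.im|) ^ (-3 / 2 + 3 * -A₁) *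
        Real.exp (3 * Real.pi / 2 * |s₁.im|)))) *
        ((K₃ * ((1 + |s₁.im|) ^ (1 / 2 + A₁ - -A₂) * (1 + |s₂.im|) ^ (e₂ - 1 + A₁ + 2 * -A₂)) *
          Real.exp (3 * Real.pi / 2 * |s₂.im| - Real.pi / 2 * |s₁.im + s₂.im|)) *
        (C * Real.exp (-(3 * Real.pi / 2) * (|s₁.im| + |s₂.im|) +
          Real.pi / 2 * |s₁.im + s₂.im|))) := by gcongr
    _ = K₁ ^ e₁ * K₂ * K₃ * C * (((1 + |s₁.im|) ^ e₁ * (1 + |s₁.im|) ^ (-3 / 2 + 3 * -A₁) *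
          (1 + |s₁.im|) ^ (1 / 2 + A₁ - -A₂)) * (1 + |s₂.im|) ^ (e₂ - 1 + A₁ + 2 * -A₂)) *
        (Real.exp (3 * Real.pi / 2 * |s₁.im|) *
          Real.exp (3 * Real.pi / 2 * |s₂.im| - Real.pi / 2 * |s₁.im + s₂.im|) *
          Real.exp (-(3 * Real.pi / 2) * (|s₁.im| + |s₂.im|) +
            Real.pi / 2 * |s₁.im + s₂.im|)) := by
        rw [mul_pow]; ring
    _ ≤ _ := by
        rw [k1, k2, k3, mul_one]
        gcongr
        linarith

theorem DoublePoles.norm_row_sum_le (h : DoublePoles A₁ A₂ J I p q l κ₁ κ₂ D T) (hA₁ : 0 < A₁)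
    (hA₂ : 0 < A₂) (hη : 0 < η) (he₁ : 2 * A₁ - A₂ = e₁ + η) (he₂ : 2 * A₂ - A₁ = e₂ + η)
    (hν : ∑ k, ν k = 0) (hκ₂ : ‖κ₂‖ = 1) (hns : ∀ (k : Fin 3) (n : ℕ), 1 + A₂ - (ν k).re + n ≠ 0) :
    ∃ K B : ℝ, 0 < K ∧ 1 ≤ B ∧ ∀ s₁ : ℂ, s₁.re = -A₁ → ∀ Y : ℝ, 0 < Y → ∀ N : ℕ,
      ‖(1 - s₁) ^ e₁ * invGammaProd ν s₁‖ * ‖∑ n ∈ Finset.range N, ∑ j ∈ J, D j s₁ *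
        (κ₂ ^ n * ((Y : ℂ) ^ (-(q j - n)) * rowKernel (-ν) e₂ s₁ (q j - n)))‖ ≤
      K * Y ^ A₂ * (1 + |s₁.im|) ^ (-1 - η) *
        (1 + (B * Y * (1 + |s₁.im|)) ^ N / (N.factorial : ℝ) ^ 2) := by
  obtain ⟨K, hK, hk⟩ := h.norm_edge_le hA₁ hA₂ he₁ he₂ hν
  obtain ⟨B, hB, hb⟩ := norm_rowKernel_sub_nat_le (-ν) e₂ hA₁.le hA₂.le
    (by simpa [sub_eq_add_neg] using hns)
  have hν' : ∑ k, (-ν) k = 0 := by simp [hν]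
  have hI := integrable_rpow_neg_one_sub hη
  set W := ∫ t : ℝ, (1 + |t|) ^ (-1 - η)
  have hW : 0 ≤ W := integral_nonneg fun t => by positivity
  refine ⟨K * W + 1, B, by positivity, hB, fun s₁ hs₁ Y hY N => ?_⟩
  have hY0 : (Y : ℂ) ≠ 0 := by exact_mod_cast hY.ne'
  have hs := (h.snd s₁ hs₁).sum_range (by linarith)
    (a := fun s => (Y : ℂ) ^ (-s) * rowKernel (-ν) e₂ s₁ s)
    (fun s hs => DifferentiableAt.mul (DifferentiableAt.const_cpow (by fun_prop) (Or.inl hY0))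
      (differentiableAt_rowKernel _ _ (by linarith) hs))
    (fun n => h.stripDecay_row hA₁ hA₂ hη he₂ hν' hs₁ hY n) N
  have hint : ∀ n : ℕ, ‖(1 - s₁) ^ e₁ * invGammaProd ν s₁‖ *
      ‖∫ t : ℝ, ((Y : ℂ) ^ (-(((-A₂ : ℝ) : ℂ) + t * Complex.I - n)) *
        rowKernel (-ν) e₂ s₁ (((-A₂ : ℝ) : ℂ) + t * Complex.I - n)) *
          T s₁ (((-A₂ : ℝ) : ℂ) + t * Complex.I)‖ ≤
      K * W * Y ^ A₂ * (1 + |s₁.im|) ^ (-1 - η) *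
        ((B * Y * (1 + |s₁.im|)) ^ n / (n.factorial : ℝ) ^ 2) := by
    intro n
    rw [← norm_mul, ← integral_const_mul]
    refine (norm_integral_le_of_norm_le (hI.const_mul (K * Y ^ A₂ * (1 + |s₁.im|) ^ (-1 - η) *
        ((B * Y * (1 + |s₁.im|)) ^ n / (n.factorial : ℝ) ^ 2)))
      (Filter.Eventually.of_forall fun t => ?_)).trans (le_of_eq ?_)
    · set s₂ : ℂ := ((-A₂ : ℝ) : ℂ) + t * Complex.I with hs₂
      have hre : s₂.re = -A₂ := by simp [hs₂]
      have him : s₂.im = t := by simp [hs₂]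
      have g1 := hk s₁ s₂ hs₁ hre
      have g2 := hb s₁ s₂ hs₁ hre n
      have g3 : ‖(Y : ℂ) ^ (-(s₂ - n))‖ = Y ^ A₂ * Y ^ n := by
        rw [norm_cpow_neg hY, ← Real.rpow_natCast, ← Real.rpow_add hY]
        congr 1; simp [hre, add_comm]
      rw [him] at g1
      rw [norm_mul, norm_mul (_ * _) (T _ _), norm_mul ((Y : ℂ) ^ _), g3]
      calc _ ≤ ‖(1 - s₁) ^ e₁ * invGammaProd ν s₁‖ * (Y ^ A₂ * Y ^ n *
            ((B * (1 + |s₁.im|)) ^ n / (n.factorial : ℝ) ^ 2 * ‖rowKernel (-ν) e₂ s₁ s₂‖) *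
            ‖T s₁ s₂‖) := by gcongr
        _ = Y ^ A₂ * ((B * Y * (1 + |s₁.im|)) ^ n / (n.factorial : ℝ) ^ 2) *
            (‖(1 - s₁) ^ e₁ * invGammaProd ν s₁‖ *
              (‖rowKernel (-ν) e₂ s₁ s₂‖ * ‖T s₁ s₂‖)) := by
            rw [mul_pow, mul_pow, mul_pow]; ring
        _ ≤ Y ^ A₂ * ((B * Y * (1 + |s₁.im|)) ^ n / (n.factorial : ℝ) ^ 2) *
            (K * ((1 + |s₁.im|) ^ (-1 - η) * (1 + |t|) ^ (-1 - η))) := by gcongr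
        _ = _ := by ring
    · rw [integral_const_mul]; ring
  have hpi : (1 : ℝ) ≤ 2 * Real.pi := by linarith [Real.pi_gt_three]
  have h2 : ‖(2 * (Real.pi : ℂ))‖ = 2 * Real.pi := by simp [abs_of_pos Real.pi_pos]
  have h3 := congrArg norm hs
  rw [norm_mul, h2] at h3
  set S := ∑ n ∈ Finset.range N, ∑ j ∈ J, D j s₁ *
        (κ₂ ^ n * ((Y : ℂ) ^ (-(q j - n)) * rowKernel (-ν) e₂ s₁ (q j - n)))
  have h4 : ‖S‖ ≤ 2 * Real.pi * ‖S‖ := le_mul_of_one_le_left (norm_nonneg _) hpi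
  have h5 := hint 0
  have h6 := hint N
  simp only [Nat.cast_zero, sub_zero, pow_zero, Nat.factorial_zero, Nat.cast_one, one_pow,
    div_one, mul_one] at h5
  refine (mul_le_mul_of_nonneg_left (h4.trans (h3.le.trans (norm_sub_le _ _)))
    (norm_nonneg _)).trans ?_
  rw [norm_mul (κ₂ ^ N), norm_pow, hκ₂, one_pow, one_mul, mul_add]
  refine (add_le_add h5 h6).trans ?_
  have h7 : 0 ≤ Y ^ A₂ * (1 + |s₁.im|) ^ (-1 - η) *
        (1 + (B * Y * (1 + |s₁.im|)) ^ N / (N.factorial : ℝ) ^ 2) := by positivity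
  linarith

end

theorem tendsto_sum_range_tsum_mul {u : ℕ × ℕ → ℂ} (hu : Summable u) {ρ : ℕ → ℕ → ℂ}
    (h₁ : ∀ N m, ‖ρ N m‖ ≤ 1) (h₂ : ∀ m, Filter.Tendsto (fun N => ρ N m) Filter.atTop (nhds 1)) :
    Filter.Tendsto (fun N => ∑ n ∈ Finset.range N, ∑' m, ρ N m * u (m, n)) Filter.atTop
      (nhds (∑' x, u x)) := by
  have hun := hu.norm
  have hb : ∀ N (x : ℕ × ℕ), ‖(if x.2 < N then ρ N x.1 * u x else 0 : ℂ)‖ ≤ ‖u x‖ := by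
    intro N x
    split_ifs
    · rw [norm_mul]
      exact mul_le_of_le_one_left (norm_nonneg _) (h₁ _ _)
    · simp
  have hs : ∀ N, Summable (fun x : ℕ × ℕ => (if x.2 < N then ρ N x.1 * u x else 0 : ℂ)) :=
    fun N => Summable.of_norm_bounded hun (hb N)
  have hcol : ∀ n, Summable fun m => ‖u (m, n)‖ := fun n =>
    hun.comp_injective (i := fun m => (m, n)) fun a b h => (Prod.mk.inj h).1
  refine (tendsto_tsum_of_dominated_convergence hun (f := fun N (x : ℕ × ℕ) =>
    (if x.2 < N then ρ N x.1 * u x else 0 : ℂ)) (fun x => ?_)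
    (Filter.Eventually.of_forall fun N x => hb N x)).congr fun N => ?_
  · have := (h₂ x.1).mul_const (u x)
    rw [one_mul] at this
    refine this.congr' ?_
    filter_upwards [Filter.eventually_gt_atTop x.2] with N hN
    rw [if_pos hN]
  · rw [(hs N).tsum_prod, ← Summable.tsum_finsetSum]
    · refine tsum_congr fun m => ?_
      rw [tsum_eq_sum (s := Finset.range N)]
      · exact Finset.sum_congr rfl fun n hn => by rw [if_pos (Finset.mem_range.1 hn)]
      · intro n hn
        rw [if_neg (by simpa using hn)]
    · intro n _
      refine Summable.of_norm_bounded (hcol n) fun m => ?_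
      rw [norm_mul]
      exact mul_le_of_le_one_left (norm_nonneg _) (h₁ _ _)

/-- The damped Mellin kernel in the first variable. -/
noncomputable def dampedKernel (ν : Fin 3 → ℂ) (e N : ℕ) (c s : ℂ) : ℂ :=
  dampFactor N s * ((1 - s) ^ e * (invGammaProd ν s * Complex.Gamma (1 - s - c)))

theorem differentiableAt_dampedKernel (ν : Fin 3 → ℂ) (e N : ℕ) {c s : ℂ} (hc : c.re < 0)
    (hs : s.re < 0) : DifferentiableAt ℂ (dampedKernel ν e N c) s := by
  unfold dampedKernel
  refine (differentiableAt_dampFactor N hs).mul ((DifferentiableAt.pow (by fun_prop) _).mul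
    ((differentiable_invGammaProd ν s).mul ?_))
  refine DifferentiableAt.comp s (Complex.differentiableAt_Gamma _ fun m h => ?_) (by fun_prop)
  have := congrArg Complex.re h
  simp at this
  have h3 : (0 : ℝ) ≤ m := m.cast_nonneg
  linarith

theorem shiftSmall_dampedKernel (ν : Fin 3 → ℂ) (e N : ℕ) (c : ℂ) :
    ShiftSmall (dampedKernel ν e N c) :=
  ((shiftSmall_invGammaProd_mul_Gamma ν c).mul_left (K := 2 ^ e) (R₀ := 0) (by positivity)
    fun s hs => norm_one_sub_shift_le (by linarith) e).mul_left (K := 1) (R₀ := 0) one_pos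
    fun s hs => norm_dampFactor_sub_one_le N (by linarith)

theorem stripDecay_dampedKernel {A₁ A₂ η : ℝ} {e N : ℕ} {ν : Fin 3 → ℂ} {Θ : ℂ → ℂ}
    (hΘ : StripExpDecay (-A₁) Θ) (hA₁ : 0 < A₁) (hη : 0 < η) (he : 2 * A₁ - A₂ = e + η)
    (hν : ∑ k, ν k = 0) {c : ℂ} (hc : c.re < 0) (hcN : -c.re ≤ A₂ + N) (m : ℕ) :
    StripDecay (-A₁) (fun s => dampedKernel ν e N c (s - m) * Θ s) := by
  obtain ⟨C, T₀, hC0, hC⟩ := hΘ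
  have hm : (0 : ℝ) ≤ m := m.cast_nonneg
  obtain ⟨K₁, hK₁, h₁⟩ := norm_one_sub_add_le (-A₁ - 1 - m) (-A₁ - m) 0
  obtain ⟨K₂, hK₂, h₂⟩ := norm_invGammaProd_le hν (-A₁ - 1 - m) (-A₁ - m)
  obtain ⟨K₃, hK₃, h₃⟩ := norm_Gamma_le (1 + (A₁ + 1 + m) - c.re)
  set E := 1 / 2 + (A₁ + 1 + m) - c.re with hE
  set L := (1 + |c.im|) ^ E
  have hL : 0 < L := by positivity
  have hd := dampScale_pos N
  refine ⟨(2 / dampScale N) ^ N * (K₁ ^ e * (K₂ * (K₃ * (L * Real.exp (Real.pi / 2 * |c.im|))))) *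
    C, η, T₀, hη, fun s g1 g2 g3 => ?_⟩
  have b0 := hC s g1 g2 g3
  have him : (s - m).im = s.im := by simp
  have hre : (s - m).re = s.re - m := by simp
  set z := s - m with hz
  have b1 := h₁ z (by linarith) (by linarith)
  have b2 := h₂ z (by linarith) (by linarith)
  have hre' : (1 - z - c).re = 1 - z.re - c.re := by simp
  have b3 := h₃ (1 - z - c) (by linarith) (by linarith)
  have him' : |(1 - z - c).im| = |s.im + c.im| := by
    rw [← abs_neg, ← him]; congr 1; simp; ring
  rw [hre', him'] at b3
  rw [add_zero, him] at b1
  rw [him] at b2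
  have p1 : 0 < 1 + |s.im| := by positivity
  have b4 : (1 + |s.im + c.im|) ^ (1 - z.re - c.re - 1 / 2) ≤
      L * (1 + |s.im|) ^ (1 - z.re - c.re - 1 / 2) :=
    one_add_abs_rpow_le (by simp) (by rw [abs_of_nonneg] <;> linarith)
  have b5 : Real.exp (-(Real.pi / 2 * |s.im + c.im|)) ≤
      Real.exp (Real.pi / 2 * |c.im|) * Real.exp (-(Real.pi / 2 * |s.im|)) := by
    rw [← Real.exp_add, Real.exp_le_exp]
    have : |s.im| ≤ |s.im + c.im| + |c.im| := by
      have := abs_sub (s.im + c.im) c.im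
      rwa [add_sub_cancel_right] at this
    nlinarith [Real.pi_pos]
  have b6 : ‖dampFactor N z‖ ≤ (2 / dampScale N) ^ N * ((1 + |s.im|) ^ N)⁻¹ := by
    rw [← div_eq_mul_inv, le_div_iff₀ (by positivity)]
    have := norm_dampFactor_mul_le N (s := z) (by linarith)
    rwa [him] at this
  have k3 : Real.exp (3 * Real.pi / 2 * |s.im|) * Real.exp (-(Real.pi / 2 * |s.im|)) *
      Real.exp (-(Real.pi * |s.im|)) = 1 := by
    rw [← Real.exp_add, ← Real.exp_add, Real.exp_eq_one_iff]; ring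
  have k4 : ((1 + |s.im|) ^ N)⁻¹ * ((1 + |s.im|) ^ e * ((1 + |s.im|) ^ (-3 / 2 + 3 * z.re) *
      (1 + |s.im|) ^ (1 - z.re - c.re - 1 / 2))) ≤ (1 + |s.im|) ^ (-1 - η) := by
    rw [← Real.rpow_natCast, ← Real.rpow_natCast, ← Real.rpow_neg p1.le, ← Real.rpow_add p1,
      ← Real.rpow_add p1, ← Real.rpow_add p1]
    refine Real.rpow_le_rpow_of_exponent_le (by linarith [abs_nonneg s.im]) ?_
    linarith
  simp only [dampedKernel, norm_mul, norm_pow]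
  calc _ ≤ (2 / dampScale N) ^ N * ((1 + |s.im|) ^ N)⁻¹ * ((K₁ * (1 + |s.im|)) ^ e *
        (K₂ * ((1 + |s.im|) ^ (-3 / 2 + 3 * z.re) * Real.exp (3 * Real.pi / 2 * |s.im|)) *
        (K₃ * ((L * (1 + |s.im|) ^ (1 - z.re - c.re - 1 / 2)) *
          (Real.exp (Real.pi / 2 * |c.im|) * Real.exp (-(Real.pi / 2 * |s.im|))))))) *
        (C * Real.exp (-(Real.pi * |s.im|))) := by
        gcongr
        exact b3.trans (by gcongr)
    _ = (2 / dampScale N) ^ N * (K₁ ^ e * (K₂ * (K₃ * (L * Real.exp (Real.pi / 2 * |c.im|))))) *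
        C * (((1 + |s.im|) ^ N)⁻¹ * ((1 + |s.im|) ^ e * ((1 + |s.im|) ^ (-3 / 2 + 3 * z.re) *
          (1 + |s.im|) ^ (1 - z.re - c.re - 1 / 2)))) *
        (Real.exp (3 * Real.pi / 2 * |s.im|) * Real.exp (-(Real.pi / 2 * |s.im|)) *
          Real.exp (-(Real.pi * |s.im|))) := by rw [mul_pow]; ring
    _ ≤ _ := by
        rw [k3, mul_one]
        gcongr

theorem integrable_cpow_mul {A X : ℝ} (hX : 0 < X) {f : ℝ → ℂ} (hf : Integrable f) :
    Integrable (fun t : ℝ => (X : ℂ) ^ (-(((-A : ℝ) : ℂ) + t * Complex.I)) * f t) := by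
  have hX0 : (X : ℂ) ≠ 0 := by exact_mod_cast hX.ne'
  refine hf.bdd_mul (c := X ^ A) ?_ (Filter.Eventually.of_forall fun t => ?_)
  · exact (Continuous.const_cpow (by fun_prop) (Or.inl hX0)).aestronglyMeasurable
  · rw [norm_cpow_neg hX]; simp

section

variable {A₁ A₂ : ℝ} {J : Finset (Fin 3)} {I : Fin 3 → Finset (Fin 3)} {p q : Fin 3 → ℂ}
  {l : Fin 3 → Fin 3 → ℂ} {κ₁ κ₂ : ℂ} {D : Fin 3 → ℂ → ℂ} {T : ℂ → ℂ → ℂ} {ν : Fin 3 → ℂ}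
  {e₁ e₂ : ℕ} {η : ℝ}

theorem DoublePoles.norm_damped_sum_le (h : DoublePoles A₁ A₂ J I p q l κ₁ κ₂ D T) (hA₁ : 0 < A₁)
    (hA₂ : 0 < A₂) (hη : 0 < η) (he₁ : 2 * A₁ - A₂ = e₁ + η) (he₂ : 2 * A₂ - A₁ = e₂ + η)
    (hν : ∑ k, ν k = 0) (hκ₁ : ‖κ₁‖ = 1) (hκ₂ : ‖κ₂‖ = 1)
    (hns : ∀ (k : Fin 3) (n : ℕ), 1 + A₂ - (ν k).re + n ≠ 0) :
    ∃ K B : ℝ, 0 < K ∧ 1 ≤ B ∧ ∀ X Y : ℝ, 0 < X → 0 < Y → ∀ N : ℕ,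
      ‖∑ n ∈ Finset.range N, ∑ j ∈ J, ∑ i ∈ I j, l j i * ∑' m : ℕ, dampFactor N (p i - m) *
        (κ₁ ^ m * κ₂ ^ n * mellinTerm ν e₁ e₂ X Y (p i - m) (q j - n))‖ ≤
      K * (X ^ A₁ * Y ^ A₂) *
        (1 + (B * Y) ^ N / (N.factorial : ℝ) ^ 2 * (2 / dampScale N) ^ N) := by
  obtain ⟨K, B, hK, hB, hk⟩ := h.norm_row_sum_le hA₁ hA₂ hη he₁ he₂ hν hκ₂ hns
  have hI := integrable_rpow_neg_one_sub hη
  set W := ∫ t : ℝ, (1 + |t|) ^ (-1 - η)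
  have hW : 0 ≤ W := integral_nonneg fun t => by positivity
  refine ⟨K * W + 1, B, by positivity, hB, fun X Y hX hY N => ?_⟩
  have hd := dampScale_pos N
  set g : ℕ → Fin 3 → ℂ := fun n j => κ₂ ^ n * ((Y : ℂ) ^ (-(q j - n)) *
    ((1 - (q j - n)) ^ e₂ * invGammaProd (-ν) (q j - n))) with hg
  set L : ℝ → ℂ := fun t => ((-A₁ : ℝ) : ℂ) + t * Complex.I with hL
  have hLre : ∀ t, (L t).re = -A₁ := fun t => by simp [hL]
  have hLim : ∀ t, (L t).im = t := fun t => by simp [hL]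
  have hq : ∀ j ∈ J, -A₂ - 1 < (q j).re ∧ (q j).re < -A₂ := fun j hj => by
    have := (h.snd (-A₁ : ℝ) (by simp)).mem j hj
    exact this
  have hstep : ∀ n ∈ Finset.range N, ∀ j ∈ J,
      Integrable (fun t => g n j * ((X : ℂ) ^ (-L t) *
        (dampedKernel ν e₁ N (q j - n) (L t) * D j (L t)))) ∧
      2 * Real.pi * ∑ i ∈ I j, l j i * ∑' m : ℕ, dampFactor N (p i - m) *
        (κ₁ ^ m * κ₂ ^ n * mellinTerm ν e₁ e₂ X Y (p i - m) (q j - n)) =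
      ∫ t, g n j * ((X : ℂ) ^ (-L t) *
        (dampedKernel ν e₁ N (q j - n) (L t) * D j (L t))) := by
    intro n hn j hj
    have hn' : (n : ℝ) + 1 ≤ N := by exact_mod_cast Finset.mem_range.1 hn
    have hn0 : (0 : ℝ) ≤ n := n.cast_nonneg
    obtain ⟨q1, q2⟩ := hq j hj
    have hc : (q j - n).re < 0 := by simp; linarith
    have hdec := stripDecay_dampedKernel (N := N) (h.fst_decay j hj) hA₁ hη he₁ hν hc
      (by simp; linarith)
    have hdiff := fun (s : ℂ) (hs : s.re < 0) => differentiableAt_dampedKernel ν e₁ N hc hs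
    constructor
    · have := ((h.fst j hj).one_strip (by linarith) hdiff 0 (hdec 0)).1
      simp only [Nat.cast_zero, sub_zero] at this
      exact (integrable_cpow_mul hX this).const_mul _
    · have := (h.fst j hj).tsum_cpow hA₁ hκ₁ hdiff hdec (shiftSmall_dampedKernel ν e₁ N _) hX
      rw [integral_const_mul, ← this, mul_left_comm]
      congr 1
      rw [Finset.mul_sum]
      refine Finset.sum_congr rfl fun i _ => ?_
      rw [mul_left_comm]
      congr 1
      rw [← tsum_mul_left]
      refine tsum_congr fun m => ?_
      rw [hg, mellinTerm, dampedKernel]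
      ring
  have hsum : 2 * Real.pi * ∑ n ∈ Finset.range N, ∑ j ∈ J, ∑ i ∈ I j, l j i * ∑' m : ℕ,
      dampFactor N (p i - m) * (κ₁ ^ m * κ₂ ^ n * mellinTerm ν e₁ e₂ X Y (p i - m) (q j - n)) =
      ∫ t, ∑ n ∈ Finset.range N, ∑ j ∈ J, g n j * ((X : ℂ) ^ (-L t) *
        (dampedKernel ν e₁ N (q j - n) (L t) * D j (L t))) := by
    rw [integral_finsetSum _ fun n hn => integrable_finsetSum _ fun j hj => (hstep n hn j hj).1,
      Finset.mul_sum]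
    refine Finset.sum_congr rfl fun n hn => ?_
    rw [integral_finsetSum _ fun j hj => (hstep n hn j hj).1, Finset.mul_sum]
    exact Finset.sum_congr rfl fun j hj => (hstep n hn j hj).2
  have hpt : ∀ t, ∑ n ∈ Finset.range N, ∑ j ∈ J, g n j * ((X : ℂ) ^ (-L t) *
        (dampedKernel ν e₁ N (q j - n) (L t) * D j (L t))) =
      ((X : ℂ) ^ (-L t) * dampFactor N (L t)) * (((1 - L t) ^ e₁ * invGammaProd ν (L t)) *
        ∑ n ∈ Finset.range N, ∑ j ∈ J, D j (L t) *
          (κ₂ ^ n * ((Y : ℂ) ^ (-(q j - n)) * rowKernel (-ν) e₂ (L t) (q j - n)))) := by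
    intro t
    simp only [Finset.mul_sum]
    refine Finset.sum_congr rfl fun n _ => Finset.sum_congr rfl fun j _ => ?_
    rw [hg, dampedKernel, rowKernel]
    ring
  set Z := ∑ n ∈ Finset.range N, ∑ j ∈ J, ∑ i ∈ I j, l j i * ∑' m : ℕ, dampFactor N (p i - m) *
    (κ₁ ^ m * κ₂ ^ n * mellinTerm ν e₁ e₂ X Y (p i - m) (q j - n))
  set M := X ^ A₁ * Y ^ A₂ *
        (1 + (B * Y) ^ N / (N.factorial : ℝ) ^ 2 * (2 / dampScale N) ^ N) with hM
  have hM0 : 0 ≤ M := by positivity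
  have hfin : ‖∫ t, ∑ n ∈ Finset.range N, ∑ j ∈ J, g n j * ((X : ℂ) ^ (-L t) *
        (dampedKernel ν e₁ N (q j - n) (L t) * D j (L t)))‖ ≤ K * M * W := by
    rw [← integral_const_mul]
    refine norm_integral_le_of_norm_le (hI.const_mul (K * M))
      (Filter.Eventually.of_forall fun t => ?_)
    rw [hpt, norm_mul, norm_mul, norm_cpow_neg hX, hLre, neg_neg, norm_mul]
    have b1 := hk (L t) (hLre t) Y hY N
    have b2 := norm_dampFactor_le_one N (s := L t) (by rw [hLre]; linarith)
    have b3 := norm_dampFactor_mul_le N (s := L t) (by rw [hLre]; linarith)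
    rw [hLim] at b1 b3
    calc _ ≤ X ^ A₁ * ‖dampFactor N (L t)‖ * (K * Y ^ A₂ * (1 + |t|) ^ (-1 - η) *
          (1 + (B * Y * (1 + |t|)) ^ N / (N.factorial : ℝ) ^ 2)) := by gcongr
      _ = K * (X ^ A₁ * Y ^ A₂) * (1 + |t|) ^ (-1 - η) * (‖dampFactor N (L t)‖ +
          (B * Y) ^ N / (N.factorial : ℝ) ^ 2 * (‖dampFactor N (L t)‖ * (1 + |t|) ^ N)) := by
          rw [mul_pow]; ring
      _ ≤ K * (X ^ A₁ * Y ^ A₂) * (1 + |t|) ^ (-1 - η) * (1 +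
          (B * Y) ^ N / (N.factorial : ℝ) ^ 2 * (2 / dampScale N) ^ N) := by gcongr
      _ = _ := by rw [hM]; ring
  have hpi : (1 : ℝ) ≤ 2 * Real.pi := by linarith [Real.pi_gt_three]
  have h2 : ‖(2 * (Real.pi : ℂ))‖ = 2 * Real.pi := by simp [abs_of_pos Real.pi_pos]
  rw [← hsum, norm_mul, h2] at hfin
  have h4 : ‖Z‖ ≤ 2 * Real.pi * ‖Z‖ := le_mul_of_one_le_left (norm_nonneg _) hpi
  rw [mul_assoc]
  linarith

theorem DoublePoles.norm_tsum_le (h : DoublePoles A₁ A₂ J I p q l κ₁ κ₂ D T) (hA₁ : 0 < A₁)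
    (hA₂ : 0 < A₂) (hη : 0 < η) (he₁ : 2 * A₁ - A₂ = e₁ + η) (he₂ : 2 * A₂ - A₁ = e₂ + η)
    (hν : ∑ k, ν k = 0) (hκ₁ : ‖κ₁‖ = 1) (hκ₂ : ‖κ₂‖ = 1)
    (hns : ∀ (k : Fin 3) (n : ℕ), 1 + A₂ - (ν k).re + n ≠ 0) :
    ∃ K : ℝ, ∀ X Y : ℝ, 0 < X → 0 < Y →
      ‖∑ j ∈ J, ∑ i ∈ I j, l j i * ∑' m : ℕ × ℕ,
        κ₁ ^ m.1 * κ₂ ^ m.2 * mellinTerm ν e₁ e₂ X Y (p i - m.1) (q j - m.2)‖ ≤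
      K * (X ^ A₁ * Y ^ A₂) := by
  obtain ⟨K, B, hK, hB, hk⟩ := h.norm_damped_sum_le hA₁ hA₂ hη he₁ he₂ hν hκ₁ hκ₂ hns
  refine ⟨K, fun X Y hX hY => ?_⟩
  have hp : ∀ j ∈ J, ∀ i ∈ I j, ∀ m : ℕ, (p i - m).re ≤ 0 := by
    intro j hj i hi m
    have := ((h.fst j hj).mem i hi).2
    have hm : (0 : ℝ) ≤ m := m.cast_nonneg
    simp; linarith
  have hlim : Filter.Tendsto (fun N => ∑ n ∈ Finset.range N, ∑ j ∈ J, ∑ i ∈ I j, l j i *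
      ∑' m : ℕ, dampFactor N (p i - m) *
        (κ₁ ^ m * κ₂ ^ n * mellinTerm ν e₁ e₂ X Y (p i - m) (q j - n))) Filter.atTop
      (nhds (∑ j ∈ J, ∑ i ∈ I j, l j i * ∑' m : ℕ × ℕ,
        κ₁ ^ m.1 * κ₂ ^ m.2 * mellinTerm ν e₁ e₂ X Y (p i - m.1) (q j - m.2))) := by
    have := tendsto_finsetSum J fun j hj => tendsto_finsetSum (I j) fun i hi =>
      (tendsto_sum_range_tsum_mul (summable_mellinTerm ν e₁ e₂ hX hY hκ₁ hκ₂ (p i) (q j))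
        (ρ := fun N m => dampFactor N (p i - m))
        (fun N m => norm_dampFactor_le_one N (hp j hj i hi m))
        (fun m => tendsto_dampFactor _)).const_mul (l j i)
    refine this.congr fun N => ?_
    simp only [Finset.mul_sum]
    rw [Finset.sum_comm (s := Finset.range N)]
    refine Finset.sum_congr rfl fun j _ => ?_
    rw [Finset.sum_comm (s := Finset.range N)]
  have hr := ((tendsto_pow_div_dampScale (B * Y) (by positivity)).const_add 1).const_mul
    (K * (X ^ A₁ * Y ^ A₂))
  rw [add_zero, mul_one] at hr
  exact le_of_tendsto_of_tendsto' hlim.norm hr fun N => hk X Y hX hY N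

end

theorem tsum_nat_eq_sum_range_add_tsum {u : ℤ → ℂ} (hu : ∀ n < 0, u n = 0)
    (hs : Summable fun n : ℕ => u n) (N : ℤ) :
    ∑' n : ℕ, u n = ∑ n ∈ Finset.range N.toNat, u n + ∑' m : ℕ, u (N + m) := by
  rcases Int.eq_nat_or_neg N with ⟨k, rfl | rfl⟩
  · rw [Int.toNat_natCast, ← hs.sum_add_tsum_nat_add k]
    congr 2
    funext m
    congr 1
    push_cast
    ring
  · have h1 : (-(k : ℤ)).toNat = 0 := by simp
    have hcomp : ∀ m : ℕ, u (-(k : ℤ) + ((m + k : ℕ) : ℤ)) = u m := fun m => by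
      congr 1; push_cast; ring
    have h2 : Summable fun m : ℕ => u (-(k : ℤ) + m) := by
      rw [← summable_nat_add_iff k]
      simpa only [hcomp] using hs
    rw [h1, Finset.sum_range_zero, zero_add, ← h2.sum_add_tsum_nat_add k,
      Finset.sum_eq_zero fun m hm => hu _ (by have := Finset.mem_range.1 hm; omega), zero_add]
    exact tsum_congr fun m => (hcomp m).symm

theorem tsum_prod_nat_eq_sum_range_add_tsum {u : ℤ → ℤ → ℂ} (hu₁ : ∀ a < 0, ∀ b, u a b = 0)
    (hu₂ : ∀ a, ∀ b < 0, u a b = 0)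
    (hs : ∀ a b : ℤ, Summable fun m : ℕ × ℕ => u (a + m.1) (b + m.2)) (N₁ N₂ : ℤ) :
    ∑' m : ℕ × ℕ, u m.1 m.2 =
      ∑ b ∈ Finset.range N₂.toNat, ∑ a ∈ Finset.range N₁.toNat, u a b +
      ∑ b ∈ Finset.range N₂.toNat, ∑' m : ℕ, u (N₁ + m) b +
      ∑ a ∈ Finset.range N₁.toNat, ∑' m : ℕ, u a (N₂ + m) +
      ∑' m : ℕ × ℕ, u (N₁ + m.1) (N₂ + m.2) := by
  have hs0 : Summable fun m : ℕ × ℕ => u m.1 m.2 := by simpa using hs 0 0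
  have hs2 : Summable fun m : ℕ × ℕ => u m.1 (N₂ + m.2) := by simpa using hs 0 N₂
  have hcol : ∀ b : ℕ, Summable fun a : ℕ => u a b := fun b =>
    (hs0.comp_injective (Prod.swap_injective (α := ℕ) (β := ℕ))).prod_factor b
  have hrow : ∀ a : ℕ, Summable fun b : ℕ => u a b := fun a => hs0.prod_factor a
  have e1 : ∀ a : ℕ, ∑' b : ℕ, u a b =
      ∑ b ∈ Finset.range N₂.toNat, u a b + ∑' m : ℕ, u a (N₂ + m) := fun a =>
    tsum_nat_eq_sum_range_add_tsum (hu₂ a) (hrow a) N₂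
  rw [hs0.tsum_prod, tsum_congr e1, Summable.tsum_add
    (summable_sum fun b _ => hcol b) hs2.prod, Summable.tsum_finsetSum fun b _ => hcol b]
  have e2 : ∀ b : ℕ, ∑' a : ℕ, u a b =
      ∑ a ∈ Finset.range N₁.toNat, u a b + ∑' m : ℕ, u (N₁ + m) b := fun b =>
    tsum_nat_eq_sum_range_add_tsum (fun a ha => hu₁ a ha b) (hcol b) N₁
  have e3 : ∑' a : ℕ, ∑' m : ℕ, u a (N₂ + m) = ∑ a ∈ Finset.range N₁.toNat, ∑' m : ℕ, u a (N₂ + m) +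
      ∑' k : ℕ, ∑' m : ℕ, u (N₁ + k) (N₂ + m) :=
    tsum_nat_eq_sum_range_add_tsum (u := fun a => ∑' m : ℕ, u a (N₂ + m))
      (fun a ha => by simp [hu₁ a ha]) hs2.prod N₁
  rw [e3, (hs N₁ N₂).tsum_prod, Finset.sum_congr rfl fun b _ => e2 b, Finset.sum_add_distrib]
  ring

theorem mellinTerm_swap (ν : Fin 3 → ℂ) (e₁ e₂ : ℕ) (X Y : ℝ) (s₁ s₂ : ℂ) :
    mellinTerm (-ν) e₂ e₁ Y X s₂ s₁ = mellinTerm ν e₁ e₂ X Y s₁ s₂ := by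
  rw [mellinTerm, mellinTerm, neg_neg, show 1 - s₂ - s₁ = 1 - s₁ - s₂ by ring]
  ring

theorem invGammaProd_sub_int (ν : Fin 3 → ℂ) (i : Fin 3) {n : ℤ} (hn : n < 0) :
    invGammaProd ν (ν i - n) = 0 := by
  refine Finset.prod_eq_zero (Finset.mem_univ i) ?_
  obtain ⟨k, hk⟩ : ∃ k : ℕ, n = -(k : ℤ) - 1 := ⟨(-n - 1).toNat, by omega⟩
  rw [show 1 - (ν i - n) + ν i = -(k : ℂ) by rw [hk]; push_cast; ring,
    Complex.Gamma_neg_nat_eq_zero, inv_zero]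

theorem cancelledGammaProd_sub_int (ν : Fin 3 → ℂ) {i j : Fin 3} (hij : i ≠ j) {n : ℤ}
    (hn : n < 0) (m : ℕ) : cancelledGammaProd ν j m (ν i - n) = 0 := by
  rw [cancelledGammaProd, Finset.prod_eq_zero (Finset.mem_erase.2 ⟨hij, Finset.mem_univ i⟩),
    mul_zero]
  obtain ⟨k, hk⟩ : ∃ k : ℕ, n = -(k : ℤ) - 1 := ⟨(-n - 1).toNat, by omega⟩
  rw [show 1 - (ν i - n) + ν i = -(k : ℂ) by rw [hk]; push_cast; ring,
    Complex.Gamma_neg_nat_eq_zero, inv_zero]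

theorem invGammaProd_mul_Gamma_eq (ν : Fin 3 → ℂ) {i j : Fin 3} (hij : i ≠ j)
    (hne : ∀ n : ℕ, 1 + n + ν j - ν i ≠ 0) (k : ℤ) (n : ℕ) :
    invGammaProd ν (ν i - k) * Complex.Gamma (1 - (ν i - k) + ν j + n) =
      cancelledGammaProd ν j n (ν i - k) := by
  rcases lt_or_ge k 0 with hk | hk
  · rw [invGammaProd_sub_int ν i hk, cancelledGammaProd_sub_int ν hij hk, zero_mul]
  · obtain ⟨k, rfl⟩ := Int.eq_ofNat_of_zero_le hk
    refine (cancelledGammaProd_eq (fun m h => hne (k + m) ?_) n).symm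
    rw [← h]; push_cast; ring

theorem StripPoles.norm_tsum_mellinTerm_le {A : ℝ} {S : Finset (Fin 3)} {l : Fin 3 → ℂ}
    {κ : ℂ} {Θ : ℂ → ℂ} {ν : Fin 3 → ℂ} {N : Fin 3 → ℤ}
    (h : StripPoles (-A) S (fun i => ν i - N i) l κ Θ) (hA : 0 < A)
    (hκ : ‖κ‖ = 1) (hΘ : StripExpDecay (-A) Θ) (hν : ∑ k, ν k = 0) (j : Fin 3)
    (hj : ∀ i ∈ S, i ≠ j) (hne : ∀ i ∈ S, ∀ n : ℕ, 1 + n + ν j - ν i ≠ 0)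
    (n e₁ e₂ : ℕ) (hexp : (e₁ : ℝ) + n - 2 * A + (ν j).re < 0) :
    ∃ C : ℝ, ∀ X Y : ℝ, 0 < X → 0 < Y → ‖∑ i ∈ S, l i * ∑' m : ℕ, κ ^ m *
      mellinTerm ν e₁ e₂ X Y (ν i - N i - m) (-ν j - n)‖ ≤ C * (X ^ A * Y ^ ((ν j).re + n)) := by
  obtain ⟨C, hC⟩ := h.norm_tsum_cancelledGammaProd_le hA hκ hΘ hν j n e₁ hexp
  set w := (1 - (-ν j - n)) ^ e₂ * invGammaProd (-ν) (-ν j - n)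
  refine ⟨‖w‖ * C, fun X Y hX hY => ?_⟩
  have key : ∑ i ∈ S, l i * ∑' m : ℕ, κ ^ m *
      mellinTerm ν e₁ e₂ X Y (ν i - N i - m) (-ν j - n) =
      ((Y : ℂ) ^ (-(-ν j - n)) * w) * ∑ i ∈ S, l i * ∑' m : ℕ, κ ^ m *
      ((X : ℂ) ^ (-(ν i - N i - m)) * ((1 - (ν i - N i - m)) ^ e₁ *
        cancelledGammaProd ν j n (ν i - N i - m))) := by
    rw [Finset.mul_sum]
    refine Finset.sum_congr rfl fun i hi => ?_
    rw [mul_left_comm]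
    congr 1
    rw [← tsum_mul_left]
    refine tsum_congr fun m => ?_
    have := invGammaProd_mul_Gamma_eq ν (hj i hi) (hne i hi) (N i + m) n
    rw [show ν i - ((N i + m : ℤ) : ℂ) = ν i - N i - m by push_cast; ring] at this
    rw [← this, mellinTerm, show 1 - (ν i - N i - m) - (-ν j - n) =
      1 - (ν i - N i - m) + ν j + n by ring]
    ring
  rw [key, norm_mul, norm_mul, norm_cpow_neg hY]
  have h3 : -(-ν j - (n : ℂ)).re = (ν j).re + n := by simp [add_comm]
  rw [h3]
  calc _ ≤ Y ^ ((ν j).re + n) * ‖w‖ * (C * X ^ A) := by gcongr; exact hC X hX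
    _ = _ := by ring

/-- `f` is dominated by `(X ^ (-M) + X ^ A₁) (Y ^ (-M) + Y ^ A₂)` on the positive quadrant. -/
def PowerBound (M A₁ A₂ : ℝ) (f : ℝ → ℝ → ℂ) : Prop :=
  ∃ K : ℝ, ∀ X Y : ℝ, 0 < X → 0 < Y →
    ‖f X Y‖ ≤ K * ((X ^ (-M) + X ^ A₁) * (Y ^ (-M) + Y ^ A₂))

section

variable {M A₁ A₂ : ℝ} {f g : ℝ → ℝ → ℂ}

theorem PowerBound.add (hf : PowerBound M A₁ A₂ f) (hg : PowerBound M A₁ A₂ g) :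
    PowerBound M A₁ A₂ (fun X Y => f X Y + g X Y) := by
  obtain ⟨K, hK⟩ := hf
  obtain ⟨L, hL⟩ := hg
  exact ⟨K + L, fun X Y hX hY => (norm_add_le _ _).trans
    (by rw [add_mul]; exact add_le_add (hK X Y hX hY) (hL X Y hX hY))⟩

theorem PowerBound.const_mul (hf : PowerBound M A₁ A₂ f) (c : ℂ) :
    PowerBound M A₁ A₂ (fun X Y => c * f X Y) := by
  obtain ⟨K, hK⟩ := hf
  refine ⟨‖c‖ * K, fun X Y hX hY => ?_⟩
  rw [norm_mul, mul_assoc]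
  exact mul_le_mul_of_nonneg_left (hK X Y hX hY) (norm_nonneg c)

theorem PowerBound.zero : PowerBound M A₁ A₂ (fun _ _ => 0) := ⟨0, fun X Y _ _ => by simp⟩

theorem PowerBound.sum {ι : Type*} {S : Finset ι} {f : ι → ℝ → ℝ → ℂ}
    (hf : ∀ i ∈ S, PowerBound M A₁ A₂ (f i)) :
    PowerBound M A₁ A₂ (fun X Y => ∑ i ∈ S, f i X Y) := by
  classical
  induction S using Finset.induction_on with
  | empty => simpa using PowerBound.zero
  | insert a S ha ih =>
    simp only [Finset.sum_insert ha]
    exact (hf a (by simp)).add (ih fun i hi => hf i (by simp [hi]))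

theorem PowerBound.of_le_rpow {K a b : ℝ} (ha : -M ≤ a) (ha' : a ≤ A₁) (hb : -M ≤ b)
    (hb' : b ≤ A₂) (h : ∀ X Y : ℝ, 0 < X → 0 < Y → ‖f X Y‖ ≤ K * (X ^ a * Y ^ b)) :
    PowerBound M A₁ A₂ f := by
  refine ⟨|K|, fun X Y hX hY => (h X Y hX hY).trans ?_⟩
  have h1 := rpow_le_rpow_add_rpow hX ha ha'
  have h2 := rpow_le_rpow_add_rpow hY hb hb'
  have h3 := le_abs_self K
  gcongr

end

/-- The double residue series attached to the pair of poles `ν i`, `-ν j`. -/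
noncomputable def pairSeries (ν : Fin 3 → ℂ) (e₁ e₂ : ℕ) (κ₁ κ₂ : ℂ) (X Y : ℝ) (i j : Fin 3) : ℂ :=
  ∑' n : ℕ × ℕ, κ₁ ^ n.1 * κ₂ ^ n.2 * mellinTerm ν e₁ e₂ X Y (ν i - n.1) (-ν j - n.2)

/-- A two-variable kernel whose double residues along the poles `ν i - ℤ`, `-ν j - ℤ` are the
coefficients `C i j`, together with its residues in either variable. -/
structure PairPoles (A₁ A₂ : ℝ) (ν : Fin 3 → ℂ) (N₁ N₂ : Fin 3 → ℤ) (J : Finset (Fin 3))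
    (I : Fin 3 → Finset (Fin 3)) (C : Fin 3 → Fin 3 → ℂ) (κ₁ κ₂ : ℂ) (D D' : Fin 3 → ℂ → ℂ)
    (T : ℂ → ℂ → ℂ) : Prop where
  double : DoublePoles A₁ A₂ J I (fun i => ν i - N₁ i) (fun j => -ν j - N₂ j)
    (fun j i => κ₁ ^ N₁ i * κ₂ ^ N₂ j * C i j) κ₁ κ₂ D T
  row : ∀ j ∈ J, ∀ i ∈ I j, StripPoles (-A₂) {j ∈ J | i ∈ I j} (fun j => -ν j - N₂ j)
    (fun j => κ₂ ^ N₂ j * C i j) κ₂ (D' i)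
  row_decay : ∀ j ∈ J, ∀ i ∈ I j, StripExpDecay (-A₂) (D' i)
  ne : ∀ j ∈ J, ∀ i ∈ I j, i ≠ j
  nonpole : ∀ j ∈ J, ∀ i ∈ I j, ∀ n : ℕ, 1 + n + ν j - ν i ≠ 0

section

variable {M A₁ A₂ η : ℝ} {ν : Fin 3 → ℂ} {N₁ N₂ : Fin 3 → ℤ} {J : Finset (Fin 3)}
  {I : Fin 3 → Finset (Fin 3)} {C : Fin 3 → Fin 3 → ℂ} {κ₁ κ₂ : ℂ} {D D' : Fin 3 → ℂ → ℂ}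
  {T : ℂ → ℂ → ℂ} {e₁ e₂ : ℕ}

theorem pairSeries_eq (hκ₁ : ‖κ₁‖ = 1) (hκ₂ : ‖κ₂‖ = 1) {X Y : ℝ} (hX : 0 < X) (hY : 0 < Y)
    (i j : Fin 3) (N₁ N₂ : ℤ) :
    pairSeries ν e₁ e₂ κ₁ κ₂ X Y i j =
      ∑ b ∈ Finset.range N₂.toNat, ∑ a ∈ Finset.range N₁.toNat,
        κ₁ ^ a * κ₂ ^ b * mellinTerm ν e₁ e₂ X Y (ν i - a) (-ν j - b) +
      ∑ b ∈ Finset.range N₂.toNat, κ₂ ^ b * (κ₁ ^ N₁ * ∑' m : ℕ, κ₁ ^ m *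
        mellinTerm ν e₁ e₂ X Y (ν i - N₁ - m) (-ν j - b)) +
      ∑ a ∈ Finset.range N₁.toNat, κ₁ ^ a * (κ₂ ^ N₂ * ∑' m : ℕ, κ₂ ^ m *
        mellinTerm ν e₁ e₂ X Y (ν i - a) (-ν j - N₂ - m)) +
      κ₁ ^ N₁ * κ₂ ^ N₂ * ∑' m : ℕ × ℕ, κ₁ ^ m.1 * κ₂ ^ m.2 *
        mellinTerm ν e₁ e₂ X Y (ν i - N₁ - m.1) (-ν j - N₂ - m.2) := by
  have h₁ : κ₁ ≠ 0 := by rintro rfl; simp at hκ₁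
  have h₂ : κ₂ ≠ 0 := by rintro rfl; simp at hκ₂
  have := tsum_prod_nat_eq_sum_range_add_tsum
    (u := fun a b => κ₁ ^ a * κ₂ ^ b * mellinTerm ν e₁ e₂ X Y (ν i - a) (-ν j - b))
    (fun a ha b => by simp only [mellinTerm, invGammaProd_sub_int ν i ha]; ring)
    (fun a b hb => by
      have : invGammaProd (-ν) (-ν j - b) = 0 := invGammaProd_sub_int (-ν) j hb
      simp only [mellinTerm, this]; ring)
    (fun a b => by
      refine ((summable_mellinTerm ν e₁ e₂ hX hY hκ₁ hκ₂ (ν i - a) (-ν j - b)).mul_left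
        (κ₁ ^ a * κ₂ ^ b)).congr fun m => ?_
      rw [zpow_add₀ h₁, zpow_add₀ h₂, zpow_natCast, zpow_natCast]
      push_cast
      rw [sub_sub, sub_sub]
      ring) N₁ N₂
  simp only [zpow_natCast, Int.cast_natCast] at this
  rw [pairSeries, this]
  congr 1
  · congr 1
    · congr 1
      refine Finset.sum_congr rfl fun b _ => ?_
      rw [← tsum_mul_left, ← tsum_mul_left]
      refine tsum_congr fun m => ?_
      rw [zpow_add₀ h₁, zpow_natCast]
      push_cast
      rw [sub_sub]
      ring
    · refine Finset.sum_congr rfl fun b _ => ?_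
      rw [← tsum_mul_left, ← tsum_mul_left]
      refine tsum_congr fun m => ?_
      rw [zpow_add₀ h₂, zpow_natCast]
      push_cast
      rw [sub_sub (-ν j)]
      ring
  · rw [← tsum_mul_left]
    refine tsum_congr fun m => ?_
    rw [zpow_add₀ h₁, zpow_add₀ h₂, zpow_natCast, zpow_natCast]
    push_cast
    rw [sub_sub, sub_sub]
    ring

theorem powerBound_mellinTerm {s₁ s₂ : ℂ} (h₁ : -M ≤ -s₁.re) (h₁' : -s₁.re ≤ A₁)
    (h₂ : -M ≤ -s₂.re) (h₂' : -s₂.re ≤ A₂) :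
    PowerBound M A₁ A₂ (fun X Y => mellinTerm ν e₁ e₂ X Y s₁ s₂) := by
  refine PowerBound.of_le_rpow (K := ‖(1 - s₁) ^ e₁ * (1 - s₂) ^ e₂ * invGammaProd ν s₁ *
    invGammaProd (-ν) s₂ * Complex.Gamma (1 - s₁ - s₂)‖) h₁ h₁' h₂ h₂' fun X Y hX hY => ?_
  rw [← norm_cpow_neg hX, ← norm_cpow_neg hY, ← norm_mul, ← norm_mul, mellinTerm]
  exact le_of_eq (congrArg norm (by ring))

theorem PairPoles.powerBound (h : PairPoles A₁ A₂ ν N₁ N₂ J I C κ₁ κ₂ D D' T) (hA₁ : 0 < A₁)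
    (hA₂ : 0 < A₂) (hη : 0 < η) (he₁ : 2 * A₁ - A₂ = e₁ + η) (he₂ : 2 * A₂ - A₁ = e₂ + η)
    (hν : ∑ k, ν k = 0) (hκ₁ : ‖κ₁‖ = 1) (hκ₂ : ‖κ₂‖ = 1)
    (hns : ∀ (k : Fin 3) (n : ℕ), 1 + A₂ - (ν k).re + n ≠ 0) (hM : 0 ≤ M)
    (hre : ∀ j ∈ J, ∀ i ∈ I j, (ν i).re ≤ M ∧ -M ≤ (ν j).re) :
    PowerBound M A₁ A₂ (fun X Y =>
      ∑ j ∈ J, ∑ i ∈ I j, C i j * pairSeries ν e₁ e₂ κ₁ κ₂ X Y i j) := by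
  have hswap : ∀ f : Fin 3 → Fin 3 → ℂ, ∑ j ∈ J, ∑ i ∈ I j, f i j =
      ∑ i, ∑ j ∈ J with i ∈ I j, f i j := fun f =>
    Finset.sum_comm' (by simp)
  have hp : ∀ j ∈ J, ∀ i ∈ I j, -A₁ - 1 < (ν i).re - N₁ i ∧ (ν i).re - N₁ i < -A₁ :=
    fun j hj i hi => by simpa using (h.double.fst j hj).mem i hi
  have hq : ∀ j ∈ J, -A₂ - 1 < -(ν j).re - N₂ j ∧ -(ν j).re - N₂ j < -A₂ :=
    fun j hj => by simpa using (h.double.snd (-A₁ : ℝ) (by simp)).mem j hj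
  have hlt : ∀ {N : ℤ} {a : ℕ}, a ∈ Finset.range N.toNat → (a : ℝ) + 1 ≤ N := by
    intro N a ha
    have := Finset.mem_range.1 ha
    have : (a : ℤ) + 1 ≤ N := by omega
    exact_mod_cast this
  have LL : PowerBound M A₁ A₂ (fun X Y => ∑ j ∈ J, ∑ i ∈ I j,
      ∑ b ∈ Finset.range (N₂ j).toNat, ∑ a ∈ Finset.range (N₁ i).toNat,
        C i j * (κ₁ ^ a * κ₂ ^ b) * mellinTerm ν e₁ e₂ X Y (ν i - a) (-ν j - b)) := by
    refine .sum fun j hj => .sum fun i hi => .sum fun b hb => .sum fun a ha => ?_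
    have ha := hlt ha
    have hb := hlt hb
    have ha0 : (0 : ℝ) ≤ a := a.cast_nonneg
    have hb0 : (0 : ℝ) ≤ b := b.cast_nonneg
    have r := hre j hj i hi
    have p := hp j hj i hi
    have q := hq j hj
    refine (powerBound_mellinTerm ?_ ?_ ?_ ?_).const_mul _ <;> simp <;> linarith
  have HL : PowerBound M A₁ A₂ (fun X Y => ∑ j ∈ J, ∑ b ∈ Finset.range (N₂ j).toNat,
      (κ₂ ^ b * (κ₂ ^ N₂ j)⁻¹) * ∑ i ∈ I j, (κ₁ ^ N₁ i * κ₂ ^ N₂ j * C i j) * ∑' m : ℕ, κ₁ ^ m *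
        mellinTerm ν e₁ e₂ X Y (ν i - N₁ i - m) (-ν j - b)) := by
    refine .sum fun j hj => .sum fun b hb => .const_mul ?_ _
    rcases (I j).eq_empty_or_nonempty with hI | ⟨i, hi⟩
    · simpa [hI] using PowerBound.zero
    have hb := hlt hb
    have hb0 : (0 : ℝ) ≤ b := b.cast_nonneg
    have r := hre j hj i hi
    have q := hq j hj
    obtain ⟨K, hK⟩ := (h.double.fst j hj).norm_tsum_mellinTerm_le hA₁ hκ₁ (h.double.fst_decay j hj)
      hν j (h.ne j hj) (h.nonpole j hj) b e₁ e₂ (by linarith)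
    exact .of_le_rpow (by linarith) le_rfl (by linarith) (by linarith) hK
  have LH : PowerBound M A₁ A₂ (fun X Y => ∑ i, ∑ a ∈ Finset.range (N₁ i).toNat,
      κ₁ ^ a * ∑ j ∈ J with i ∈ I j, (κ₂ ^ N₂ j * C i j) * ∑' m : ℕ, κ₂ ^ m *
        mellinTerm ν e₁ e₂ X Y (ν i - a) (-ν j - N₂ j - m)) := by
    refine .sum fun i _ => .sum fun a ha => .const_mul ?_ _
    rcases Finset.eq_empty_or_nonempty {j ∈ J | i ∈ I j} with hJ | ⟨j, hj⟩
    · simpa [hJ] using PowerBound.zero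
    obtain ⟨hj, hi⟩ := Finset.mem_filter.1 hj
    have ha := hlt ha
    have ha0 : (0 : ℝ) ≤ a := a.cast_nonneg
    have r := hre j hj i hi
    have p := hp j hj i hi
    obtain ⟨K, hK⟩ := StripPoles.norm_tsum_mellinTerm_le (ν := -ν) (h.row j hj i hi) hA₂ hκ₂
      (h.row_decay j hj i hi) (by simp [hν]) i
      (fun j hj => ((h.ne j (Finset.mem_filter.1 hj).1 i (Finset.mem_filter.1 hj).2)).symm)
      (fun j hj n => by
        have := h.nonpole j (Finset.mem_filter.1 hj).1 i (Finset.mem_filter.1 hj).2 n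
        simp only [Pi.neg_apply]
        contrapose! this
        rw [← this]; ring) a e₂ e₁ (by simp; linarith)
    refine .of_le_rpow (K := K) (a := -(ν i).re + a) (by linarith) (by linarith) (by linarith)
      le_rfl fun X Y hX hY => ?_
    have := hK Y X hY hX
    simp only [Pi.neg_apply, neg_neg, mellinTerm_swap, Complex.neg_re] at this
    rwa [mul_comm (X ^ _)]
  have HH : PowerBound M A₁ A₂ (fun X Y => ∑ j ∈ J, ∑ i ∈ I j,
      (κ₁ ^ N₁ i * κ₂ ^ N₂ j * C i j) * ∑' m : ℕ × ℕ, κ₁ ^ m.1 * κ₂ ^ m.2 *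
        mellinTerm ν e₁ e₂ X Y (ν i - N₁ i - m.1) (-ν j - N₂ j - m.2)) := by
    obtain ⟨K, hK⟩ := h.double.norm_tsum_le hA₁ hA₂ hη he₁ he₂ hν hκ₁ hκ₂ hns
    exact .of_le_rpow (by linarith) le_rfl (by linarith) le_rfl hK
  obtain ⟨K, hK⟩ := ((LL.add HL).add LH).add HH
  refine ⟨K, fun X Y hX hY => ?_⟩
  convert hK X Y hX hY using 2
  have h₂ : κ₂ ≠ 0 := by rintro rfl; simp at hκ₂
  have eHL : ∀ j, (∑ b ∈ Finset.range (N₂ j).toNat,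
      (κ₂ ^ b * (κ₂ ^ N₂ j)⁻¹) * ∑ i ∈ I j, (κ₁ ^ N₁ i * κ₂ ^ N₂ j * C i j) * ∑' m : ℕ, κ₁ ^ m *
        mellinTerm ν e₁ e₂ X Y (ν i - N₁ i - m) (-ν j - b)) =
      ∑ i ∈ I j, C i j * ∑ b ∈ Finset.range (N₂ j).toNat, κ₂ ^ b * (κ₁ ^ N₁ i * ∑' m : ℕ, κ₁ ^ m *
        mellinTerm ν e₁ e₂ X Y (ν i - N₁ i - m) (-ν j - b)) := by
    intro j
    simp only [Finset.mul_sum]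
    rw [Finset.sum_comm]
    refine Finset.sum_congr rfl fun i _ => Finset.sum_congr rfl fun b _ => ?_
    have : κ₂ ^ N₂ j ≠ 0 := zpow_ne_zero _ h₂
    field_simp
  have eLH : ∀ i, (∑ a ∈ Finset.range (N₁ i).toNat,
      κ₁ ^ a * ∑ j ∈ J with i ∈ I j, (κ₂ ^ N₂ j * C i j) * ∑' m : ℕ, κ₂ ^ m *
        mellinTerm ν e₁ e₂ X Y (ν i - a) (-ν j - N₂ j - m)) =
      ∑ j ∈ J with i ∈ I j, C i j * ∑ a ∈ Finset.range (N₁ i).toNat, κ₁ ^ a *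
        (κ₂ ^ N₂ j * ∑' m : ℕ, κ₂ ^ m *
          mellinTerm ν e₁ e₂ X Y (ν i - a) (-ν j - N₂ j - m)) := by
    intro i
    simp only [Finset.mul_sum]
    rw [Finset.sum_comm]
    refine Finset.sum_congr rfl fun j _ => Finset.sum_congr rfl fun a _ => ?_
    ring
  simp only [eHL, eLH, ← hswap]
  rw [← Finset.sum_add_distrib, ← Finset.sum_add_distrib, ← Finset.sum_add_distrib]
  refine Finset.sum_congr rfl fun j _ => ?_
  rw [← Finset.sum_add_distrib, ← Finset.sum_add_distrib, ← Finset.sum_add_distrib]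
  refine Finset.sum_congr rfl fun i _ => ?_
  rw [pairSeries_eq hκ₁ hκ₂ hX hY i j (N₁ i) (N₂ j)]
  simp only [mul_add, Finset.mul_sum]
  congr 1
  · congr 2
    exact Finset.sum_congr rfl fun b _ => Finset.sum_congr rfl fun a _ => by ring
  · ring

end

/-- The function `π / sin (π (s - a))`, with simple poles at `a + ℤ`. -/
noncomputable def sinPole (a s : ℂ) : ℂ := Real.pi / Complex.sin (Real.pi * (s - a))

theorem sin_pi_mul_eq_zero_iff (z : ℂ) : Complex.sin (Real.pi * z) = 0 ↔ ∃ n : ℤ, z = n := by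
  have hpi : (Real.pi : ℂ) ≠ 0 := by exact_mod_cast Real.pi_ne_zero
  rw [Complex.sin_eq_zero_iff]
  refine exists_congr fun n => ⟨fun h => mul_left_cancel₀ hpi (by rw [h]; ring), fun h => ?_⟩
  rw [h]; ring

theorem sin_pi_sub_one (z : ℂ) : Complex.sin (Real.pi * (z - 1)) = -Complex.sin (Real.pi * z) := by
  rw [mul_sub, mul_one, Complex.sin_sub_pi]

theorem sinPole_sub_one (a s : ℂ) : sinPole a (s - 1) = -sinPole a s := by
  rw [sinPole, sinPole, sub_right_comm, sin_pi_sub_one, div_neg]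

theorem sin_pi_sub_ne_zero {a s : ℂ} (h : ∀ n : ℤ, s - a ≠ n) :
    Complex.sin (Real.pi * (s - a)) ≠ 0 := fun h0 => by
  obtain ⟨n, hn⟩ := (sin_pi_mul_eq_zero_iff _).1 h0
  exact h n hn

theorem differentiableAt_sinPole {a s : ℂ} (h : ∀ n : ℤ, s - a ≠ n) :
    DifferentiableAt ℂ (sinPole a) s := by
  unfold sinPole
  exact DifferentiableAt.div (by fun_prop) (by fun_prop) (sin_pi_sub_ne_zero h)

theorem tendsto_sub_mul_sinPole (a : ℂ) :
    Filter.Tendsto (fun s => (s - a) * sinPole a s) (nhdsWithin a {a}ᶜ) (nhds 1) := by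
  have hd : HasDerivAt (fun s : ℂ => Complex.sin (Real.pi * (s - a))) (Real.pi : ℂ) a := by
    have := (((hasDerivAt_id a).sub_const a).const_mul (Real.pi : ℂ)).csin
    simpa using this
  have hpi : (Real.pi : ℂ) ≠ 0 := by exact_mod_cast Real.pi_ne_zero
  have := (hasDerivAt_iff_tendsto_slope.1 hd).inv₀ hpi |>.const_mul (Real.pi : ℂ)
  rw [mul_inv_cancel₀ hpi] at this
  refine this.congr fun s => ?_
  rw [slope_def_field, sinPole]
  simp [div_eq_mul_inv]
  ring

theorem norm_sin_le_exp (z : ℂ) : ‖Complex.sin z‖ ≤ Real.exp |z.im| := by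
  have h1 : ‖Complex.exp (-z * Complex.I)‖ ≤ Real.exp |z.im| := by
    rw [Complex.norm_exp, Real.exp_le_exp]; simpa using le_abs_self z.im
  have h2 : ‖Complex.exp (z * Complex.I)‖ ≤ Real.exp |z.im| := by
    rw [Complex.norm_exp, Real.exp_le_exp]; simpa using neg_le_abs z.im
  rw [Complex.sin, norm_div, norm_mul, Complex.norm_I, mul_one, Complex.norm_ofNat]
  have := norm_sub_le (Complex.exp (-z * Complex.I)) (Complex.exp (z * Complex.I))
  linarith

theorem exp_le_four_mul_norm_sin {z : ℂ} (hz : 1 ≤ |z.im|) :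
    Real.exp |z.im| ≤ 4 * ‖Complex.sin z‖ := by
  have h3 : (2 : ℝ) ≤ Real.exp |z.im| := by linarith [Real.add_one_le_exp |z.im|]
  have h4 : Real.exp (-|z.im|) ≤ 1 := by rw [Real.exp_le_one_iff]; linarith
  have h1 : ‖Complex.exp (-z * Complex.I)‖ = Real.exp z.im := by
    rw [Complex.norm_exp]; simp
  have h2 : ‖Complex.exp (z * Complex.I)‖ = Real.exp (-z.im) := by
    rw [Complex.norm_exp]; simp
  rw [Complex.sin, norm_div, norm_mul, Complex.norm_I, mul_one, Complex.norm_ofNat]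
  rcases le_total 0 z.im with h | h
  · rw [abs_of_nonneg h] at *
    have := norm_sub_norm_le (Complex.exp (-z * Complex.I)) (Complex.exp (z * Complex.I))
    linarith
  · rw [abs_of_nonpos h] at *
    rw [neg_neg] at h4
    have := norm_sub_norm_le (Complex.exp (z * Complex.I)) (Complex.exp (-z * Complex.I))
    rw [norm_sub_rev] at this
    linarith

theorem abs_sin_mul_exp_le (z : ℂ) :
    |Real.sin z.re| * Real.exp |z.im| ≤ 2 * ‖Complex.sin z‖ := by
  have h := Complex.abs_re_le_norm (Complex.sin z)
  rw [Complex.sin_eq] at h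
  have e : (Complex.sin z.re * Complex.cosh z.im + Complex.cos z.re * Complex.sinh z.im *
      Complex.I).re = Real.sin z.re * Real.cosh z.im := by
    rw [← Complex.ofReal_sin, ← Complex.ofReal_cosh, ← Complex.ofReal_cos, ← Complex.ofReal_sinh,
      ← Complex.ofReal_mul, ← Complex.ofReal_mul, Complex.add_re, Complex.ofReal_re,
      Complex.re_ofReal_mul, Complex.I_re, mul_zero, add_zero]
  rw [e, abs_mul, abs_of_pos (Real.cosh_pos _), ← Complex.sin_eq] at h
  have h2 : Real.exp |z.im| ≤ 2 * Real.cosh z.im := by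
    rw [← Real.cosh_abs, Real.cosh_eq]
    linarith [Real.exp_pos (-|z.im|)]
  nlinarith [abs_nonneg (Real.sin z.re)]

theorem norm_sinPole_le {a : ℂ} {σ : ℝ} (h : ∀ n : ℤ, σ - a.re ≠ n) :
    ∃ C T₀ : ℝ, 0 ≤ C ∧ ∀ s : ℂ, (T₀ ≤ |s.im| ∨ s.re = σ ∨ s.re = σ - 1) →
      ‖sinPole a s‖ ≤ C * Real.exp (-(Real.pi * |s.im|)) := by
  have hpi := Real.pi_pos
  set c := |Real.sin (Real.pi * (σ - a.re))| with hc
  have hc0 : 0 < c := by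
    rw [hc, abs_pos]
    intro h0
    obtain ⟨n, hn⟩ := Real.sin_eq_zero_iff.1 h0
    exact h n (mul_left_cancel₀ hpi.ne' (by rw [← hn]; ring))
  have hre : ∀ s : ℂ, ((Real.pi : ℂ) * (s - a)).re = Real.pi * (s.re - a.re) := by simp
  have him : ∀ s : ℂ, ((Real.pi : ℂ) * (s - a)).im = Real.pi * (s.im - a.im) := by simp
  set E := Real.exp (Real.pi * |a.im|)
  have key : ∀ s : ℂ, ∀ b : ℝ, 0 < b → b * Real.exp |((Real.pi : ℂ) * (s - a)).im| ≤
      ‖Complex.sin (Real.pi * (s - a))‖ →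
      ‖sinPole a s‖ ≤ Real.pi / b * E * Real.exp (-(Real.pi * |s.im|)) := by
    intro s b hb hs
    rw [sinPole, norm_div, Complex.norm_real, Real.norm_of_nonneg hpi.le]
    have h1 : Real.exp (Real.pi * |s.im|) ≤ E * Real.exp |((Real.pi : ℂ) * (s - a)).im| := by
      rw [← Real.exp_add, Real.exp_le_exp, him, abs_mul, abs_of_pos hpi, ← mul_add]
      gcongr
      have := abs_add_le a.im (s.im - a.im)
      rwa [add_sub_cancel] at this
    have h2 : 0 < b * Real.exp |((Real.pi : ℂ) * (s - a)).im| := by positivity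
    refine (div_le_div_of_nonneg_left hpi.le h2 hs).trans ?_
    rw [Real.exp_neg, div_le_iff₀ h2]
    have h3 := Real.exp_pos (Real.pi * |s.im|)
    calc Real.pi = Real.pi * (Real.exp (Real.pi * |s.im|))⁻¹ * Real.exp (Real.pi * |s.im|) := by
          field_simp
      _ ≤ Real.pi * (Real.exp (Real.pi * |s.im|))⁻¹ *
          (E * Real.exp |((Real.pi : ℂ) * (s - a)).im|) := by gcongr
      _ = _ := by field_simp
  refine ⟨max (Real.pi / (1 / 4) * E) (Real.pi / (c / 2) * E), |a.im| + 1, by positivity,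
    fun s hs => ?_⟩
  rcases hs with hs | hs
  · refine (key s (1 / 4) (by norm_num) ?_).trans (by gcongr; exact le_max_left _ _)
    have : 1 ≤ |((Real.pi : ℂ) * (s - a)).im| := by
      rw [him, abs_mul, abs_of_pos hpi]
      have := abs_sub_abs_le_abs_sub s.im a.im
      nlinarith [Real.pi_gt_three]
    linarith [exp_le_four_mul_norm_sin this]
  · refine (key s (c / 2) (by positivity) ?_).trans (by gcongr; exact le_max_right _ _)
    have h5 := abs_sin_mul_exp_le (Real.pi * (s - a))
    have h6 : |Real.sin ((Real.pi : ℂ) * (s - a)).re| = c := by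
      rw [hre, hc]
      rcases hs with hs | hs
      · rw [hs]
      · rw [hs, show Real.pi * (σ - 1 - a.re) = Real.pi * (σ - a.re) - Real.pi by ring,
          Real.sin_sub_pi, abs_neg]
    rw [h6] at h5
    linarith

theorem norm_prod_sinPole_le {ν : Fin 3 → ℂ} {S : Finset (Fin 3)} {σ : ℝ}
    (h : ∀ i ∈ S, ∀ n : ℤ, σ - (ν i).re ≠ n) :
    ∃ C T₀ : ℝ, 0 ≤ C ∧ ∀ s : ℂ, (T₀ ≤ |s.im| ∨ s.re = σ ∨ s.re = σ - 1) →
      ‖∏ i ∈ S, sinPole (ν i) s‖ ≤ C * Real.exp (-(S.card * (Real.pi * |s.im|))) := by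
  induction S using Finset.induction_on with
  | empty => exact ⟨1, 0, zero_le_one, fun s _ => by simp⟩
  | insert a S ha ih =>
    obtain ⟨C, T, hC, hC'⟩ := ih fun i hi => h i (by simp [hi])
    obtain ⟨B, U, hB, hB'⟩ := norm_sinPole_le (h a (by simp))
    refine ⟨B * C, max T U, by positivity, fun s hs => ?_⟩
    have h1 := hC' s (hs.imp_left fun h => (le_max_left _ _).trans h)
    have h2 := hB' s (hs.imp_left fun h => (le_max_right _ _).trans h)
    rw [Finset.prod_insert ha, norm_mul, Finset.card_insert_of_notMem ha]
    refine (mul_le_mul h2 h1 (norm_nonneg _) (by positivity)).trans (le_of_eq ?_)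
    rw [mul_mul_mul_comm, ← Real.exp_add]
    congr 2
    push_cast
    ring

theorem stripExpDecay_prod_sinPole {ν : Fin 3 → ℂ} {S : Finset (Fin 3)} (hS : S.Nonempty) {σ : ℝ}
    (h : ∀ i ∈ S, ∀ n : ℤ, σ - (ν i).re ≠ n) (c : ℂ) :
    StripExpDecay σ (fun s => c * ∏ i ∈ S, sinPole (ν i) s) := by
  obtain ⟨C, T₀, hC, hb⟩ := norm_prod_sinPole_le h
  refine ⟨‖c‖ * C, T₀, by positivity, fun s _ _ hs => ?_⟩
  rw [norm_mul, mul_assoc]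
  have h1 : (1 : ℝ) ≤ S.card := by exact_mod_cast hS.card_pos
  have h2 : 0 ≤ Real.pi * |s.im| := by positivity
  gcongr
  refine (hb s hs).trans (mul_le_mul_of_nonneg_left (Real.exp_le_exp.2 ?_) hC)
  nlinarith

theorem stripPoles_mul_prod_sinPole {ν : Fin 3 → ℂ} {S : Finset (Fin 3)} {σ : ℝ} {N : Fin 3 → ℤ}
    {κ ρ : ℂ} {g : ℂ → ℂ} {l : Fin 3 → ℂ} (hg : Differentiable ℂ g)
    (hgp : ∀ s, g (s - 1) = ρ * g s)
    (hκ : κ = ρ * (-1) ^ S.card) (hκ0 : κ ≠ 0)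
    (hS : ∀ i ∈ S, ∀ k ∈ S, i ≠ k → ∀ n : ℤ, ν i - ν k ≠ n)
    (hN : ∀ i ∈ S, σ - 1 < (ν i).re - N i ∧ (ν i).re - N i < σ)
    (hl : ∀ i ∈ S, l i = κ ^ N i * (g (ν i) * ∏ k ∈ S.erase i, sinPole (ν k) (ν i))) :
    StripPoles σ S (fun i => ν i - N i) l κ (fun s => g s * ∏ i ∈ S, sinPole (ν i) s) := by
  have hper : ∀ s, g (s - 1) * ∏ i ∈ S, sinPole (ν i) (s - 1) =
      κ * (g s * ∏ i ∈ S, sinPole (ν i) s) := by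
    intro s
    simp only [sinPole_sub_one, hgp, Finset.prod_neg, hκ]
    ring
  have hperN : ∀ (n : ℤ) s, g (s - n) * ∏ i ∈ S, sinPole (ν i) (s - n) =
      κ ^ n * (g s * ∏ i ∈ S, sinPole (ν i) s) := by
    intro n
    induction n using Int.induction_on with
    | zero => simp
    | succ n ih =>
      intro s
      have := ih (s - 1)
      rw [show s - ((n + 1 : ℤ) : ℂ) = s - 1 - (n : ℤ) by push_cast; ring, this, hper,
        zpow_add_one₀ hκ0, mul_assoc]
    | pred n ih =>
      intro s
      have := ih (s + 1)
      have h2 := hper (s + 1)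
      rw [add_sub_cancel_right] at h2
      rw [show s - ((-n - 1 : ℤ) : ℂ) = s + 1 - (-n : ℤ) by push_cast; ring, this, h2,
        zpow_sub_one₀ hκ0, ← mul_assoc, ← mul_assoc, ← mul_assoc, inv_mul_cancel_right₀ hκ0]
  refine ⟨hper, fun i hi k hk hik => ?_, fun i hi => by simpa using hN i hi, fun s h1 h2 h3 => ?_,
    fun i hi => ?_⟩
  · by_contra hne
    refine hS i hi k hk hne (N i - N k) ?_
    push_cast
    linear_combination hik
  · refine (hg s).mul (DifferentiableAt.fun_finsetProd fun i hi => differentiableAt_sinPole ?_)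
    intro n hn
    have hre : s.re = (ν i).re + n := by
      have := congrArg Complex.re hn
      simp at this
      linarith
    obtain ⟨g1, g2⟩ := hN i hi
    have h4 : n = -N i := by
      have a1 : (-1 : ℝ) < n + N i := by linarith
      have a2 : (n : ℝ) + N i < 1 := by linarith
      have a1' : -1 < n + N i := by exact_mod_cast a1
      have a2' : n + N i < 1 := by exact_mod_cast a2
      omega
    apply h3 i hi
    rw [h4] at hn
    push_cast at hn
    linear_combination hn
  · have hcont : Filter.Tendsto (fun s => g s * ∏ k ∈ S.erase i, sinPole (ν k) s)
        (nhdsWithin (ν i) {ν i}ᶜ) (nhds (g (ν i) * ∏ k ∈ S.erase i, sinPole (ν k) (ν i))) := by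
      refine Filter.Tendsto.mono_left ?_ nhdsWithin_le_nhds
      refine ContinuousAt.tendsto (f := fun s => g s * ∏ k ∈ S.erase i, sinPole (ν k) s)
        (DifferentiableAt.continuousAt ((hg _).mul (DifferentiableAt.fun_finsetProd fun k hk =>
          differentiableAt_sinPole ?_)) )
      obtain ⟨hki, hk⟩ := Finset.mem_erase.1 hk
      exact hS i hi k hk hki.symm
    have hmain := ((tendsto_sub_mul_sinPole (ν i)).mul hcont).const_mul (κ ^ N i)
    rw [one_mul, ← hl i hi] at hmain
    have hshift : Filter.Tendsto (fun s : ℂ => s + N i) (nhdsWithin (ν i - N i) {ν i - (N i : ℂ)}ᶜ)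
        (nhdsWithin (ν i) {ν i}ᶜ) := by
      refine tendsto_nhdsWithin_of_tendsto_nhds_of_eventually_within _ ?_ ?_
      · refine Filter.Tendsto.mono_left ?_ nhdsWithin_le_nhds
        have : Continuous fun s : ℂ => s + N i := by fun_prop
        simpa using this.tendsto (ν i - N i)
      · filter_upwards [self_mem_nhdsWithin] with s hs h
        exact hs (by
          simp only [Set.mem_singleton_iff] at h ⊢
          rw [← h]; ring)
    refine (hmain.comp hshift).congr fun s => ?_
    have := hperN (N i) (s + N i)
    rw [add_sub_cancel_right] at this
    simp only [Function.comp]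
    rw [this, ← Finset.mul_prod_erase S _ hi]
    ring

theorem exists_int_sub_mem_strip {x A : ℝ} (h : ∀ n : ℤ, x + A ≠ n) :
    ∃ N : ℤ, -A - 1 < x - N ∧ x - N < -A := by
  refine ⟨⌊x + A⌋ + 1, ?_, ?_⟩
  · have h1 := (Int.floor_le (x + A)).lt_of_ne (h _).symm
    push_cast
    linarith
  · have h1 := Int.lt_floor_add_one (x + A)
    push_cast
    linarith

theorem powerBound_of_sinPole {M A₁ A₂ η : ℝ} {ν : Fin 3 → ℂ} {J I₀ : Finset (Fin 3)}
    {I : Fin 3 → Finset (Fin 3)} {C : Fin 3 → Fin 3 → ℂ} {κ₁ κ₂ : ℂ} {d d' : Fin 3 → ℂ}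
    {r e₁ e₂ : ℕ} (hA₁ : 0 < A₁)
    (hA₂ : 0 < A₂) (hη : 0 < η) (he₁ : 2 * A₁ - A₂ = e₁ + η) (he₂ : 2 * A₂ - A₁ = e₂ + η)
    (hν : ∑ k, ν k = 0) (hM : 0 ≤ M)
    (hre : ∀ j ∈ J, ∀ i ∈ I j, (ν i).re ≤ M ∧ -M ≤ (ν j).re)
    (hgen₁ : ∀ (k : Fin 3) (n : ℤ), (ν k).re + A₁ ≠ n)
    (hgen₂ : ∀ (k : Fin 3) (n : ℤ), -(ν k).re + A₂ ≠ n)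
    (hne : ∀ j ∈ J, ∀ i ∈ I j, i ≠ j)
    (hnp : ∀ j ∈ J, ∀ i ∈ I j, ∀ n : ℕ, 1 + n + ν j - ν i ≠ 0)
    (hI : ∀ j ∈ J, (I j).Nonempty)
    (hIS : ∀ j ∈ J, ∀ i ∈ I j, ∀ k ∈ I j, i ≠ k → ∀ n : ℤ, ν i - ν k ≠ n)
    (hJS : ∀ i ∈ J, ∀ k ∈ J, i ≠ k → ∀ n : ℤ, ν i - ν k ≠ n)
    (hκ₁ : ∀ j ∈ J, κ₁ = (-1) ^ (I j).card)
    (hκ₂' : ∀ j ∈ J, ∀ i ∈ I j, κ₂ = (-1) ^ (J.filter fun j => i ∈ I j).card)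
    (hκ₂ : κ₂ = (-1) ^ r * (-1) ^ J.card)
    (hκ₁n : ‖κ₁‖ = 1)
    (hdec : ∀ t₁ t₂ : ℝ, (r : ℝ) * |t₁ + t₂| - I₀.card * |t₁| - J.card * |t₂| ≤
      -(3 / 2) * (|t₁| + |t₂|) + 1 / 2 * |t₁ + t₂|)
    (hC : ∀ j ∈ J, ∀ i ∈ I j, C i j = d j * ∏ k ∈ (I j).erase i, sinPole (ν k) (ν i))
    (hC' : ∀ j ∈ J, ∀ i ∈ I j, C i j =
      d' i * ∏ k ∈ (J.filter fun j => i ∈ I j).erase j, sinPole (-ν k) (-ν j))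
    (hres : ∀ s : ℂ, (∀ (k : Fin 3) (n : ℤ), s - ν k ≠ n) → ∀ j ∈ J,
      (Complex.sin (Real.pi * (s - ν j)) / Real.pi) ^ r * (∏ i ∈ I₀, sinPole (ν i) s) *
        ∏ k ∈ J.erase j, sinPole (-ν k) (-ν j) = d j * ∏ i ∈ I j, sinPole (ν i) s) :
    PowerBound M A₁ A₂ (fun X Y =>
      ∑ j ∈ J, ∑ i ∈ I j, C i j * pairSeries ν e₁ e₂ κ₁ κ₂ X Y i j) := by
  choose N₁ hN₁ using fun k => exists_int_sub_mem_strip (hgen₁ k)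
  choose N₂ hN₂ using fun k => exists_int_sub_mem_strip (hgen₂ k)
  have hκ₂n : ‖κ₂‖ = 1 := by rw [hκ₂, norm_mul, norm_pow, norm_pow, norm_neg, norm_one]; simp
  have h₁0 : κ₁ ≠ 0 := by rintro rfl; simp at hκ₁n
  have h₂0 : κ₂ ≠ 0 := by rintro rfl; simp at hκ₂n
  have hg₁ : ∀ (k : Fin 3) (n : ℤ), -A₁ - (ν k).re ≠ n := fun k n h =>
    hgen₁ k (-n) (by push_cast; linarith)
  have hg₂ : ∀ (k : Fin 3) (n : ℤ), -A₂ - (-ν k).re ≠ n := fun k n h =>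
    hgen₂ k (-n) (by simp only [Complex.neg_re] at h; push_cast; linarith)
  have hJneg : ∀ i ∈ J, ∀ k ∈ J, i ≠ k → ∀ n : ℤ, -ν i - -ν k ≠ n := fun i hi k hk hik n h =>
    hJS i hi k hk hik (-n) (by push_cast; linear_combination -h)
  have hline : ∀ s : ℂ, s.re = -A₁ → ∀ (k : Fin 3) (n : ℤ), s - ν k ≠ n := fun s hs k n h => by
    have := congrArg Complex.re h
    simp only [Complex.sub_re, hs, Complex.intCast_re] at this
    exact hg₁ k n this
  have hN₂' : ∀ j, -A₂ - 1 < (-ν j).re - N₂ j ∧ (-ν j).re - N₂ j < -A₂ := hN₂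
  set V : ℂ → ℂ := fun s => (Complex.sin (Real.pi * s) / Real.pi) ^ r with hV
  have hVp : ∀ s, V (s - 1) = (-1) ^ r * V s := fun s => by
    simp only [hV]
    rw [sin_pi_sub_one, ← mul_pow]; ring
  have hVn : ∀ s, ‖V s‖ ≤ Real.exp (Real.pi * (r * |s.im|)) := fun s => by
    have h1 : ‖Complex.sin (Real.pi * s) / Real.pi‖ ≤ Real.exp (Real.pi * |s.im|) := by
      rw [norm_div, Complex.norm_real, Real.norm_of_nonneg Real.pi_pos.le]
      refine (div_le_self (norm_nonneg _) (by linarith [Real.pi_gt_three])).trans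
        ((norm_sin_le_exp _).trans (le_of_eq ?_))
      rw [Complex.im_ofReal_mul, abs_mul, abs_of_pos Real.pi_pos]
    refine (le_of_eq (norm_pow _ _)).trans ((pow_le_pow_left₀ (norm_nonneg _) h1 r).trans
      (le_of_eq ?_))
    rw [← Real.exp_nat_mul]; ring_nf
  set T : ℂ → ℂ → ℂ := fun s₁ s₂ =>
    (V (s₁ + s₂) * ∏ i ∈ I₀, sinPole (ν i) s₁) * ∏ j ∈ J, sinPole (-ν j) s₂ with hT
  have hpair : PairPoles A₁ A₂ ν N₁ N₂ J I C κ₁ κ₂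
      (fun j s => (κ₂ ^ N₂ j * d j) * ∏ i ∈ I j, sinPole (ν i) s)
      (fun i s => d' i * ∏ j ∈ J with i ∈ I j, sinPole (-ν j) s) T := by
    refine ⟨⟨fun j hj => ?_, fun j hj => ?_, fun s₁ hs₁ => ?_, ?_⟩, fun j hj i hi => ?_,
      fun j hj i hi => ?_, hne, hnp⟩
    · refine stripPoles_mul_prod_sinPole (g := fun _ => κ₂ ^ N₂ j * d j) (ρ := 1)
        (differentiable_const _) (fun s => (one_mul _).symm) (by rw [one_mul]; exact hκ₁ j hj)
        h₁0 (hIS j hj) (fun i _ => hN₁ i) fun i hi => ?_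
      rw [hC j hj i hi]; ring
    · exact stripExpDecay_prod_sinPole (hI j hj) (fun i _ => hg₁ i) _
    · refine stripPoles_mul_prod_sinPole (ν := fun j => -ν j)
        (g := fun s₂ => V (s₁ + s₂) * ∏ i ∈ I₀, sinPole (ν i) s₁)
        (ρ := (-1) ^ r) (by simp only [hV]; fun_prop) (fun s => ?_) hκ₂ h₂0 hJneg
        (fun j _ => hN₂' j) fun j hj => ?_
      · rw [← add_sub_assoc, hVp, mul_assoc]
      · have := hres s₁ (hline s₁ hs₁) j hj
        rw [mul_assoc, ← this, hV]
        simp only [sub_eq_add_neg]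
    · obtain ⟨B₁, T₁, hB₁, hb₁⟩ := norm_prod_sinPole_le (ν := ν) (S := I₀) fun i _ => hg₁ i
      obtain ⟨B₂, T₂, hB₂, hb₂⟩ := norm_prod_sinPole_le (ν := fun j => -ν j) (S := J)
        fun i _ => hg₂ i
      refine ⟨B₁ * B₂, T₂, by positivity, fun s₁ s₂ g1 g2 g3 g4 => ?_⟩
      have c1 := hb₁ s₁ (Or.inr (Or.inl g1))
      have c2 := hb₂ s₂ g4
      have c3 := hVn (s₁ + s₂)
      have c4 := hdec s₁.im s₂.im
      rw [hT]
      simp only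
      rw [norm_mul, norm_mul]
      calc _ ≤ Real.exp (Real.pi * (r * |(s₁ + s₂).im|)) *
            (B₁ * Real.exp (-(I₀.card * (Real.pi * |s₁.im|)))) *
            (B₂ * Real.exp (-(J.card * (Real.pi * |s₂.im|)))) := by gcongr
        _ = B₁ * B₂ * Real.exp (Real.pi * (r * |s₁.im + s₂.im| - I₀.card * |s₁.im| -
              J.card * |s₂.im|)) := by
            rw [Complex.add_im, mul_sub, mul_sub, sub_eq_add_neg, sub_eq_add_neg, Real.exp_add,
              Real.exp_add]
            ring_nf
        _ ≤ _ := by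
            gcongr
            have := mul_le_mul_of_nonneg_left c4 Real.pi_pos.le
            linarith
    · refine stripPoles_mul_prod_sinPole (ν := fun j => -ν j) (g := fun _ => d' i) (ρ := 1)
        (differentiable_const _) (fun s => (one_mul _).symm)
        (by rw [one_mul]; exact hκ₂' j hj i hi)
        h₂0 (fun j hj k hk => hJneg j (Finset.mem_filter.1 hj).1 k (Finset.mem_filter.1 hk).1)
        (fun j _ => hN₂' j) fun j hj => ?_
      obtain ⟨hj, hi⟩ := Finset.mem_filter.1 hj
      rw [hC' j hj i hi]
    · exact stripExpDecay_prod_sinPole (ν := fun j => -ν j)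
        ⟨j, Finset.mem_filter.2 ⟨hj, hi⟩⟩ (fun i _ => hg₂ i) _
  refine hpair.powerBound hA₁ hA₂ hη he₁ he₂ hν hκ₁n hκ₂n (fun k n h => ?_) hM hre
  exact hgen₂ k (-(n + 1)) (by push_cast; linarith)

theorem sinPole_neg_neg (a b : ℂ) : sinPole (-a) (-b) = sinPole b a := by
  rw [sinPole, sinPole, show -b - -a = a - b by ring]

theorem sinPole_swap (a b : ℂ) : sinPole b a = -sinPole a b := by
  rw [sinPole, sinPole, show Real.pi * (a - b) = -(Real.pi * (b - a)) by ring, Complex.sin_neg,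
    div_neg]

theorem sinPole_ne_zero {a b : ℂ} (h : ∀ n : ℤ, b - a ≠ n) : sinPole a b ≠ 0 :=
  div_ne_zero (by exact_mod_cast Real.pi_ne_zero) (sin_pi_sub_ne_zero h)

theorem sin_div_pi_mul_sinPole {a s : ℂ} (h : ∀ n : ℤ, s - a ≠ n) :
    Complex.sin (Real.pi * (s - a)) / Real.pi * sinPole a s = 1 := by
  have h1 := sin_pi_sub_ne_zero h
  have hpi : (Real.pi : ℂ) ≠ 0 := by exact_mod_cast Real.pi_ne_zero
  rw [sinPole]
  field_simp

/-- Exponents `A₁, A₂` avoiding the lines of poles attached to `ν`. -/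
structure GenericExponents (M A₁ A₂ η : ℝ) (ν : Fin 3 → ℂ) (e₁ e₂ : ℕ) : Prop where
  pos₁ : 0 < A₁
  pos₂ : 0 < A₂
  pos : 0 < η
  eq₁ : 2 * A₁ - A₂ = e₁ + η
  eq₂ : 2 * A₂ - A₁ = e₂ + η
  sum : ∑ k, ν k = 0
  nonneg : 0 ≤ M
  gen₁ : ∀ (k : Fin 3) (n : ℤ), (ν k).re + A₁ ≠ n
  gen₂ : ∀ (k : Fin 3) (n : ℤ), -(ν k).re + A₂ ≠ n

section

variable {M A₁ A₂ η : ℝ} {ν : Fin 3 → ℂ} {e₁ e₂ : ℕ}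

theorem PowerBound.of_const_mul {f : ℝ → ℝ → ℂ} {c : ℂ} (hc : c ≠ 0)
    (h : PowerBound M A₁ A₂ (fun X Y => c * f X Y)) : PowerBound M A₁ A₂ f := by
  have := h.const_mul c⁻¹
  simpa only [inv_mul_cancel_left₀ hc] using this

theorem GenericExponents.powerBound_column (h : GenericExponents M A₁ A₂ η ν e₁ e₂) {i k j : Fin 3}
    (hik : i ≠ k) (hij : i ≠ j) (hkj : k ≠ j) (hint : ∀ n : ℤ, ν i - ν k ≠ n)
    (hi : ∀ n : ℕ, 1 + n + ν j - ν i ≠ 0) (hk : ∀ n : ℕ, 1 + n + ν j - ν k ≠ 0)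
    (hri : (ν i).re ≤ M) (hrk : (ν k).re ≤ M) (hrj : -M ≤ (ν j).re) :
    PowerBound M A₁ A₂ (fun X Y => pairSeries ν e₁ e₂ 1 (-1) X Y i j -
      pairSeries ν e₁ e₂ 1 (-1) X Y k j) := by
  have hint' : ∀ n : ℤ, ν k - ν i ≠ n := fun n hn => hint (-n) (by
    push_cast; linear_combination -hn)
  have e1 : ({i, k} : Finset (Fin 3)).erase i = {k} := by
    ext x; simp; grind
  have e2 : ({i, k} : Finset (Fin 3)).erase k = {i} := by
    ext x; simp; grind
  have := powerBound_of_sinPole (M := M) (J := {j}) (I₀ := {i, k}) (I := fun _ => {i, k})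
    (C := fun a _ => ∏ b ∈ ({i, k} : Finset (Fin 3)).erase a, sinPole (ν b) (ν a))
    (κ₁ := 1) (κ₂ := -1) (d := fun _ => 1)
    (d' := fun a => ∏ b ∈ ({i, k} : Finset (Fin 3)).erase a, sinPole (ν b) (ν a)) (r := 0)
    h.pos₁ h.pos₂ h.pos h.eq₁ h.eq₂ h.sum h.nonneg (by simp; tauto) h.gen₁ h.gen₂
    (by simp; tauto) (by simp only [Finset.mem_singleton, Finset.mem_insert]; grind)
    (by simp) (by simp only [Finset.mem_singleton, Finset.mem_insert]; grind)
    (by simp only [Finset.mem_singleton]; grind)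
    (by simp [hik]) (by simp only [Finset.mem_singleton, Finset.mem_insert, forall_eq]
                        intro a ha
                        simp [Finset.filter_singleton, ha])
    (by simp) (by simp) (fun t₁ t₂ => by
      simp [hik]
      have h2 := abs_add_le (t₁ + t₂) (-t₁)
      rw [abs_neg, add_neg_cancel_comm] at h2
      linarith)
    (by simp)
    (by simp only [Finset.mem_singleton, Finset.mem_insert, forall_eq]
        intro a ha
        simp [Finset.filter_singleton, ha])
    (by simp)
  simp only [Finset.sum_singleton, Finset.sum_pair hik, e1, e2, Finset.prod_singleton] at this
  refine PowerBound.of_const_mul (sinPole_ne_zero hint) ?_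
  obtain ⟨K, hK⟩ := this
  refine ⟨K, fun X Y hX hY => le_of_eq_of_le (congrArg _ ?_) (hK X Y hX hY)⟩
  rw [sinPole_swap (ν k) (ν i)]
  ring

theorem GenericExponents.powerBound_row (h : GenericExponents M A₁ A₂ η ν e₁ e₂) {i j k : Fin 3}
    (hjk : j ≠ k) (hij : i ≠ j) (hik : i ≠ k) (hint : ∀ n : ℤ, ν j - ν k ≠ n)
    (hj : ∀ n : ℕ, 1 + n + ν j - ν i ≠ 0) (hk : ∀ n : ℕ, 1 + n + ν k - ν i ≠ 0)
    (hri : (ν i).re ≤ M) (hrj : -M ≤ (ν j).re) (hrk : -M ≤ (ν k).re) :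
    PowerBound M A₁ A₂ (fun X Y => pairSeries ν e₁ e₂ (-1) 1 X Y i j -
      pairSeries ν e₁ e₂ (-1) 1 X Y i k) := by
  have hint' : ∀ n : ℤ, ν k - ν j ≠ n := fun n hn => hint (-n) (by
    push_cast; linear_combination -hn)
  have e1 : ({j, k} : Finset (Fin 3)).erase j = {k} := by
    ext x; simp; grind
  have e2 : ({j, k} : Finset (Fin 3)).erase k = {j} := by
    ext x; simp; grind
  have := powerBound_of_sinPole (M := M) (J := {j, k}) (I₀ := {i}) (I := fun _ => {i})
    (C := fun _ a => ∏ b ∈ ({j, k} : Finset (Fin 3)).erase a, sinPole (-ν b) (-ν a))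
    (κ₁ := -1) (κ₂ := 1)
    (d := fun a => ∏ b ∈ ({j, k} : Finset (Fin 3)).erase a, sinPole (-ν b) (-ν a))
    (d' := fun _ => 1) (r := 0)
    h.pos₁ h.pos₂ h.pos h.eq₁ h.eq₂ h.sum h.nonneg (by simp; tauto) h.gen₁ h.gen₂
    (by simp; tauto) (by simp only [Finset.mem_singleton, Finset.mem_insert]; grind)
    (by simp) (by simp only [Finset.mem_singleton]; grind)
    (by simp only [Finset.mem_singleton, Finset.mem_insert]; grind)
    (by simp) (by simp [hjk]) (by simp [hjk]) (by simp) (fun t₁ t₂ => by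
      simp [hjk]
      have h2 := abs_add_le (t₁ + t₂) (-t₂)
      rw [abs_neg, add_neg_cancel_right] at h2
      linarith)
    (by simp) (by simp) (by intros; simp; ring)
  simp only [Finset.sum_singleton, Finset.sum_pair hjk, e1, e2, Finset.prod_singleton,
    sinPole_neg_neg] at this
  refine PowerBound.of_const_mul (sinPole_ne_zero hint') ?_
  obtain ⟨K, hK⟩ := this
  refine ⟨K, fun X Y hX hY => le_of_eq_of_le (congrArg _ ?_) (hK X Y hX hY)⟩
  rw [sinPole_swap (ν j) (ν k)]
  ring

theorem GenericExponents.powerBound_pair (h : GenericExponents M A₁ A₂ η ν e₁ e₂) {i j : Fin 3}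
    (hij : i ≠ j) (hint : ∀ n : ℤ, ν i - ν j ≠ n)
    (hri : |(ν i).re| ≤ M) (hrj : |(ν j).re| ≤ M) :
    PowerBound M A₁ A₂ (fun X Y => pairSeries ν e₁ e₂ (-1) (-1) X Y i j -
      pairSeries ν e₁ e₂ (-1) (-1) X Y j i) := by
  have hint' : ∀ n : ℤ, ν j - ν i ≠ n := fun n hn => hint (-n) (by
    push_cast; linear_combination -hn)
  have hji := hij.symm
  have hi : ∀ n : ℕ, 1 + n + ν j - ν i ≠ 0 := fun n hn => hint (n + 1) (by
    push_cast; linear_combination -hn)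
  have hj : ∀ n : ℕ, 1 + n + ν i - ν j ≠ 0 := fun n hn => hint' (n + 1) (by
    push_cast; linear_combination -hn)
  have e1 : ({i, j} : Finset (Fin 3)).erase i = {j} := by
    ext x; simp; grind
  have e2 : ({i, j} : Finset (Fin 3)).erase j = {i} := by
    ext x; simp; grind
  have f1' : ({i, j} : Finset (Fin 3)).filter (fun b => i ∈ ({i, j} : Finset (Fin 3)).erase b) =
      {j} := by
    ext x; simp; grind
  have f2' : ({i, j} : Finset (Fin 3)).filter (fun b => j ∈ ({i, j} : Finset (Fin 3)).erase b) =
      {i} := by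
    ext x; simp; grind
  obtain ⟨a1, a2⟩ := abs_le.1 hri
  obtain ⟨a3, a4⟩ := abs_le.1 hrj
  have hpair : ∀ P : Fin 3 → Prop, (∀ b ∈ ({i, j} : Finset (Fin 3)), P b) ↔ P i ∧ P j := by simp
  have := powerBound_of_sinPole (M := M) (J := {i, j}) (I₀ := {i, j})
    (I := fun b => ({i, j} : Finset (Fin 3)).erase b)
    (C := fun _ a => ∏ b ∈ ({i, j} : Finset (Fin 3)).erase a, sinPole (-ν b) (-ν a))
    (κ₁ := -1) (κ₂ := -1)
    (d := fun a => ∏ b ∈ ({i, j} : Finset (Fin 3)).erase a, sinPole (-ν b) (-ν a))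
    (d' := fun a => ∏ b ∈ ({i, j} : Finset (Fin 3)).erase a, sinPole (-ν a) (-ν b)) (r := 1)
    h.pos₁ h.pos₂ h.pos h.eq₁ h.eq₂ h.sum h.nonneg
    (by simp only [hpair, e1, e2, Finset.mem_singleton, forall_eq]; tauto) h.gen₁ h.gen₂
    (by simp only [hpair, e1, e2, Finset.mem_singleton, forall_eq]; tauto)
    (by simp only [hpair, e1, e2, Finset.mem_singleton, forall_eq]; tauto)
    (by simp only [hpair, e1, e2, Finset.singleton_nonempty, and_self])
    (by simp only [hpair, e1, e2, Finset.mem_singleton, forall_eq]; tauto)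
    (by simp only [hpair]; tauto)
    (by simp only [hpair, e1, e2]; simp)
    (by simp only [hpair, e1, e2, Finset.mem_singleton, forall_eq, f1', f2']; simp)
    (by simp [hij]) (by simp) (fun t₁ t₂ => by
      simp [hij]
      have h2 := abs_add_le t₁ t₂
      linarith)
    (by simp only [hpair, e1, e2, Finset.mem_singleton, forall_eq]; simp)
    (by simp only [hpair, e1, e2, Finset.mem_singleton, forall_eq, f1', f2']; simp)
    (by
      intro s hs
      simp only [hpair, e1, e2, Finset.prod_pair hij, Finset.prod_singleton, pow_one]
      have s1 := sin_div_pi_mul_sinPole (hs i)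
      have s2 := sin_div_pi_mul_sinPole (hs j)
      constructor
      · linear_combination sinPole (ν j) s * sinPole (-ν j) (-ν i) * s1
      · linear_combination sinPole (ν i) s * sinPole (-ν i) (-ν j) * s2)
  simp only [Finset.sum_pair hij, e1, e2, Finset.prod_singleton, Finset.sum_singleton,
    sinPole_neg_neg] at this
  refine PowerBound.of_const_mul (sinPole_ne_zero hint) ?_
  obtain ⟨K, hK⟩ := this
  refine ⟨K, fun X Y hX hY => le_of_eq_of_le (congrArg _ ?_) (hK X Y hX hY)⟩
  rw [sinPole_swap (ν j) (ν i)]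
  ring

end

section

variable {M A₁ A₂ η : ℝ} {ν : Fin 3 → ℂ} {e₁ e₂ : ℕ}

theorem GenericExponents.powerBound_full (h : GenericExponents M A₁ A₂ η ν e₁ e₂)
    (hint : ∀ i k : Fin 3, i ≠ k → ∀ n : ℤ, ν i - ν k ≠ n) (hre : ∀ i, |(ν i).re| ≤ M) :
    PowerBound M A₁ A₂ (fun X Y => pairSeries ν e₁ e₂ 1 1 X Y 2 0 +
      pairSeries ν e₁ e₂ 1 1 X Y 1 2 + pairSeries ν e₁ e₂ 1 1 X Y 0 1 -
      pairSeries ν e₁ e₂ 1 1 X Y 2 1 - pairSeries ν e₁ e₂ 1 1 X Y 0 2 -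
      pairSeries ν e₁ e₂ 1 1 X Y 1 0) := by
  have e0 : (Finset.univ : Finset (Fin 3)).erase 0 = {1, 2} := by decide
  have e1 : (Finset.univ : Finset (Fin 3)).erase 1 = {0, 2} := by decide
  have e2 : (Finset.univ : Finset (Fin 3)).erase 2 = {0, 1} := by decide
  have e01 : ({0, 1} : Finset (Fin 3)).erase 0 = {1} := by decide
  have e10 : ({0, 1} : Finset (Fin 3)).erase 1 = {0} := by decide
  have e02 : ({0, 2} : Finset (Fin 3)).erase 0 = {2} := by decide
  have e20 : ({0, 2} : Finset (Fin 3)).erase 2 = {0} := by decide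
  have e12 : ({1, 2} : Finset (Fin 3)).erase 1 = {2} := by decide
  have e21 : ({1, 2} : Finset (Fin 3)).erase 2 = {1} := by decide
  have hfilter (i : Fin 3) : (Finset.univ : Finset (Fin 3)).filter
      (fun j => i ∈ (Finset.univ : Finset (Fin 3)).erase j) = Finset.univ.erase i := by
    ext x; simp [eq_comm]
  have hnp (i j : Fin 3) (hij : i ≠ j) (n : ℕ) : 1 + n + ν j - ν i ≠ 0 := fun hn =>
    hint i j hij (n + 1) (by push_cast; linear_combination -hn)
  have := powerBound_of_sinPole (M := M) (J := Finset.univ) (I₀ := Finset.univ)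
    (I := fun b => Finset.univ.erase b)
    (C := fun i j => (∏ k ∈ Finset.univ.erase j, sinPole (-ν k) (-ν j)) *
      ∏ k ∈ (Finset.univ.erase j).erase i, sinPole (ν k) (ν i))
    (κ₁ := 1) (κ₂ := 1)
    (d := fun j => ∏ k ∈ Finset.univ.erase j, sinPole (-ν k) (-ν j))
    (d' := fun i => ∏ k ∈ Finset.univ.erase i, sinPole (ν k) (ν i)) (r := 1)
    h.pos₁ h.pos₂ h.pos h.eq₁ h.eq₂ h.sum h.nonneg
    (fun j _ i _ => ⟨(abs_le.1 (hre i)).2, (abs_le.1 (hre j)).1⟩) h.gen₁ h.gen₂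
    (fun j _ i hi => Finset.ne_of_mem_erase hi)
    (fun j _ i hi => hnp i j (Finset.ne_of_mem_erase hi))
    (by decide)
    (fun j _ i _ k _ hik => hint i k hik)
    (fun i _ k _ hik => hint i k hik)
    (by simp)
    (by intro j _ i _; rw [hfilter]; simp)
    (by norm_num) (by simp)
    (fun t₁ t₂ => by
      have h2 := abs_add_le t₁ t₂
      simp
      linarith [abs_nonneg t₁, abs_nonneg t₂])
    (fun _ _ _ _ => rfl)
    (by
      intro j _ i hi
      rw [hfilter]
      fin_cases j <;> fin_cases i <;>
        simp [e0, e1, e2, e01, e10, e02, e20, e12, e21, sinPole_neg_neg] at hi ⊢ <;> ring)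
    (by
      intro s hs j _
      rw [← Finset.mul_prod_erase Finset.univ _ (Finset.mem_univ j)]
      have s1 := sin_div_pi_mul_sinPole (hs j)
      linear_combination (∏ x ∈ Finset.univ.erase j, sinPole (ν x) s) *
        (∏ k ∈ Finset.univ.erase j, sinPole (-ν k) (-ν j)) * s1)
  refine PowerBound.of_const_mul (c := sinPole (ν 0) (ν 1) * sinPole (ν 0) (ν 2) *
    sinPole (ν 1) (ν 2)) (mul_ne_zero (mul_ne_zero (sinPole_ne_zero (hint _ _ (by decide)))
      (sinPole_ne_zero (hint _ _ (by decide)))) (sinPole_ne_zero (hint _ _ (by decide)))) ?_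
  obtain ⟨K, hK⟩ := this
  refine ⟨K, fun X Y hX hY => le_of_eq_of_le (congrArg _ ?_) (hK X Y hX hY)⟩
  simp [Fin.sum_univ_three, e0, e1, e2, e01, e10, e02, e20, e12, e21, sinPole_neg_neg]
  rw [sinPole_swap (ν 0) (ν 1), sinPole_swap (ν 0) (ν 2), sinPole_swap (ν 1) (ν 2)]
  ring

theorem sin_pi_sub_eq_of_sub_eq {a b s : ℂ} {m : ℕ} (hab : a - b = m) :
    Complex.sin (Real.pi * (s - a)) = (-1) ^ m * Complex.sin (Real.pi * (s - b)) := by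
  rw [show (Real.pi * (s - a) : ℂ) = Real.pi * (s - b) - m * Real.pi by rw [← hab]; ring,
    Complex.sin_antiperiodic.sub_nat_mul_eq]

theorem GenericExponents.powerBound_degenerate (h : GenericExponents M A₁ A₂ η ν e₁ e₂) {m : ℕ}
    (hm : ν 0 - ν 1 = m) (hint : ∀ n : ℤ, ν 0 - ν 2 ≠ n)
    (h0 : -M ≤ (ν 0).re) (h1 : (ν 1).re ≤ M) (h2 : |(ν 2).re| ≤ M) :
    PowerBound M A₁ A₂ (fun X Y => pairSeries ν e₁ e₂ (-1) (-1) X Y 2 0 -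
      (-1) ^ m * pairSeries ν e₁ e₂ (-1) (-1) X Y 1 2) := by
  have hint1 : ∀ n : ℤ, ν 2 - ν 0 ≠ n := fun n hn => hint (-n) (by
    push_cast; linear_combination -hn)
  have hint2 : ∀ n : ℤ, ν 1 - ν 2 ≠ n := fun n hn => hint (n + m) (by
    push_cast; linear_combination hn + hm)
  have hint3 : ∀ n : ℤ, ν 2 - ν 1 ≠ n := fun n hn => hint2 (-n) (by
    push_cast; linear_combination -hn)
  obtain ⟨h21, h22⟩ := abs_le.1 h2
  have hsq : ((-1 : ℂ) ^ m) * (-1) ^ m = 1 := by rw [← mul_pow]; simp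
  set I : Fin 3 → Finset (Fin 3) := ![{2}, ∅, {1}] with hIdef
  have I0 : I 0 = {2} := rfl
  have I2 : I 2 = {1} := rfl
  have f2 : ({0, 2} : Finset (Fin 3)).filter (fun j => 2 ∈ I j) = {0} := by
    simp only [hIdef]; decide
  have f1 : ({0, 2} : Finset (Fin 3)).filter (fun j => 1 ∈ I j) = {2} := by
    simp only [hIdef]; decide
  have e02 : ({0, 2} : Finset (Fin 3)).erase 0 = {2} := by decide
  have e20 : ({0, 2} : Finset (Fin 3)).erase 2 = {0} := by decide
  have hpair : ∀ P : Fin 3 → Prop, (∀ b ∈ ({0, 2} : Finset (Fin 3)), P b) ↔ P 0 ∧ P 2 := by simp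
  have := powerBound_of_sinPole (M := M) (J := {0, 2}) (I₀ := {1, 2}) (I := I)
    (C := fun _ j => ![(-1) ^ m * sinPole (-ν 2) (-ν 0), 0, sinPole (-ν 0) (-ν 2)] j)
    (κ₁ := -1) (κ₂ := -1)
    (d := ![(-1) ^ m * sinPole (-ν 2) (-ν 0), 0, sinPole (-ν 0) (-ν 2)])
    (d' := ![0, sinPole (-ν 0) (-ν 2), (-1) ^ m * sinPole (-ν 2) (-ν 0)]) (r := 1)
    h.pos₁ h.pos₂ h.pos h.eq₁ h.eq₂ h.sum h.nonneg
    (by simp only [hpair, I0, I2, Finset.mem_singleton, forall_eq]; tauto) h.gen₁ h.gen₂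
    (by simp only [hpair, I0, I2, Finset.mem_singleton, forall_eq]; decide)
    (by
      simp only [hpair, I0, I2, Finset.mem_singleton, forall_eq]
      exact ⟨fun n hn => hint1 (n + 1) (by push_cast; linear_combination -hn),
        fun n hn => hint2 (n + 1) (by push_cast; linear_combination -hn)⟩)
    (by simp only [hpair, I0, I2, Finset.singleton_nonempty, and_self])
    (by simp only [hpair, I0, I2, Finset.mem_singleton, forall_eq]; tauto)
    (by
      simp only [hpair]
      exact ⟨⟨fun h => absurd rfl h, fun _ => hint⟩, ⟨fun _ => hint1, fun h => absurd rfl h⟩⟩)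
    (by simp only [hpair, I0, I2]; simp)
    (by simp only [hpair, I0, I2, Finset.mem_singleton, forall_eq, f1, f2]; simp)
    (by simp) (by simp) (fun t₁ t₂ => by
      simp
      have h2 := abs_add_le t₁ t₂
      linarith)
    (by simp only [hpair, I0, I2, Finset.mem_singleton, forall_eq]; simp)
    (by simp only [hpair, I0, I2, Finset.mem_singleton, forall_eq, f1, f2]; simp)
    (by
      intro s hs
      simp only [hpair, I0, I2, e02, e20, Finset.prod_pair (show (1 : Fin 3) ≠ 2 by decide),
        Finset.prod_singleton, pow_one]
      have s1 := sin_div_pi_mul_sinPole (hs 1)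
      have s2 := sin_div_pi_mul_sinPole (hs 2)
      rw [sin_pi_sub_eq_of_sub_eq (s := s) hm]
      simp only [Matrix.cons_val]
      constructor
      · linear_combination (-1) ^ m * sinPole (ν 2) s * sinPole (-ν 2) (-ν 0) * s1
      · linear_combination sinPole (ν 1) s * sinPole (-ν 0) (-ν 2) * s2)
  simp only [Finset.sum_pair (show (0 : Fin 3) ≠ 2 by decide), I0, I2, Finset.sum_singleton,
    sinPole_neg_neg, Matrix.cons_val] at this
  refine PowerBound.of_const_mul (c := (-1) ^ m * sinPole (ν 0) (ν 2))
    (mul_ne_zero (by simp) (sinPole_ne_zero hint1)) ?_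
  obtain ⟨K, hK⟩ := this
  refine ⟨K, fun X Y hX hY => le_of_eq_of_le (congrArg _ ?_) (hK X Y hX hY)⟩
  rw [sinPole_swap (ν 0) (ν 2)]
  linear_combination -(sinPole (ν 0) (ν 2) * pairSeries ν e₁ e₂ (-1) (-1) X Y 1 2) * hsq

end

/-- Coefficients of a double power series that is entire of exponential type. -/
def RapidDecay (a : ℕ × ℕ → ℂ) : Prop :=
  ∃ B c : ℝ, ∀ n : ℕ × ℕ, ‖a n‖ ≤ c * (B ^ n.1 / n.1.factorial * (B ^ n.2 / n.2.factorial))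

theorem RapidDecay.summable {a : ℕ × ℕ → ℂ} (h : RapidDecay a) {x y : ℝ} (hx : 0 ≤ x) (hy : 0 ≤ y) :
    Summable (fun n : ℕ × ℕ => ‖a n‖ * (x ^ n.1 * y ^ n.2)) := by
  obtain ⟨B, c, h⟩ := h
  have hs := (summable_mul_of_summable_norm (Real.summable_pow_div_factorial (B * x)).norm
    (Real.summable_pow_div_factorial (B * y)).norm).mul_left c
  refine Summable.of_nonneg_of_le (fun n => by positivity) (fun n => ?_) hs
  calc _ ≤ _ := mul_le_mul_of_nonneg_right (h n) (by positivity)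
    _ = _ := by rw [mul_pow, mul_pow]; ring

theorem RapidDecay.swap {a : ℕ × ℕ → ℂ} (h : RapidDecay a) : RapidDecay (fun n => a n.swap) := by
  obtain ⟨B, c, h⟩ := h
  exact ⟨B, c, fun n => (h n.swap).trans_eq (by simp [mul_comm])⟩

theorem RapidDecay.const_mul {a : ℕ × ℕ → ℂ} (h : RapidDecay a) (w : ℂ) :
    RapidDecay (fun n => w * a n) := by
  obtain ⟨B, c, h⟩ := h
  refine ⟨B, ‖w‖ * c, fun n => ?_⟩
  rw [norm_mul, mul_assoc]
  exact mul_le_mul_of_nonneg_left (h n) (norm_nonneg w)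

theorem RapidDecay.add_mul {a : ℕ × ℕ → ℂ} (h : RapidDecay a) (w : ℂ) :
    RapidDecay (fun n => (w + n.1) * a n) := by
  obtain ⟨B, c, h⟩ := h
  refine ⟨2 * |B|, (‖w‖ + 1) * |c|, fun n => ?_⟩
  have h1 : ‖w + n.1‖ ≤ (‖w‖ + 1) * (2 ^ n.1 * 2 ^ n.2) := by
    have h2 : (n.1 : ℝ) ≤ 2 ^ n.1 := by exact_mod_cast Nat.lt_two_pow_self.le
    have h3 : (1 : ℝ) ≤ 2 ^ n.1 := one_le_pow₀ (by norm_num)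
    have h4 : (1 : ℝ) ≤ 2 ^ n.2 := one_le_pow₀ (by norm_num)
    calc ‖w + n.1‖ ≤ ‖w‖ + n.1 := (norm_add_le _ _).trans (by simp)
      _ ≤ (‖w‖ + 1) * 2 ^ n.1 := by nlinarith [norm_nonneg w]
      _ ≤ _ := by
        rw [← mul_assoc]
        exact le_mul_of_one_le_right (by positivity) h4
  have h5 : ‖a n‖ ≤ |c| * (|B| ^ n.1 / n.1.factorial * (|B| ^ n.2 / n.2.factorial)) := by
    refine ((h n).trans (le_abs_self _)).trans_eq ?_
    simp [abs_mul, abs_div, abs_pow]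
  rw [norm_mul]
  calc _ ≤ _ := mul_le_mul h1 h5 (norm_nonneg _) (by positivity)
    _ = _ := by rw [mul_pow, mul_pow]; ring

/-- A double power series times the monomial `|y₁| ^ l * |y₂| ^ k`. -/
noncomputable def absSeries (l k : ℂ) (a : ℕ × ℕ → ℂ) (y₁ y₂ : ℝ) : ℂ :=
  ∑' n : ℕ × ℕ, a n * (((|y₁| : ℝ) : ℂ) ^ (l + n.1) * ((|y₂| : ℝ) : ℂ) ^ (k + n.2))

theorem absSeries_swap (l k : ℂ) (a : ℕ × ℕ → ℂ) (y₁ y₂ : ℝ) :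
    absSeries k l (fun n => a n.swap) y₂ y₁ = absSeries l k a y₁ y₂ := by
  rw [absSeries, absSeries, ← (Equiv.prodComm ℕ ℕ).tsum_eq]
  simp [mul_comm]

theorem hasDerivAt_abs_cpow {y : ℝ} (hy : y ≠ 0) (s : ℂ) :
    HasDerivAt (fun u : ℝ => ((|u| : ℝ) : ℂ) ^ s) (s * ((|y| : ℝ) : ℂ) ^ s / y) y := by
  rcases eq_or_ne s 0 with rfl | hs
  · simpa using hasDerivAt_const y (1 : ℂ)
  have hy' : ((|y| : ℝ) : ℂ) ≠ 0 := by simpa using hy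
  have := HasDerivAt.scomp (h := fun u : ℝ => |u|) (g₁ := fun u : ℝ => (u : ℂ) ^ s) y
    (hasDerivAt_ofReal_cpow_const (abs_ne_zero.2 hy) hs) (hasDerivAt_abs hy)
  refine this.congr_deriv ?_
  rw [Complex.cpow_sub _ _ hy', Complex.cpow_one]
  rcases lt_or_gt_of_ne hy with h | h
  · simp [h, abs_of_neg, div_neg]; ring
  · simp [h, abs_of_pos]; ring

theorem norm_abs_cpow {y : ℝ} (hy : y ≠ 0) (s : ℂ) (n : ℕ) :
    ‖((|y| : ℝ) : ℂ) ^ (s + n)‖ = |y| ^ s.re * |y| ^ n := by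
  have := abs_pos.2 hy
  rw [Complex.norm_cpow_eq_rpow_re_of_pos this, Complex.add_re, Complex.natCast_re,
    Real.rpow_add this, Real.rpow_natCast]

theorem summable_absSeries {l k : ℂ} {a : ℕ × ℕ → ℂ} (ha : RapidDecay a) {y₁ y₂ : ℝ} (h₁ : y₁ ≠ 0)
    (h₂ : y₂ ≠ 0) : Summable (fun n : ℕ × ℕ =>
      a n * (((|y₁| : ℝ) : ℂ) ^ (l + n.1) * ((|y₂| : ℝ) : ℂ) ^ (k + n.2))) := by
  refine Summable.of_norm_bounded ((ha.summable (abs_nonneg y₁) (abs_nonneg y₂)).mul_left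
    (|y₁| ^ l.re * |y₂| ^ k.re)) fun n => le_of_eq ?_
  rw [norm_mul, norm_mul, norm_abs_cpow h₁, norm_abs_cpow h₂]
  ring

theorem rpow_le_of_mem_Icc {a b x : ℝ} (ha : 0 < a) (h1 : a ≤ x) (h2 : x ≤ b) (p : ℝ) :
    x ^ p ≤ a ^ p + b ^ p := by
  have ha' : 0 ≤ a ^ p := Real.rpow_nonneg ha.le p
  have hb' : 0 ≤ b ^ p := Real.rpow_nonneg (by linarith) p
  rcases le_total 0 p with hp | hp
  · linarith [Real.rpow_le_rpow (ha.le.trans h1) h2 hp]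
  · linarith [Real.rpow_le_rpow_of_nonpos ha h1 hp]

theorem hasDerivAt_absSeries {l k : ℂ} {a : ℕ × ℕ → ℂ} (ha : RapidDecay a) {y₁ y₂ : ℝ}
    (h₁ : y₁ ≠ 0) (h₂ : y₂ ≠ 0) :
    HasDerivAt (fun u : ℝ => absSeries l k a u y₂)
      (absSeries l k (fun n => (l + n.1) * a n) y₁ y₂ / y₁) y₁ := by
  have hy := abs_pos.2 h₁
  have hball : ∀ u ∈ Metric.ball y₁ (|y₁| / 2), u ≠ 0 ∧ |y₁| / 2 ≤ |u| ∧ |u| ≤ 2 * |y₁| := by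
    intro u hu
    rw [Metric.mem_ball, Real.dist_eq] at hu
    have h3 := abs_sub_abs_le_abs_sub y₁ u
    have h4 := abs_sub_abs_le_abs_sub u y₁
    rw [abs_sub_comm] at h3
    exact ⟨abs_pos.1 (by linarith), by linarith, by linarith⟩
  have key := hasDerivAt_tsum_of_isPreconnected
    (g := fun (n : ℕ × ℕ) (u : ℝ) =>
      a n * (((|u| : ℝ) : ℂ) ^ (l + n.1) * ((|y₂| : ℝ) : ℂ) ^ (k + n.2)))
    (g' := fun n u => a n * ((l + n.1) * ((|u| : ℝ) : ℂ) ^ (l + n.1) / u *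
      ((|y₂| : ℝ) : ℂ) ^ (k + n.2)))
    (((ha.add_mul l).summable (x := 2 * |y₁|) (by positivity) (abs_nonneg y₂)).mul_left
      (((|y₁| / 2) ^ l.re + (2 * |y₁|) ^ l.re) * |y₂| ^ k.re * (2 / |y₁|)))
    Metric.isOpen_ball (Metric.isPreconnected_ball (x := y₁) (r := |y₁| / 2))
    (fun n u hu => (((hasDerivAt_abs_cpow (hball u hu).1 _).mul_const _).const_mul _))
    (fun n u hu => by
      obtain ⟨hu0, hu1, hu2⟩ := hball u hu
      rw [norm_mul, norm_mul, norm_div, norm_mul, norm_abs_cpow hu0, norm_abs_cpow h₂, norm_mul,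
        Complex.norm_real, Real.norm_eq_abs, div_eq_mul_inv]
      have e1 := rpow_le_of_mem_Icc (by positivity) hu1 hu2 l.re
      have e2 : |u| ^ n.1 ≤ (2 * |y₁|) ^ n.1 := pow_le_pow_left₀ (abs_nonneg u) hu2 _
      have e3 : |u|⁻¹ ≤ 2 / |y₁| := by
        rw [show 2 / |y₁| = (|y₁| / 2)⁻¹ by field_simp]
        exact inv_anti₀ (by positivity) hu1
      calc _ = ‖l + n.1‖ * ‖a n‖ * (|y₂| ^ k.re * |y₂| ^ n.2) *
            (|u| ^ l.re * |u| ^ n.1 * |u|⁻¹) := by ring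
        _ ≤ ‖l + n.1‖ * ‖a n‖ * (|y₂| ^ k.re * |y₂| ^ n.2) *
            (((|y₁| / 2) ^ l.re + (2 * |y₁|) ^ l.re) * (2 * |y₁|) ^ n.1 * (2 / |y₁|)) := by
          gcongr
        _ = _ := by ring)
    (Metric.mem_ball_self (by positivity)) (summable_absSeries ha h₁ h₂)
    (Metric.mem_ball_self (by positivity))
  refine key.congr_deriv ?_
  rw [absSeries, div_eq_mul_inv, ← tsum_mul_right]
  refine tsum_congr fun n => ?_
  ring

theorem eulerOp1_eq_of_eqOn {σ₁ σ₂ : ℝ} {f g : ℝ → ℝ → ℂ}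
    (h : ∀ y₁ y₂, 0 < σ₁ * y₁ → 0 < σ₂ * y₂ → f y₁ y₂ = g y₁ y₂) (y₁ y₂ : ℝ) (h₁ : 0 < σ₁ * y₁)
    (h₂ : 0 < σ₂ * y₂) : eulerOp1 f y₁ y₂ = eulerOp1 g y₁ y₂ := by
  have : (fun u : ℝ => f u y₂) =ᶠ[nhds y₁] fun u => g u y₂ := by
    have : ∀ᶠ u in nhds y₁, 0 < σ₁ * u :=
      (continuous_const.mul continuous_id).continuousAt.eventually_const_lt h₁
    filter_upwards [this] with u hu using h u y₂ hu h₂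
  rw [eulerOp1, eulerOp1, this.deriv_eq]

theorem eulerOp2_eq_eulerOp1 (f : ℝ → ℝ → ℂ) (y₁ y₂ : ℝ) :
    eulerOp2 f y₁ y₂ = eulerOp1 (fun a b => f b a) y₂ y₁ := rfl

theorem eulerOp2_eq_of_eqOn {σ₁ σ₂ : ℝ} {f g : ℝ → ℝ → ℂ}
    (h : ∀ y₁ y₂, 0 < σ₁ * y₁ → 0 < σ₂ * y₂ → f y₁ y₂ = g y₁ y₂) (y₁ y₂ : ℝ) (h₁ : 0 < σ₁ * y₁)
    (h₂ : 0 < σ₂ * y₂) : eulerOp2 f y₁ y₂ = eulerOp2 g y₁ y₂ :=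
  eulerOp1_eq_of_eqOn (f := fun a b => f b a) (g := fun a b => g b a)
    (fun b a hb ha => h a b ha hb) y₂ y₁ h₂ h₁

section

variable {ι : Type*} {P : Finset ι} {c l k : ι → ℂ} {a : ι → ℕ × ℕ → ℂ}

theorem eulerOp1_sum_absSeries (ha : ∀ p, RapidDecay (a p)) {y₁ y₂ : ℝ} (h₁ : y₁ ≠ 0)
    (h₂ : y₂ ≠ 0) :
    eulerOp1 (fun u v => ∑ p ∈ P, c p * absSeries (l p) (k p) (a p) u v) y₁ y₂ =
      ∑ p ∈ P, c p * absSeries (l p) (k p) (fun n => (l p + n.1) * a p n) y₁ y₂ := by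
  have hd := HasDerivAt.fun_sum (u := P) fun p _ =>
    (hasDerivAt_absSeries (l := l p) (k := k p) (ha p) h₁ h₂).const_mul (c p)
  have hy : (y₁ : ℂ) ≠ 0 := by exact_mod_cast h₁
  rw [eulerOp1, hd.deriv, Finset.mul_sum]
  refine Finset.sum_congr rfl fun p _ => ?_
  field_simp

theorem eulerOp2_sum_absSeries (ha : ∀ p, RapidDecay (a p)) {y₁ y₂ : ℝ} (h₁ : y₁ ≠ 0)
    (h₂ : y₂ ≠ 0) :
    eulerOp2 (fun u v => ∑ p ∈ P, c p * absSeries (l p) (k p) (a p) u v) y₁ y₂ =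
      ∑ p ∈ P, c p * absSeries (l p) (k p) (fun n => (k p + n.2) * a p n) y₁ y₂ := by
  have := eulerOp1_sum_absSeries (P := P) (c := c) (l := k) (k := l)
    (a := fun p n => a p n.swap) (fun p => (ha p).swap) h₂ h₁
  simp only [absSeries_swap (l _) (k _)] at this
  rw [eulerOp2_eq_eulerOp1, this]
  refine Finset.sum_congr rfl fun p _ => ?_
  rw [← absSeries_swap (l p) (k p)]
  rfl

theorem rapidDecay_euler {a : ℕ × ℕ → ℂ} (h : RapidDecay a) (l k : ℂ) (j₁ j₂ : ℕ) :
    RapidDecay (fun n => (l + n.1) ^ j₁ * ((k + n.2) ^ j₂ * a n)) := by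
  have h2 : RapidDecay (fun n => (k + n.2) ^ j₂ * a n) := by
    induction j₂ with
    | zero => simpa using h
    | succ m ih =>
      convert (ih.swap.add_mul k).swap using 2 with n
      simp only [Prod.swap_swap, Prod.fst_swap]
      ring
  induction j₁ with
  | zero => simpa using h2
  | succ m ih =>
    convert ih.add_mul l using 2 with n
    ring

theorem iterate_eulerOp_eq {σ₁ σ₂ : ℝ} {f : ℝ → ℝ → ℂ} (ha : ∀ p, RapidDecay (a p))
    (hf : ∀ y₁ y₂, 0 < σ₁ * y₁ → 0 < σ₂ * y₂ →
      f y₁ y₂ = ∑ p ∈ P, c p * absSeries (l p) (k p) (a p) y₁ y₂) (j₁ j₂ : ℕ) :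
    ∀ y₁ y₂, 0 < σ₁ * y₁ → 0 < σ₂ * y₂ → (eulerOp1^[j₁] (eulerOp2^[j₂] f)) y₁ y₂ =
      ∑ p ∈ P, c p * absSeries (l p) (k p)
        (fun n => (l p + n.1) ^ j₁ * ((k p + n.2) ^ j₂ * a p n)) y₁ y₂ := by
  have hne {σ y : ℝ} (h : 0 < σ * y) : y ≠ 0 := by rintro rfl; simp at h
  induction j₁ with
  | zero =>
    induction j₂ with
    | zero => simpa using hf
    | succ m ih =>
      intro y₁ y₂ h₁ h₂
      rw [Function.iterate_zero, id] at ih ⊢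
      rw [Function.iterate_succ_apply', eulerOp2_eq_of_eqOn ih y₁ y₂ h₁ h₂,
        eulerOp2_sum_absSeries (fun p => rapidDecay_euler (ha p) _ _ _ _) (hne h₁) (hne h₂)]
      refine Finset.sum_congr rfl fun p _ => ?_
      congr 2
      ext n
      ring
  | succ m ih =>
    intro y₁ y₂ h₁ h₂
    rw [Function.iterate_succ_apply', eulerOp1_eq_of_eqOn ih y₁ y₂ h₁ h₂,
      eulerOp1_sum_absSeries (fun p => rapidDecay_euler (ha p) _ _ _ _) (hne h₁) (hne h₂)]
    refine Finset.sum_congr rfl fun p _ => ?_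
    congr 2
    ext n
    ring

end

/-- The power-series coefficients of the function attached to the pair of poles `ν i`, `-ν j`. -/
noncomputable def pairCoeff (ν : Fin 3 → ℂ) (κ₁ κ₂ : ℂ) (i j : Fin 3) (n : ℕ × ℕ) : ℂ :=
  ((4 * Real.pi ^ 2 : ℝ) : ℂ) ^ 2 * (κ₁ ^ n.1 * κ₂ ^ n.2 *
    mellinTerm ν 0 0 (4 * Real.pi ^ 2) (4 * Real.pi ^ 2) (ν i - n.1) (-ν j - n.2))

theorem rapidDecay_pairCoeff (ν : Fin 3 → ℂ) {κ₁ κ₂ : ℂ} (h₁ : ‖κ₁‖ = 1) (h₂ : ‖κ₂‖ = 1)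
    (i j : Fin 3) : RapidDecay (pairCoeff ν κ₁ κ₂ i j) := by
  have hp : 0 < 4 * Real.pi ^ 2 := by positivity
  obtain ⟨B, c, h⟩ := norm_mellinTerm_sub_nat_le ν 0 0 hp hp (ν i) (-ν j)
  refine RapidDecay.const_mul ⟨B, c, fun n => ?_⟩ _
  rw [norm_mul, norm_mul, norm_pow, norm_pow, h₁, h₂, one_pow, one_pow, one_mul, one_mul]
  exact h n

theorem cpow_one_sub_add_natCast {x : ℝ} (hx : 0 < x) (s : ℂ) (n : ℕ) :
    (x : ℂ) ^ (1 - s + n) = x * (x : ℂ) ^ (-(s - n)) := by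
  rw [show 1 - s + n = 1 + -(s - n) by ring,
    Complex.cpow_add _ _ (by exact_mod_cast hx.ne'), Complex.cpow_one]

theorem absSeries_pairCoeff (ν : Fin 3 → ℂ) (e₁ e₂ : ℕ) (κ₁ κ₂ : ℂ) (i j : Fin 3) {y₁ y₂ : ℝ}
    (h₁ : y₁ ≠ 0) (h₂ : y₂ ≠ 0) :
    absSeries (1 - ν i) (1 - -ν j) (fun n => (1 - ν i + n.1) ^ e₁ *
        ((1 - -ν j + n.2) ^ e₂ * pairCoeff ν κ₁ κ₂ i j n)) y₁ y₂ =
      ((4 * Real.pi ^ 2 * |y₁| : ℝ) : ℂ) * ((4 * Real.pi ^ 2 * |y₂| : ℝ) : ℂ) *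
        pairSeries ν e₁ e₂ κ₁ κ₂ (4 * Real.pi ^ 2 * |y₁|) (4 * Real.pi ^ 2 * |y₂|) i j := by
  have hp : 0 ≤ 4 * Real.pi ^ 2 := by positivity
  rw [absSeries, pairSeries, ← tsum_mul_left]
  refine tsum_congr fun n => ?_
  rw [pairCoeff, mellinTerm, mellinTerm, cpow_one_sub_add_natCast (abs_pos.2 h₁),
    cpow_one_sub_add_natCast (abs_pos.2 h₂), Complex.ofReal_mul (4 * Real.pi ^ 2),
    Complex.ofReal_mul (4 * Real.pi ^ 2),
    Complex.mul_cpow_ofReal_nonneg hp (abs_nonneg y₁),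
    Complex.mul_cpow_ofReal_nonneg hp (abs_nonneg y₂)]
  ring

theorem prod_fin_three_of_ne {i j k : Fin 3} (hij : i ≠ j) (hik : i ≠ k) (hjk : j ≠ k)
    (f : Fin 3 → ℂ) : ∏ l, f l = f j * f k * f i := by
  have h : (Finset.univ : Finset (Fin 3)) = {j, k, i} := by
    revert hij hik hjk; revert i j k; decide
  rw [h, Finset.prod_insert (by simp [hjk, hij.symm]), Finset.prod_pair hik.symm, mul_assoc]

theorem Jwl_eq_pairSeries (ν : Fin 3 → ℂ) {i j k : Fin 3} (hij : i ≠ j) (hik : i ≠ k)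
    (hjk : j ≠ k) {σ₁ σ₂ y₁ y₂ : ℝ} (h₁ : y₁ = σ₁ * |y₁|) (h₂ : y₂ = σ₂ * |y₂|)
    (h₁' : y₁ ≠ 0) (h₂' : y₂ ≠ 0) :
    Jwl y₁ y₂ (ν j) (ν k) (ν i) =
      ((4 * Real.pi ^ 2 * |y₁| : ℝ) : ℂ) * ((4 * Real.pi ^ 2 * |y₂| : ℝ) : ℂ) *
        pairSeries ν 0 0 σ₁ σ₂ (4 * Real.pi ^ 2 * |y₁|) (4 * Real.pi ^ 2 * |y₂|) i j := by
  have hp : 0 < 4 * Real.pi ^ 2 := by positivity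
  have e1 : 4 * Real.pi ^ 2 * y₁ = σ₁ * (4 * Real.pi ^ 2 * |y₁|) := by
    rw [mul_left_comm, ← h₁]
  have e2 : 4 * Real.pi ^ 2 * y₂ = σ₂ * (4 * Real.pi ^ 2 * |y₂|) := by
    rw [mul_left_comm, ← h₂]
  rw [Jwl, abs_mul (4 * Real.pi ^ 2), abs_mul (4 * Real.pi ^ 2), abs_of_pos hp, e1, e2]
  have hx : 0 < 4 * Real.pi ^ 2 * |y₁| := mul_pos hp (abs_pos.2 h₁')
  have hy : 0 < 4 * Real.pi ^ 2 * |y₂| := mul_pos hp (abs_pos.2 h₂')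
  generalize 4 * Real.pi ^ 2 * |y₁| = x at hx
  generalize 4 * Real.pi ^ 2 * |y₂| = y at hy
  have hx' : (x : ℂ) ≠ 0 := by exact_mod_cast hx.ne'
  have hy' : (y : ℂ) ≠ 0 := by exact_mod_cast hy.ne'
  rw [pairSeries, ← tsum_mul_left, ← tsum_mul_left]
  refine tsum_congr fun n => ?_
  have px : (x : ℂ) ^ (1 - ν i) * (x : ℂ) ^ n.1 = x * (x : ℂ) ^ (-(ν i - n.1)) := by
    rw [← cpow_one_sub_add_natCast hx, Complex.cpow_add _ _ hx', Complex.cpow_natCast]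
  have py : (y : ℂ) ^ (1 + ν j) * (y : ℂ) ^ n.2 = y * (y : ℂ) ^ (-(-ν j - n.2)) := by
    rw [← cpow_one_sub_add_natCast hy, sub_neg_eq_add, Complex.cpow_add _ (n.2 : ℂ) hy',
      Complex.cpow_natCast]
  rw [mellinTerm, invGammaProd, invGammaProd, prod_fin_three_of_ne hij hik hjk,
    prod_fin_three_of_ne hij hik hjk, Complex.ofReal_mul, Complex.ofReal_mul, mul_pow, mul_pow]
  simp only [Pi.neg_apply]
  rw [show 1 - (ν i - n.1) - (-ν j - n.2) = n.1 + n.2 + ν j - ν i + 1 by ring,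
    show 1 - (ν i - n.1) + ν j = n.1 + ν j - ν i + 1 by ring,
    show 1 - (ν i - n.1) + ν k = n.1 + ν k - ν i + 1 by ring,
    show 1 - (ν i - n.1) + ν i = n.1 + ν i - ν i + 1 by ring,
    show 1 - (-ν j - n.2) + -ν j = n.2 + ν j - ν j + 1 by ring,
    show 1 - (-ν j - n.2) + -ν k = n.2 + ν j - ν k + 1 by ring,
    show 1 - (-ν j - n.2) + -ν i = n.2 + ν j - ν i + 1 by ring, div_eq_mul_inv]
  simp only [mul_inv]
  generalize (Complex.Gamma (n.1 + ν j - ν i + 1))⁻¹ = g₁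
  generalize (Complex.Gamma (n.1 + ν k - ν i + 1))⁻¹ = g₂
  generalize (Complex.Gamma (n.1 + ν i - ν i + 1))⁻¹ = g₃
  generalize (Complex.Gamma (n.2 + ν j - ν j + 1))⁻¹ = g₄
  generalize (Complex.Gamma (n.2 + ν j - ν k + 1))⁻¹ = g₅
  generalize (Complex.Gamma (n.2 + ν j - ν i + 1))⁻¹ = g₆
  generalize Complex.Gamma (n.1 + n.2 + ν j - ν i + 1) = g
  generalize (x : ℂ) ^ (1 - ν i) = p at px ⊢
  generalize (y : ℂ) ^ (1 + ν j) = q at py ⊢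
  generalize (x : ℂ) ^ (-(ν i - n.1)) = u at px ⊢
  generalize (y : ℂ) ^ (-(-ν j - n.2)) = v at py ⊢
  rw [pow_zero, pow_zero]
  linear_combination g * (σ₁ : ℂ) ^ n.1 * (σ₂ : ℂ) ^ n.2 * g₁ * g₂ * g₃ * g₄ * g₅ * g₆ *
    (q * (y : ℂ) ^ n.2 * px + x * u * py)

/-- A linear combination of the double residue series. -/
noncomputable def pairComb (c : Fin 3 → Fin 3 → ℂ) (ν : Fin 3 → ℂ) (e₁ e₂ : ℕ) (κ₁ κ₂ : ℂ)
    (X Y : ℝ) : ℂ :=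
  ∑ p : Fin 3 × Fin 3, c p.1 p.2 * pairSeries ν e₁ e₂ κ₁ κ₂ X Y p.1 p.2

/-- On the quadrant with signs `σ₁, σ₂`, the function `f` is `|4π²y₁||4π²y₂|` times a combination
of the double residue series. -/
def IsPairComb (c : Fin 3 → Fin 3 → ℂ) (ν : Fin 3 → ℂ) (σ₁ σ₂ : ℝ) (f : ℝ → ℝ → ℂ) : Prop :=
  ∀ y₁ y₂ : ℝ, 0 < σ₁ * y₁ → 0 < σ₂ * y₂ → f y₁ y₂ =
    ((4 * Real.pi ^ 2 * |y₁| : ℝ) : ℂ) * ((4 * Real.pi ^ 2 * |y₂| : ℝ) : ℂ) *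
      pairComb c ν 0 0 σ₁ σ₂ (4 * Real.pi ^ 2 * |y₁|) (4 * Real.pi ^ 2 * |y₂|)

theorem mul_rpow_add_le {p x M A : ℝ} (hp : 0 ≤ p) (hx : 0 ≤ x) :
    (p * x) ^ (-M) + (p * x) ^ A ≤ (p ^ (-M) + p ^ A) * (x ^ (-M) + x ^ A) := by
  rw [Real.mul_rpow hp hx, Real.mul_rpow hp hx]
  have h1 := mul_nonneg (Real.rpow_nonneg hp (-M)) (Real.rpow_nonneg hx A)
  have h2 := mul_nonneg (Real.rpow_nonneg hp A) (Real.rpow_nonneg hx (-M))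
  linarith

theorem IsPairComb.iterate_eulerOp {c : Fin 3 → Fin 3 → ℂ} {ν : Fin 3 → ℂ} {σ₁ σ₂ : ℝ}
    {f : ℝ → ℝ → ℂ} (hf : IsPairComb c ν σ₁ σ₂ f) (h₁ : |σ₁| = 1) (h₂ : |σ₂| = 1) (j₁ j₂ : ℕ)
    {y₁ y₂ : ℝ} (hy₁ : 0 < σ₁ * y₁) (hy₂ : 0 < σ₂ * y₂) :
    (eulerOp1^[j₁] (eulerOp2^[j₂] f)) y₁ y₂ =
      ((4 * Real.pi ^ 2 * |y₁| : ℝ) : ℂ) * ((4 * Real.pi ^ 2 * |y₂| : ℝ) : ℂ) *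
      pairComb c ν j₁ j₂ σ₁ σ₂ (4 * Real.pi ^ 2 * |y₁|) (4 * Real.pi ^ 2 * |y₂|) := by
  have hne {σ y : ℝ} (h : 0 < σ * y) : y ≠ 0 := by rintro rfl; simp at h
  have hn₁ : ‖(σ₁ : ℂ)‖ = 1 := by simpa using h₁
  have hn₂ : ‖(σ₂ : ℂ)‖ = 1 := by simpa using h₂
  rw [iterate_eulerOp_eq (σ₁ := σ₁) (σ₂ := σ₂) (P := (Finset.univ : Finset (Fin 3 × Fin 3)))
    (c := fun p => c p.1 p.2) (l := fun p => 1 - ν p.1) (k := fun p => 1 - -ν p.2)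
    (a := fun p => pairCoeff ν σ₁ σ₂ p.1 p.2)
    (fun p => rapidDecay_pairCoeff ν hn₁ hn₂ p.1 p.2) (fun u v hu hv => by
      rw [hf u v hu hv, pairComb, Finset.mul_sum]
      refine Finset.sum_congr rfl fun p _ => ?_
      have := absSeries_pairCoeff ν 0 0 σ₁ σ₂ p.1 p.2 (hne hu) (hne hv)
      simp only [pow_zero, one_mul] at this
      rw [this]
      ring) j₁ j₂ y₁ y₂ hy₁ hy₂, pairComb, Finset.mul_sum]
  refine Finset.sum_congr rfl fun p _ => ?_
  rw [absSeries_pairCoeff ν j₁ j₂ σ₁ σ₂ p.1 p.2 (hne hy₁) (hne hy₂)]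
  ring

theorem IsPairComb.norm_le {c : Fin 3 → Fin 3 → ℂ} {ν : Fin 3 → ℂ} {σ₁ σ₂ : ℝ}
    {f : ℝ → ℝ → ℂ} (hf : IsPairComb c ν σ₁ σ₂ f) (h₁ : |σ₁| = 1) (h₂ : |σ₂| = 1) {j₁ j₂ : ℕ}
    {M A₁ A₂ : ℝ} (hb : PowerBound M A₁ A₂ (pairComb c ν j₁ j₂ σ₁ σ₂)) :
    ∃ K : ℝ, 0 < K ∧ ∀ y₁ y₂ : ℝ, 0 < σ₁ * y₁ → 0 < σ₂ * y₂ →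
      ‖(((y₁ * y₂ : ℝ) : ℂ))⁻¹ * (eulerOp1^[j₁] (eulerOp2^[j₂] f)) y₁ y₂‖ ≤
        K * ((|y₁| ^ (-M) + |y₁| ^ A₁) * (|y₂| ^ (-M) + |y₂| ^ A₂)) := by
  have hne {σ y : ℝ} (h : 0 < σ * y) : y ≠ 0 := by rintro rfl; simp at h
  obtain ⟨K, hK⟩ := hb
  have hp : 0 < 4 * Real.pi ^ 2 := by positivity
  set p := 4 * Real.pi ^ 2 with hpdef
  refine ⟨(|K| + 1) * (p * p * ((p ^ (-M) + p ^ A₁) * (p ^ (-M) + p ^ A₂))), by positivity,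
    fun y₁ y₂ hy₁ hy₂ => ?_⟩
  have a₁ := abs_pos.2 (hne hy₁)
  have a₂ := abs_pos.2 (hne hy₂)
  rw [hf.iterate_eulerOp h₁ h₂ j₁ j₂ hy₁ hy₂, ← hpdef, norm_mul, norm_mul, norm_mul, norm_inv,
    Complex.norm_real, Complex.norm_real, Complex.norm_real, Real.norm_eq_abs, Real.norm_eq_abs,
    Real.norm_eq_abs, abs_mul y₁, abs_of_pos (mul_pos hp a₁), abs_of_pos (mul_pos hp a₂)]
  calc (|y₁| * |y₂|)⁻¹ * (p * |y₁| * (p * |y₂|) *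
        ‖pairComb c ν j₁ j₂ σ₁ σ₂ (p * |y₁|) (p * |y₂|)‖)
      = p * p * ‖pairComb c ν j₁ j₂ σ₁ σ₂ (p * |y₁|) (p * |y₂|)‖ := by field_simp
    _ ≤ p * p * ((|K| + 1) * (((p ^ (-M) + p ^ A₁) * (|y₁| ^ (-M) + |y₁| ^ A₁)) *
        ((p ^ (-M) + p ^ A₂) * (|y₂| ^ (-M) + |y₂| ^ A₂)))) := by
      refine mul_le_mul_of_nonneg_left ((hK _ _ (by positivity) (by positivity)).trans ?_)
        (by positivity)
      have hK' : K ≤ |K| + 1 := by linarith [le_abs_self K]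
      gcongr
      · exact mul_rpow_add_le hp.le a₁.le
      · exact mul_rpow_add_le hp.le a₂.le
    _ = _ := by ring

theorem exists_genericExponents {M : ℝ} (hM : 0 ≤ M) {ν : Fin 3 → ℂ} (hν : ∑ k, ν k = 0)
    (j₁ j₂ : ℕ) {ε : ℝ} (hε : 0 < ε) : ∃ A₁ A₂ η : ℝ, GenericExponents M A₁ A₂ η ν j₁ j₂ ∧
      A₁ ≤ (2 / 3) * (j₁ : ℝ) + (1 / 3) * (j₂ : ℝ) + ε ∧
      A₂ ≤ (1 / 3) * (j₁ : ℝ) + (2 / 3) * (j₂ : ℝ) + ε := by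
  set a₁ := (2 / 3) * (j₁ : ℝ) + (1 / 3) * (j₂ : ℝ) with ha₁
  set a₂ := (1 / 3) * (j₁ : ℝ) + (2 / 3) * (j₂ : ℝ) with ha₂
  have h₁ : 0 ≤ a₁ := by positivity
  have h₂ : 0 ≤ a₂ := by positivity
  set S : Set ℝ := Set.range (fun q : Fin 3 × ℤ => (q.2 : ℝ) - (ν q.1).re - a₁) ∪
    Set.range (fun q : Fin 3 × ℤ => (q.2 : ℝ) + (ν q.1).re - a₂) with hS
  have hSc : S.Countable := (Set.countable_range _).union (Set.countable_range _)
  obtain ⟨η, ⟨hη0, hη⟩, hηS⟩ : ∃ η ∈ Set.Ioo 0 ε, η ∉ S := by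
    by_contra! hcon
    exact Cardinal.Real.Ioo_countable_iff.1 (hSc.mono hcon) |>.not_gt hε
  refine ⟨a₁ + η, a₂ + η, η, ⟨by linarith, by linarith, hη0, by rw [ha₁, ha₂]; ring,
    by rw [ha₁, ha₂]; ring, hν, hM, fun k n hn => hηS (Or.inl ⟨(k, n), ?_⟩),
    fun k n hn => hηS (Or.inr ⟨(k, n), ?_⟩)⟩, by linarith, by linarith⟩
  · change (n : ℝ) - (ν k).re - a₁ = η
    linarith
  · change (n : ℝ) + (ν k).re - a₂ = η
    linarith

theorem rpow_add_rpow_le {x a b A B : ℝ} (hx : 0 < x) (h1 : A ≤ a) (h2 : a ≤ B) (h3 : A ≤ b)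
    (h4 : b ≤ B) : x ^ a + x ^ b ≤ 2 * (x ^ A + x ^ B) := by
  linarith [rpow_le_rpow_add_rpow hx h1 h2, rpow_le_rpow_add_rpow hx h3 h4]

theorem exists_bound_of_isPairComb {M : ℝ} (hM : 0 ≤ M) {ν : Fin 3 → ℂ} (hν : ∑ k, ν k = 0)
    {j₁ j₂ : ℕ} {ε : ℝ} (hε : 0 < ε) {f : ℝ → ℝ → ℂ}
    (h : ∀ σ₁ σ₂ : ℝ, (σ₁ = 1 ∨ σ₁ = -1) → (σ₂ = 1 ∨ σ₂ = -1) → ∃ c : Fin 3 → Fin 3 → ℂ,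
      IsPairComb c ν σ₁ σ₂ f ∧ ∀ A₁ A₂ η : ℝ, GenericExponents M A₁ A₂ η ν j₁ j₂ →
        PowerBound M A₁ A₂ (pairComb c ν j₁ j₂ σ₁ σ₂)) :
    ∃ C : ℝ, 0 < C ∧ ∀ y₁ y₂ : ℝ, y₁ * y₂ ≠ 0 →
      ‖(((y₁ * y₂ : ℝ) : ℂ))⁻¹ * (eulerOp1^[j₁] (eulerOp2^[j₂] f)) y₁ y₂‖ ≤
        C * ((|y₁| ^ (-M - ε) + |y₁| ^ ((2 / 3) * (j₁ : ℝ) + (1 / 3) * (j₂ : ℝ) +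
            (1 / 6) * max 0 (3 * M - (j₁ : ℝ) - (j₂ : ℝ)) + ε)) *
          (|y₂| ^ (-M - ε) + |y₂| ^ ((1 / 3) * (j₁ : ℝ) + (2 / 3) * (j₂ : ℝ) +
            (1 / 6) * max 0 (3 * M - (j₁ : ℝ) - (j₂ : ℝ)) + ε))) := by
  obtain ⟨A₁, A₂, η, hG, hA₁, hA₂⟩ := exists_genericExponents hM hν j₁ j₂ hε
  have hK (σ₁ σ₂ : ℝ) (h₁ : σ₁ = 1 ∨ σ₁ = -1) (h₂ : σ₂ = 1 ∨ σ₂ = -1) : ∃ K : ℝ, 0 < K ∧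
      ∀ y₁ y₂ : ℝ, 0 < σ₁ * y₁ → 0 < σ₂ * y₂ →
        ‖(((y₁ * y₂ : ℝ) : ℂ))⁻¹ * (eulerOp1^[j₁] (eulerOp2^[j₂] f)) y₁ y₂‖ ≤
          K * ((|y₁| ^ (-M) + |y₁| ^ A₁) * (|y₂| ^ (-M) + |y₂| ^ A₂)) := by
    obtain ⟨c, hc, hb⟩ := h σ₁ σ₂ h₁ h₂
    exact hc.norm_le (by rcases h₁ with rfl | rfl <;> simp)
      (by rcases h₂ with rfl | rfl <;> simp) (hb A₁ A₂ η hG)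
  obtain ⟨K₁, hK₁, b₁⟩ := hK 1 1 (Or.inl rfl) (Or.inl rfl)
  obtain ⟨K₂, hK₂, b₂⟩ := hK 1 (-1) (Or.inl rfl) (Or.inr rfl)
  obtain ⟨K₃, hK₃, b₃⟩ := hK (-1) 1 (Or.inr rfl) (Or.inl rfl)
  obtain ⟨K₄, hK₄, b₄⟩ := hK (-1) (-1) (Or.inr rfl) (Or.inr rfl)
  refine ⟨(K₁ + K₂ + K₃ + K₄) * 4, by positivity, fun y₁ y₂ hy => ?_⟩
  have hy₁ : y₁ ≠ 0 := left_ne_zero_of_mul hy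
  have hy₂ : y₂ ≠ 0 := right_ne_zero_of_mul hy
  have hmax : 0 ≤ max 0 (3 * M - (j₁ : ℝ) - (j₂ : ℝ)) := le_max_left _ _
  have hj₁ : (0 : ℝ) ≤ j₁ := Nat.cast_nonneg _
  have hj₂ : (0 : ℝ) ≤ j₂ := Nat.cast_nonneg _
  have p₁ := hG.pos₁
  have p₂ := hG.pos₂
  have c₁ := rpow_add_rpow_le (x := |y₁|) (a := -M) (b := A₁) (A := -M - ε)
    (B := (2 / 3) * (j₁ : ℝ) + (1 / 3) * (j₂ : ℝ) +
      (1 / 6) * max 0 (3 * M - (j₁ : ℝ) - (j₂ : ℝ)) + ε) (abs_pos.2 hy₁)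
    (by linarith) (by linarith) (by linarith) (by linarith)
  have c₂ := rpow_add_rpow_le (x := |y₂|) (a := -M) (b := A₂) (A := -M - ε)
    (B := (1 / 3) * (j₁ : ℝ) + (2 / 3) * (j₂ : ℝ) +
      (1 / 6) * max 0 (3 * M - (j₁ : ℝ) - (j₂ : ℝ)) + ε) (abs_pos.2 hy₂)
    (by linarith) (by linarith) (by linarith) (by linarith)
  have key : ‖(((y₁ * y₂ : ℝ) : ℂ))⁻¹ * (eulerOp1^[j₁] (eulerOp2^[j₂] f)) y₁ y₂‖ ≤
      (K₁ + K₂ + K₃ + K₄) * ((|y₁| ^ (-M) + |y₁| ^ A₁) * (|y₂| ^ (-M) + |y₂| ^ A₂)) := by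
    have hnn : 0 ≤ (|y₁| ^ (-M) + |y₁| ^ A₁) * (|y₂| ^ (-M) + |y₂| ^ A₂) := by positivity
    rcases lt_or_gt_of_ne hy₁ with s₁ | s₁ <;> rcases lt_or_gt_of_ne hy₂ with s₂ | s₂
    · exact (b₄ y₁ y₂ (by linarith) (by linarith)).trans
        (mul_le_mul_of_nonneg_right (by linarith) hnn)
    · exact (b₃ y₁ y₂ (by linarith) (by linarith)).trans
        (mul_le_mul_of_nonneg_right (by linarith) hnn)
    · exact (b₂ y₁ y₂ (by linarith) (by linarith)).trans
        (mul_le_mul_of_nonneg_right (by linarith) hnn)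
    · exact (b₁ y₁ y₂ (by linarith) (by linarith)).trans
        (mul_le_mul_of_nonneg_right (by linarith) hnn)
  refine key.trans ?_
  calc _ ≤ (K₁ + K₂ + K₃ + K₄) * (_ * _) :=
        mul_le_mul_of_nonneg_left (mul_le_mul c₁ c₂ (by positivity) (by positivity)) (by positivity)
    _ = _ := by ring

theorem PowerBound.congr {M A₁ A₂ : ℝ} {f g : ℝ → ℝ → ℂ} (hf : PowerBound M A₁ A₂ f)
    (h : ∀ X Y, g X Y = f X Y) : PowerBound M A₁ A₂ g := by
  obtain ⟨K, hK⟩ := hf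
  exact ⟨K, fun X Y hX hY => (h X Y).symm ▸ hK X Y hX hY⟩

/-- The combination `a₁S₂₀ + a₂S₁₂ + a₃S₀₁ - b₁S₂₁ - b₂S₀₂ - b₃S₁₀` scaled by `c`. -/
def weylCoeff (c a₁ a₂ a₃ b₁ b₂ b₃ : ℂ) : Fin 3 → Fin 3 → ℂ :=
  ![![0, c * a₃, -(c * b₂)], ![-(c * b₃), 0, c * a₂], ![c * a₁, -(c * b₁), 0]]

theorem pairComb_weylCoeff (c a₁ a₂ a₃ b₁ b₂ b₃ : ℂ) (ν : Fin 3 → ℂ) (e₁ e₂ : ℕ) (κ₁ κ₂ : ℂ)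
    (X Y : ℝ) : pairComb (weylCoeff c a₁ a₂ a₃ b₁ b₂ b₃) ν e₁ e₂ κ₁ κ₂ X Y =
      c * (a₁ * pairSeries ν e₁ e₂ κ₁ κ₂ X Y 2 0 + a₂ * pairSeries ν e₁ e₂ κ₁ κ₂ X Y 1 2 +
        a₃ * pairSeries ν e₁ e₂ κ₁ κ₂ X Y 0 1 - b₁ * pairSeries ν e₁ e₂ κ₁ κ₂ X Y 2 1 -
        b₂ * pairSeries ν e₁ e₂ κ₁ κ₂ X Y 0 2 - b₃ * pairSeries ν e₁ e₂ κ₁ κ₂ X Y 1 0) := by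
  simp [pairComb, weylCoeff, Fintype.sum_prod_type, Fin.sum_univ_three]
  ring

theorem isPairComb_weylCoeff {c a₁ a₂ a₃ b₁ b₂ b₃ μ₁ μ₂ μ₃ : ℂ} {σ₁ σ₂ : ℝ}
    (h₁ : σ₁ = 1 ∨ σ₁ = -1) (h₂ : σ₂ = 1 ∨ σ₂ = -1) {f : ℝ → ℝ → ℂ}
    (hf : ∀ y₁ y₂ : ℝ, 0 < σ₁ * y₁ → 0 < σ₂ * y₂ → f y₁ y₂ =
      c * (a₁ * Jwl y₁ y₂ μ₁ μ₂ μ₃ + a₂ * Jwl y₁ y₂ μ₃ μ₁ μ₂ + a₃ * Jwl y₁ y₂ μ₂ μ₃ μ₁ -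
        b₁ * Jwl y₁ y₂ μ₂ μ₁ μ₃ - b₂ * Jwl y₁ y₂ μ₃ μ₂ μ₁ - b₃ * Jwl y₁ y₂ μ₁ μ₃ μ₂)) :
    IsPairComb (weylCoeff c a₁ a₂ a₃ b₁ b₂ b₃) ![μ₁, μ₂, μ₃] σ₁ σ₂ f := by
  have habs {σ y : ℝ} (hσ : σ = 1 ∨ σ = -1) (h : 0 < σ * y) : y = σ * |y| ∧ y ≠ 0 := by
    rcases hσ with rfl | rfl
    · have : 0 < y := by linarith
      simp [abs_of_pos this, this.ne']
    · have : y < 0 := by linarith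
      simp [abs_of_neg this, this.ne]
  intro y₁ y₂ hy₁ hy₂
  obtain ⟨e₁, n₁⟩ := habs h₁ hy₁
  obtain ⟨e₂, n₂⟩ := habs h₂ hy₂
  have key (i k j : Fin 3) (hij : i ≠ j) (hik : i ≠ k) (hjk : j ≠ k) :=
    Jwl_eq_pairSeries ![μ₁, μ₂, μ₃] hij hik hjk e₁ e₂ n₁ n₂
  have t₁ := key 2 1 0 (by decide) (by decide) (by decide)
  have t₂ := key 1 0 2 (by decide) (by decide) (by decide)
  have t₃ := key 0 2 1 (by decide) (by decide) (by decide)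
  have t₄ := key 2 0 1 (by decide) (by decide) (by decide)
  have t₅ := key 0 1 2 (by decide) (by decide) (by decide)
  have t₆ := key 1 2 0 (by decide) (by decide) (by decide)
  simp only [Matrix.cons_val] at t₁ t₂ t₃ t₄ t₅ t₆
  rw [hf y₁ y₂ hy₁ hy₂, pairComb_weylCoeff, t₁, t₂, t₃, t₄, t₅, t₆]
  ring

section

variable {M A₁ A₂ η : ℝ} {ν : Fin 3 → ℂ} {e₁ e₂ : ℕ}

theorem one_add_natCast_add_sub_ne_zero {z w : ℂ} (h : ∀ n : ℤ, z - w ≠ n) (n : ℕ) :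
    1 + (n : ℂ) + z - w ≠ 0 := fun h0 =>
  h (-(1 + n)) (by push_cast; linear_combination h0)

/-- On each quadrant, the alternating sum over the Weyl group with coefficients `σ₂`, `σ₁`, `σ₁σ₂`
(or all `1`) obeys the power bound. -/
theorem GenericExponents.powerBound_weylCoeff (h : GenericExponents M A₁ A₂ η ν e₁ e₂)
    (hint : ∀ i k, i ≠ k → ∀ n : ℤ, ν i - ν k ≠ n) (hre : ∀ i, |(ν i).re| ≤ M)
    {σ₁ σ₂ : ℝ} (h₁ : σ₁ = 1 ∨ σ₁ = -1) (h₂ : σ₂ = 1 ∨ σ₂ = -1) (c : ℂ) {τ₁ τ₂ : ℝ}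
    (hτ : τ₁ = 1 ∧ τ₂ = 1 ∨ τ₁ = σ₁ ∧ τ₂ = σ₂) :
    PowerBound M A₁ A₂ (pairComb (weylCoeff c τ₂ τ₁ (τ₁ * τ₂) τ₂ τ₁ (τ₁ * τ₂)) ν e₁ e₂ σ₁ σ₂) := by
  have hup i : (ν i).re ≤ M := (abs_le.1 (hre i)).2
  have hlo i : -M ≤ (ν i).re := (abs_le.1 (hre i)).1
  have col (i k j : Fin 3) (hik : i ≠ k) (hij : i ≠ j) (hkj : k ≠ j) :=
    h.powerBound_column hik hij hkj (hint i k hik)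
      (one_add_natCast_add_sub_ne_zero (hint j i hij.symm))
      (one_add_natCast_add_sub_ne_zero (hint j k hkj.symm)) (hup i) (hup k) (hlo j)
  have row (i j k : Fin 3) (hjk : j ≠ k) (hij : i ≠ j) (hik : i ≠ k) :=
    h.powerBound_row hjk hij hik (hint j k hjk)
      (one_add_natCast_add_sub_ne_zero (hint j i hij.symm))
      (one_add_natCast_add_sub_ne_zero (hint k i hik.symm)) (hup i) (hlo j) (hlo k)
  have pair (i j : Fin 3) (hij : i ≠ j) :=
    h.powerBound_pair hij (hint i j hij) (hre i) (hre j)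
  rcases h₁ with rfl | rfl <;> rcases h₂ with rfl | rfl
  · refine ((h.powerBound_full hint hre).const_mul c).congr fun X Y => ?_
    rw [pairComb_weylCoeff]
    rcases hτ with ⟨rfl, rfl⟩ | ⟨rfl, rfl⟩ <;> push_cast <;> ring
  · have := (((col 2 1 0 (by decide) (by decide) (by decide)).const_mul τ₂).add
      ((col 1 0 2 (by decide) (by decide) (by decide)).const_mul τ₁)).add
      ((col 0 2 1 (by decide) (by decide) (by decide)).const_mul τ₂)
    refine (this.const_mul c).congr fun X Y => ?_
    rw [pairComb_weylCoeff]
    rcases hτ with ⟨rfl, rfl⟩ | ⟨rfl, rfl⟩ <;> push_cast <;> ring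
  · have := (((row 2 0 1 (by decide) (by decide) (by decide)).const_mul τ₂).add
      ((row 1 2 0 (by decide) (by decide) (by decide)).const_mul τ₁)).add
      ((row 0 1 2 (by decide) (by decide) (by decide)).const_mul τ₁)
    refine (this.const_mul c).congr fun X Y => ?_
    rw [pairComb_weylCoeff]
    rcases hτ with ⟨rfl, rfl⟩ | ⟨rfl, rfl⟩ <;> push_cast <;> ring
  · have := (((pair 2 0 (by decide)).const_mul τ₂).add
      ((pair 1 2 (by decide)).const_mul τ₁)).add
      ((pair 0 1 (by decide)).const_mul (τ₁ * τ₂))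
    refine (this.const_mul c).congr fun X Y => ?_
    rw [pairComb_weylCoeff]
    rcases hτ with ⟨rfl, rfl⟩ | ⟨rfl, rfl⟩ <;> push_cast <;> ring

end

theorem sign_eq_of_mul_pos {σ y : ℝ} (hσ : σ = 1 ∨ σ = -1) (h : 0 < σ * y) :
    Real.sign y = σ := by
  rcases hσ with rfl | rfl
  · exact Real.sign_of_pos (by linarith)
  · exact Real.sign_of_neg (by linarith)

theorem exists_bound_K0wl_K1wl (d : ℕ) {X : ℝ} (hX : 0 ≤ X) {μ₁ μ₂ μ₃ : ℂ}
    (hμ : μ₁ + μ₂ + μ₃ = 0) (hr₁ : |μ₁.re| ≤ X) (hr₂ : |μ₂.re| ≤ X) (hr₃ : |μ₃.re| ≤ X)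
    (h₁₂ : ∀ n : ℤ, μ₁ - μ₂ ≠ (n : ℂ)) (h₁₃ : ∀ n : ℤ, μ₁ - μ₃ ≠ (n : ℂ))
    (h₂₃ : ∀ n : ℤ, μ₂ - μ₃ ≠ (n : ℂ)) (j₁ j₂ : ℕ) {ε : ℝ} (hε : 0 < ε) :
    ∃ C : ℝ, 0 < C ∧ ∀ y₁ y₂ : ℝ, y₁ * y₂ ≠ 0 →
        ‖(((y₁ * y₂ : ℝ) : ℂ))⁻¹ *
            (eulerOp1^[j₁] (eulerOp2^[j₂]
              (fun a b => if d = 0 then K0wl a b μ₁ μ₂ μ₃ else K1wl a b μ₁ μ₂ μ₃))) y₁ y₂‖ ≤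
          C * ((|y₁| ^ (-X - ε) +
                |y₁| ^ ((2 / 3) * (j₁ : ℝ) + (1 / 3) * (j₂ : ℝ) +
                  (1 / 6) * max 0 (3 * X - (j₁ : ℝ) - (j₂ : ℝ)) + ε)) *
              (|y₂| ^ (-X - ε) +
                |y₂| ^ ((1 / 3) * (j₁ : ℝ) + (2 / 3) * (j₂ : ℝ) +
                  (1 / 6) * max 0 (3 * X - (j₁ : ℝ) - (j₂ : ℝ)) + ε))) := by
  have flip {z w : ℂ} (h : ∀ n : ℤ, z - w ≠ (n : ℂ)) (n : ℤ) : w - z ≠ (n : ℂ) := fun h0 =>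
    h (-n) (by push_cast; linear_combination -h0)
  have hint : ∀ i k : Fin 3, i ≠ k → ∀ n : ℤ, ![μ₁, μ₂, μ₃] i - ![μ₁, μ₂, μ₃] k ≠ n := by
    intro i k hik
    fin_cases i <;> fin_cases k <;>
      first
        | exact absurd rfl hik
        | exact h₁₂ | exact h₁₃ | exact h₂₃ | exact flip h₁₂ | exact flip h₁₃ | exact flip h₂₃
  have hre : ∀ i, |(![μ₁, μ₂, μ₃] i).re| ≤ X := by
    intro i
    fin_cases i
    exacts [hr₁, hr₂, hr₃]
  refine exists_bound_of_isPairComb hX (ν := ![μ₁, μ₂, μ₃])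
    (by simpa [Fin.sum_univ_three] using hμ) hε fun σ₁ σ₂ hσ₁ hσ₂ => ?_
  by_cases hd : d = 0
  · refine ⟨_, isPairComb_weylCoeff hσ₁ hσ₂ fun y₁ y₂ hy₁ hy₂ => ?_, fun A₁ A₂ η h =>
      h.powerBound_weylCoeff hint hre hσ₁ hσ₂ (-(1 / (16 * (Real.pi : ℂ))) /
      (Complex.sin ((Real.pi : ℂ) / 2 * (μ₁ - μ₂)) * Complex.sin ((Real.pi : ℂ) / 2 * (μ₁ - μ₃)) *
        Complex.sin ((Real.pi : ℂ) / 2 * (μ₂ - μ₃)))) (τ₁ := 1) (τ₂ := 1) (Or.inl ⟨rfl, rfl⟩)⟩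
    rw [if_pos hd, K0wl, Jsign, Jsign]
    push_cast
    ring
  · refine ⟨_, isPairComb_weylCoeff hσ₁ hσ₂ fun y₁ y₂ hy₁ hy₂ => ?_, fun A₁ A₂ η h =>
      h.powerBound_weylCoeff hint hre hσ₁ hσ₂ (-(1 / (16 * (Real.pi : ℂ))) /
      (Complex.cos ((Real.pi : ℂ) / 2 * (μ₁ - μ₃)) * Complex.cos ((Real.pi : ℂ) / 2 * (μ₂ - μ₃)) *
        Complex.sin ((Real.pi : ℂ) / 2 * (μ₁ - μ₂)))) (τ₁ := σ₁) (τ₂ := σ₂) (Or.inr ⟨rfl, rfl⟩)⟩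
    rw [if_neg hd, K1wl, Jsign, Jsign, sign_eq_of_mul_pos hσ₁ hy₁, sign_eq_of_mul_pos hσ₂ hy₂]
    ring

theorem exists_bound_Kdwl {d : ℕ} (hd : 2 ≤ d) {X : ℝ} (hX : 0 ≤ X) {r : ℂ}
    (hr : |(2 * r).re| ≤ X) (hcos : Complex.cos ((Real.pi : ℂ) * ((d : ℂ) / 2 + 3 * r)) ≠ 0)
    (j₁ j₂ : ℕ) {ε : ℝ} (hε : 0 < ε) :
    ∃ C : ℝ, 0 < C ∧ ∀ y₁ y₂ : ℝ, y₁ * y₂ ≠ 0 →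
        ‖(((y₁ * y₂ : ℝ) : ℂ))⁻¹ *
            (eulerOp1^[j₁] (eulerOp2^[j₂] (fun a b => Kdwl d a b r))) y₁ y₂‖ ≤
          C * ((|y₁| ^ (-X - ε) +
                |y₁| ^ ((2 / 3) * (j₁ : ℝ) + (1 / 3) * (j₂ : ℝ) +
                  (1 / 6) * max 0 (3 * X - (j₁ : ℝ) - (j₂ : ℝ)) + ε)) *
              (|y₂| ^ (-X - ε) +
                |y₂| ^ ((1 / 3) * (j₁ : ℝ) + (2 / 3) * (j₂ : ℝ) +
                  (1 / 6) * max 0 (3 * X - (j₁ : ℝ) - (j₂ : ℝ)) + ε))) := by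
  set ν : Fin 3 → ℂ := ![((d : ℂ) - 1) / 2 + r, -(((d : ℂ) - 1) / 2) + r, -2 * r] with hνdef
  have v0 : ν 0 = ((d : ℂ) - 1) / 2 + r := rfl
  have v1 : ν 1 = -(((d : ℂ) - 1) / 2) + r := rfl
  have v2 : ν 2 = -2 * r := rfl
  obtain ⟨m, rfl⟩ : ∃ m : ℕ, d = m + 1 := ⟨d - 1, by omega⟩
  have hm : ν 0 - ν 1 = m := by rw [v0, v1]; push_cast; ring
  have hint0 (n : ℤ) : ν 0 - ν 2 ≠ n := fun h => hcos <| Complex.cos_eq_zero_iff.2 ⟨n, by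
    rw [← h, v0, v2]; push_cast; ring⟩
  have hint1 (n : ℤ) : ν 1 - ν 2 ≠ n := fun h => hint0 (n + m) (by
    push_cast; rw [← h, ← hm]; ring)
  have hint2 (n : ℤ) : ν 2 - ν 1 ≠ n := fun h => hint1 (-n) (by push_cast; rw [← h]; ring)
  have hint3 (n : ℤ) : ν 2 - ν 0 ≠ n := fun h => hint0 (-n) (by push_cast; rw [← h]; ring)
  have hnat (n : ℕ) : 1 + (n : ℂ) + ν 0 - ν 1 ≠ 0 := by
    have : 1 + (n : ℂ) + ν 0 - ν 1 = ((1 + n + m : ℕ) : ℂ) := by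
      push_cast
      rw [← hm]
      ring
    rw [this]
    exact Nat.cast_ne_zero.2 (by omega)
  have hr' : |2 * r.re| ≤ X := by simpa using hr
  obtain ⟨hr1, hr2⟩ := abs_le.1 hr'
  have hm0 : (0 : ℝ) ≤ m := m.cast_nonneg
  have re0 : (ν 0).re = (m : ℝ) / 2 + r.re := by
    have : ν 0 = (((m : ℝ) / 2 : ℝ) : ℂ) + r := by rw [v0]; push_cast; ring
    rw [this, Complex.add_re, Complex.ofReal_re]
  have re1 : (ν 1).re = -((m : ℝ) / 2) + r.re := by
    have : ν 1 = ((-((m : ℝ) / 2) : ℝ) : ℂ) + r := by rw [v1]; push_cast; ring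
    rw [this, Complex.add_re, Complex.ofReal_re]
  have re2 : (ν 2).re = -(2 * r.re) := by rw [v2]; simp
  have b0 : -X ≤ (ν 0).re := by rw [re0]; linarith
  have b1 : (ν 1).re ≤ X := by rw [re1]; linarith
  have b2 : |(ν 2).re| ≤ X := by rw [re2, abs_neg]; exact hr'
  obtain ⟨b2l, b2u⟩ := abs_le.1 b2
  set c₀ : ℂ := -(1 / (4 * (Real.pi : ℂ) *
    Complex.cos ((Real.pi : ℂ) * (((m + 1 : ℕ) : ℂ) / 2 + 3 * r)))) with hc₀
  refine exists_bound_of_isPairComb hX (ν := ν)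
    (by rw [Fin.sum_univ_three, v0, v1, v2]; ring) hε ?_
  rintro σ₁ σ₂ (rfl | rfl) (rfl | rfl)
  · refine ⟨_, isPairComb_weylCoeff (c := 0) (a₁ := 0) (a₂ := 0) (a₃ := 0) (b₁ := 0) (b₂ := 0)
      (b₃ := 0) (by simp) (by simp) fun y₁ y₂ hy₁ hy₂ => ?_, fun A₁ A₂ η h =>
      PowerBound.zero.congr fun _ _ => ?_⟩
    · have h1 : ¬ y₁ < 0 := by linarith
      have h2 : ¬ y₂ < 0 := by linarith
      have h3 : ¬ y₁ * y₂ < 0 := by nlinarith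
      simp [Kdwl, h1, h2, h3]
    · rw [pairComb_weylCoeff]; simp
  · refine ⟨_, isPairComb_weylCoeff (c := c₀) (a₁ := (-1) ^ (m + 1)) (a₂ := 0) (a₃ := 0)
      (b₁ := 0) (b₂ := 0) (b₃ := (-1) ^ (m + 1)) (by simp) (by simp) fun y₁ y₂ hy₁ hy₂ => ?_,
      fun A₁ A₂ η h => ((h.powerBound_column (i := 2) (k := 1) (j := 0) (by decide) (by decide)
        (by decide) hint2 (one_add_natCast_add_sub_ne_zero hint0) hnat b2u b1 b0).const_mul
        (c₀ * (-1) ^ (m + 1))).congr fun _ _ => ?_⟩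
    · have h1 : ¬ y₁ < 0 := by linarith
      have h2 : y₂ < 0 := by linarith
      have h3 : y₁ * y₂ < 0 := by nlinarith
      rw [Kdwl, ← hc₀, if_neg h1, if_pos h2, if_pos h3, sign_eq_of_mul_pos (Or.inl rfl) hy₁]
      push_cast
      ring
    · rw [pairComb_weylCoeff]; push_cast; ring
  · refine ⟨_, isPairComb_weylCoeff (c := c₀) (a₁ := 0) (a₂ := 1) (a₃ := 0)
      (b₁ := 0) (b₂ := 0) (b₃ := 1) (by simp) (by simp) fun y₁ y₂ hy₁ hy₂ => ?_,
      fun A₁ A₂ η h => ((h.powerBound_row (i := 1) (j := 2) (k := 0) (by decide) (by decide)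
        (by decide) hint3 (one_add_natCast_add_sub_ne_zero hint2) hnat b1 b2l b0).const_mul
        c₀).congr fun _ _ => ?_⟩
    · have h1 : y₁ < 0 := by linarith
      have h2 : ¬ y₂ < 0 := by linarith
      have h3 : y₁ * y₂ < 0 := by nlinarith
      rw [Kdwl, ← hc₀, if_pos h1, if_neg h2, if_pos h3, sign_eq_of_mul_pos (Or.inr rfl) hy₁,
        sign_eq_of_mul_pos (Or.inl rfl) hy₂]
      push_cast
      simp only [neg_neg, one_pow]
      ring
    · rw [pairComb_weylCoeff]; push_cast; ring
  · refine ⟨_, isPairComb_weylCoeff (c := c₀) (a₁ := 1) (a₂ := (-1) ^ (m + 1)) (a₃ := 0)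
      (b₁ := 0) (b₂ := 0) (b₃ := 0) (by simp) (by simp) fun y₁ y₂ hy₁ hy₂ => ?_,
      fun A₁ A₂ η h => ((h.powerBound_degenerate hm hint0 b0 b1 b2).const_mul
        c₀).congr fun _ _ => ?_⟩
    · have h1 : y₁ < 0 := by linarith
      have h2 : y₂ < 0 := by linarith
      have h3 : ¬ y₁ * y₂ < 0 := by nlinarith
      rw [Kdwl, ← hc₀, if_pos h1, if_pos h2, if_neg h3, sign_eq_of_mul_pos (Or.inr rfl) hy₁,
        sign_eq_of_mul_pos (Or.inr rfl) hy₂]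
      push_cast
      simp only [neg_neg, one_pow]
      ring
    · rw [pairComb_weylCoeff]; push_cast; ring

/-- Bounds for the iterated Euler derivatives of the GL(3) long-element Bessel functions. -/
theorem stmt19 :
    (∀ (d : ℕ), d ≤ 1 → ∀ (X : ℝ), 0 ≤ X → ∀ μ₁ μ₂ μ₃ : ℂ,
      μ₁ + μ₂ + μ₃ = 0 → |μ₁.re| ≤ X → |μ₂.re| ≤ X → |μ₃.re| ≤ X →
      (∀ n : ℤ, μ₁ - μ₂ ≠ (n : ℂ)) → (∀ n : ℤ, μ₁ - μ₃ ≠ (n : ℂ)) →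
      (∀ n : ℤ, μ₂ - μ₃ ≠ (n : ℂ)) →
      ∀ (j₁ j₂ : ℕ) (ε : ℝ), 0 < ε →
      ∃ C : ℝ, 0 < C ∧ ∀ y₁ y₂ : ℝ, y₁ * y₂ ≠ 0 →
        ‖(((y₁ * y₂ : ℝ) : ℂ))⁻¹ *
            (eulerOp1^[j₁] (eulerOp2^[j₂]
              (fun a b => if d = 0 then K0wl a b μ₁ μ₂ μ₃ else K1wl a b μ₁ μ₂ μ₃))) y₁ y₂‖ ≤
          C * ((|y₁| ^ (-X - ε) +
                |y₁| ^ ((2 / 3) * (j₁ : ℝ) + (1 / 3) * (j₂ : ℝ) +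
                  (1 / 6) * max 0 (3 * X - (j₁ : ℝ) - (j₂ : ℝ)) + ε)) *
              (|y₂| ^ (-X - ε) +
                |y₂| ^ ((1 / 3) * (j₁ : ℝ) + (2 / 3) * (j₂ : ℝ) +
                  (1 / 6) * max 0 (3 * X - (j₁ : ℝ) - (j₂ : ℝ)) + ε)))) ∧
    (∀ (d : ℕ), 2 ≤ d → ∀ (X : ℝ), 0 ≤ X → ∀ r : ℂ, |(2 * r).re| ≤ X →
      Complex.cos ((Real.pi : ℂ) * ((d : ℂ) / 2 + 3 * r)) ≠ 0 →
      ∀ (j₁ j₂ : ℕ) (ε : ℝ), 0 < ε →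
      ∃ C : ℝ, 0 < C ∧ ∀ y₁ y₂ : ℝ, y₁ * y₂ ≠ 0 →
        ‖(((y₁ * y₂ : ℝ) : ℂ))⁻¹ *
            (eulerOp1^[j₁] (eulerOp2^[j₂] (fun a b => Kdwl d a b r))) y₁ y₂‖ ≤
          C * ((|y₁| ^ (-X - ε) +
                |y₁| ^ ((2 / 3) * (j₁ : ℝ) + (1 / 3) * (j₂ : ℝ) +
                  (1 / 6) * max 0 (3 * X - (j₁ : ℝ) - (j₂ : ℝ)) + ε)) *
              (|y₂| ^ (-X - ε) +
                |y₂| ^ ((1 / 3) * (j₁ : ℝ) + (2 / 3) * (j₂ : ℝ) +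
                  (1 / 6) * max 0 (3 * X - (j₁ : ℝ) - (j₂ : ℝ)) + ε)))) := by
  exact ⟨fun d _ _ hX _ _ _ hμ hr₁ hr₂ hr₃ h₁₂ h₁₃ h₂₃ j₁ j₂ _ hε =>
      exists_bound_K0wl_K1wl d hX hμ hr₁ hr₂ hr₃ h₁₂ h₁₃ h₂₃ j₁ j₂ hε,
    fun _ hd _ hX _ hr hcos j₁ j₂ _ hε => exists_bound_Kdwl hd hX hr hcos j₁ j₂ hε⟩
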